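/- arXiv:1505.00667 — 5 statements merged into one kernel-verified Lean document; each statement's English description precedes it below -/
import Mathlib

section
/- The real number σ² is transcendental over ℚ (equivalently, σ² is not the root of any nonzero polynomial with rational coefficients). -/
namespace Paper

/-- `s i = 2^{ν₂(i+1)}`, the largest power of 2 dividing `i+1`. -/
def s (i : ℕ) : ℕ := 2 ^ padicValNat 2 (i + 1)

/-- Continuant numerators, shifted by 2: `p 0 = p_{-2} = 0`, `p 1 = p_{-1} = 1`,
and `p (n+2) = p_n = s_n p_{n-1} + p_{n-2}`. -/
def p : ℕ → ℤ
  | 0 => 0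
  | 1 => 1
  | n + 2 => (s n : ℤ) * p (n + 1) + p n

/-- Continuant denominators, shifted by 2: `q 0 = q_{-2} = 1`, `q 1 = q_{-1} = 0`,
and `q (n+2) = q_n = s_n q_{n-1} + q_{n-2}`. -/
def q : ℕ → ℤ
  | 0 => 1
  | 1 => 0
  | n + 2 => (s n : ℤ) * q (n + 1) + q n

/-- Hurwitz–Kolden–Frame matrix of a finite sequence. -/
def M (l : List ℤ) : Matrix (Fin 2) (Fin 2) ℤ :=
  (l.map fun a => !![a, 1; 1, 0]).prod

/-- `u n = (s_1, s_2, ..., s_{2^n - 3})`. -/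
def u (n : ℕ) : List ℤ := (List.range (2 ^ n - 3)).map fun i => (s (i + 1) : ℤ)

/-- `v n = (s_1, s_2, ..., s_{2^n - 2})`. -/
def v (n : ℕ) : List ℤ := (List.range (2 ^ n - 2)).map fun i => (s (i + 1) : ℤ)

def c (n : ℕ) : ℤ := M (u n) 0 0
def e (n : ℕ) : ℤ := M (u n) 0 1
def d (n : ℕ) : ℤ := M (u n) 1 0
def f (n : ℕ) : ℤ := M (u n) 1 1
def w (n : ℕ) : ℤ := M (v n) 0 0
def y (n : ℕ) : ℤ := M (v n) 0 1
def x (n : ℕ) : ℤ := M (v n) 1 0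
def z (n : ℕ) : ℤ := M (v n) 1 1
def g (n : ℕ) : ℤ := c n + 2 * e n + f n
def r (n : ℕ) : ℤ := 2 ^ n * (w n + x n) + w n + y n + z n

end Paper

open Paper Filter Real

namespace RulerCF

lemma s_two_pow_add {k j : ℕ} (h : j + 1 < 2 ^ k) : s (2 ^ k + j) = s j := by
  have hk : padicValNat 2 (j + 1) < k := by
    by_contra! hle
    exact absurd (Nat.le_of_dvd (by omega) ((pow_dvd_pow 2 hle).trans pow_padicValNat_dvd))
      (by omega)
  have hdvd : ∀ n, n ≤ k → (2 ^ n ∣ 2 ^ k + j + 1 ↔ 2 ^ n ∣ j + 1) := fun n hn => by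
    rw [add_assoc]; exact Nat.dvd_add_right (pow_dvd_pow 2 hn)
  unfold s
  congr 1
  apply le_antisymm
  · by_contra! hlt
    have := (hdvd (padicValNat 2 (j + 1) + 1) hk).1
      ((pow_dvd_pow 2 hlt).trans pow_padicValNat_dvd)
    exact pow_succ_padicValNat_not_dvd (by omega) this
  · exact (padicValNat_dvd_iff_le (by omega)).1 ((hdvd _ hk.le).2 pow_padicValNat_dvd)

lemma s_two_pow_sub_one (k : ℕ) : s (2 ^ k - 1) = 2 ^ k := by
  unfold s
  rw [Nat.sub_add_cancel Nat.one_le_two_pow, padicValNat.prime_pow]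

lemma p_two_pow_add (k : ℕ) : ∀ j, j ≤ 2 ^ k →
    p (2 ^ k + j) = p (2 ^ k) * q j + p (2 ^ k + 1) * p j
  | 0, _ => by simp [p, q]
  | 1, _ => by simp [p, q]
  | j + 2, h => by
    have h1 := p_two_pow_add k j (by omega)
    have h2 := p_two_pow_add k (j + 1) (by omega)
    rw [← add_assoc, p, p, q, s_two_pow_add (by omega), add_assoc, h1, h2]
    ring

lemma q_two_pow_add (k : ℕ) : ∀ j, j ≤ 2 ^ k →
    q (2 ^ k + j) = q (2 ^ k) * q j + q (2 ^ k + 1) * p j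
  | 0, _ => by simp [p, q]
  | 1, _ => by simp [p, q]
  | j + 2, h => by
    have h1 := q_two_pow_add k j (by omega)
    have h2 := q_two_pow_add k (j + 1) (by omega)
    rw [← add_assoc, q, p, q, s_two_pow_add (by omega), add_assoc, h1, h2]
    ring

lemma p_mul_q_sub (n : ℕ) : p (n + 1) * q n - p n * q (n + 1) = (-1) ^ n := by
  induction n with
  | zero => simp [p, q]
  | succ n ih => rw [p, q, pow_succ, ← ih]; ring

lemma p_two_pow_add_one (k : ℕ) :
    p (2 ^ k + 1) = 2 ^ k * p (2 ^ k) + p (2 ^ k - 1) := by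
  obtain ⟨n, hn⟩ : ∃ n, 2 ^ k = n + 1 := ⟨2 ^ k - 1, (Nat.sub_add_cancel Nat.one_le_two_pow).symm⟩
  have h := s_two_pow_sub_one k
  simp only [hn, Nat.add_sub_cancel] at h ⊢
  rw [p, h, ← hn]
  push_cast
  ring

lemma q_two_pow_add_one (k : ℕ) :
    q (2 ^ k + 1) = 2 ^ k * q (2 ^ k) + q (2 ^ k - 1) := by
  obtain ⟨n, hn⟩ : ∃ n, 2 ^ k = n + 1 := ⟨2 ^ k - 1, (Nat.sub_add_cancel Nat.one_le_two_pow).symm⟩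
  have h := s_two_pow_sub_one k
  simp only [hn, Nat.add_sub_cancel] at h ⊢
  rw [q, h, ← hn]
  push_cast
  ring

lemma det_two_pow (k : ℕ) :
    p (2 ^ (k + 1)) * q (2 ^ (k + 1) - 1) - p (2 ^ (k + 1) - 1) * q (2 ^ (k + 1)) = -1 := by
  have h := p_mul_q_sub (2 ^ (k + 1) - 1)
  rw [Nat.sub_add_cancel Nat.one_le_two_pow] at h
  rw [h]
  exact Odd.neg_one_pow ⟨2 ^ k - 1, by have := Nat.one_le_two_pow (n := k); rw [pow_succ]; omega⟩

/-- The truncation before the first partial quotient `2 ^ (k + 1)` is a palindrome. -/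
lemma p_two_pow_sub_one (k : ℕ) : p (2 ^ (k + 1) - 1) = q (2 ^ (k + 1)) := by
  induction k with
  | zero => simp [p, q, s]
  | succ k ih =>
    have h1 := Nat.one_le_two_pow (n := k + 1)
    have e1 : 2 ^ (k + 1 + 1) - 1 = 2 ^ (k + 1) + (2 ^ (k + 1) - 1) := by
      rw [pow_succ 2 (k + 1)]; omega
    have e2 : 2 ^ (k + 1 + 1) = 2 ^ (k + 1) + 2 ^ (k + 1) := by rw [pow_succ 2 (k + 1)]; omega
    rw [e1, p_two_pow_add _ _ (by omega), e2, q_two_pow_add _ _ le_rfl, p_two_pow_add_one,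
      q_two_pow_add_one, ih]
    ring

/-- Numerator of the truncation before the first partial quotient `2 ^ (k + 1)`. -/
def num (k : ℕ) : ℤ := p (2 ^ (k + 1))

/-- Denominator of the truncation before the first partial quotient `2 ^ (k + 1)`. -/
def den (k : ℕ) : ℤ := q (2 ^ (k + 1))

lemma num_succ (k : ℕ) : num (k + 1) = num k * (2 ^ (k + 1) * num k + 2 * den k) := by
  have e2 : 2 ^ (k + 1 + 1) = 2 ^ (k + 1) + 2 ^ (k + 1) := by rw [pow_succ 2 (k + 1)]; omega
  unfold num den
  rw [e2, p_two_pow_add _ _ le_rfl, p_two_pow_add_one, p_two_pow_sub_one]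
  ring

lemma den_succ (k : ℕ) : den (k + 1) = den k * (2 ^ (k + 1) * num k + 2 * den k) - 1 := by
  have e2 : 2 ^ (k + 1 + 1) = 2 ^ (k + 1) + 2 ^ (k + 1) := by rw [pow_succ 2 (k + 1)]; omega
  have h := det_two_pow k
  rw [p_two_pow_sub_one] at h
  unfold num den
  rw [e2, q_two_pow_add _ _ le_rfl, q_two_pow_add_one]
  linear_combination h

lemma num_den_pos (k : ℕ) : 1 ≤ num k ∧ 1 ≤ den k := by
  induction k with
  | zero => simp [num, den, p, q, s]
  | succ k ih =>
    obtain ⟨ha, hb⟩ := ih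
    have h2 : (1 : ℤ) ≤ 2 ^ (k + 1) := one_le_pow₀ (by norm_num)
    have ht : 2 ≤ 2 ^ (k + 1) * num k + 2 * den k := by nlinarith
    rw [num_succ, den_succ]
    constructor <;> nlinarith

/-- The partial quotient following the `k`-th palindromic prefix. -/
noncomputable def pw (k : ℕ) : ℝ := 2 ^ (k + 1)

/-- Reciprocal of the numerator of the `k`-th palindromic prefix. -/
noncomputable def eps (k : ℕ) : ℝ := 1 / num k

/-- Reciprocal of the convergent given by the `k`-th palindromic prefix. -/
noncomputable def rho (k : ℕ) : ℝ := den k / num k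

lemma num_pos (k : ℕ) : (0 : ℝ) < num k := by
  exact_mod_cast (num_den_pos k).1

lemma den_pos (k : ℕ) : (0 : ℝ) < den k := by
  exact_mod_cast (num_den_pos k).2

lemma eps_pos (k : ℕ) : 0 < eps k := one_div_pos.2 (num_pos k)

lemma rho_pos (k : ℕ) : 0 < rho k := div_pos (den_pos k) (num_pos k)

lemma two_le_pw (k : ℕ) : 2 ≤ pw k := by
  unfold pw
  rw [pow_succ]
  linarith [one_le_pow₀ (M₀ := ℝ) (a := 2) (n := k) (by norm_num)]

lemma pw_succ (k : ℕ) : pw (k + 1) = 2 * pw k := by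
  unfold pw; ring

lemma pw_add_pos (k : ℕ) : 0 < pw k + 2 * rho k := by
  linarith [two_le_pw k, rho_pos k]

lemma eps_succ (k : ℕ) : eps (k + 1) = eps k ^ 2 / (pw k + 2 * rho k) := by
  have h := num_pos k
  have h' := den_pos k
  have h2 : (0 : ℝ) < 2 ^ (k + 1) := by positivity
  unfold eps rho pw
  rw [num_succ]
  push_cast
  field_simp

lemma rho_succ (k : ℕ) : rho (k + 1) = rho k - eps (k + 1) := by
  have h := num_pos k
  have h' := den_pos k
  have h2 : (0 : ℝ) < 2 ^ (k + 1) := by positivity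
  unfold eps rho
  rw [num_succ, den_succ]
  push_cast
  field_simp

lemma eps_le_one (k : ℕ) : eps k ≤ 1 := by
  unfold eps
  rw [div_le_one (num_pos k)]
  exact_mod_cast (num_den_pos k).1

lemma eps_succ_le_sq (k : ℕ) : eps (k + 1) ≤ eps k ^ 2 := by
  rw [eps_succ]
  exact div_le_self (sq_nonneg _) (by linarith [two_le_pw k, rho_pos k])

lemma eps_succ_le_div (k : ℕ) : eps (k + 1) ≤ eps k / pw k := by
  have h0 := eps_pos k
  have h1 := two_le_pw k
  rw [eps_succ]
  apply div_le_div₀ h0.le _ (by linarith) (by linarith [rho_pos k])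
  nlinarith [eps_le_one k]

lemma eps_succ_le_half (k : ℕ) : eps (k + 1) ≤ eps k / 2 :=
  (eps_succ_le_div k).trans
    (div_le_div_of_nonneg_left (eps_pos k).le (by norm_num) (two_le_pw k))

lemma rho_antitone : Antitone rho :=
  antitone_nat_of_succ_le fun k => by rw [rho_succ]; linarith [eps_pos (k + 1)]

lemma rho_sub_eps_monotone : Monotone fun k => rho k - 2 * eps k :=
  monotone_nat_of_le_succ fun k => by
    simp only [rho_succ]; linarith [eps_succ_le_half k, eps_pos k]

lemma tendsto_pw_pow_mul_eps (C : ℕ) : Tendsto (fun k => pw k ^ C * eps k) atTop (nhds 0) := by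
  have hpos : ∀ k, 0 < pw k ^ C * eps k := fun k =>
    mul_pos (pow_pos (by linarith [two_le_pw k]) _) (eps_pos k)
  have hpw : Tendsto pw atTop atTop :=
    (tendsto_pow_atTop_atTop_of_one_lt (by norm_num : (1 : ℝ) < 2)).comp (tendsto_add_atTop_nat 1)
  refine (summable_of_ratio_norm_eventually_le (r := 1 / 2) (by norm_num) ?_).tendsto_atTop_zero
  filter_upwards [hpw.eventually_ge_atTop (2 * 2 ^ C)] with k hk
  rw [norm_of_nonneg (hpos _).le, norm_of_nonneg (hpos _).le, pw_succ, mul_pow]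
  have h1 := eps_succ_le_div k
  have h2 := two_le_pw k
  have h3 : 0 < pw k ^ C := pow_pos (by linarith) _
  have h4 : 2 ^ C * (eps k / pw k) ≤ 1 / 2 * eps k := by
    rw [← mul_div_assoc, div_le_iff₀ (by linarith)]
    nlinarith [eps_pos k]
  have h5 : (2 : ℝ) ^ C * eps (k + 1) ≤ 1 / 2 * eps k :=
    (mul_le_mul_of_nonneg_left h1 (by positivity)).trans h4
  nlinarith

/-- `x k = O(eps k ^ n)` up to a power of `2 ^ k`. -/
def IsSmall (n : ℕ) (x : ℕ → ℝ) : Prop :=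
  ∃ C : ℕ, x =O[atTop] fun k => pw k ^ C * eps k ^ n

lemma isBigO_pw_pow_eps_pow {C D n n' : ℕ} (hC : C ≤ D) (hn : n' ≤ n) :
    (fun k => pw k ^ C * eps k ^ n) =O[atTop] fun k => pw k ^ D * eps k ^ n' := by
  refine Asymptotics.IsBigO.of_bound 1 (Eventually.of_forall fun k => ?_)
  have h1 := two_le_pw k
  have h2 := eps_pos k
  rw [norm_of_nonneg (by positivity), norm_of_nonneg (by positivity), one_mul]
  exact mul_le_mul (pow_le_pow_right₀ (by linarith) hC)
    (pow_le_pow_of_le_one h2.le (eps_le_one k) hn) (by positivity) (by positivity)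

lemma IsSmall.mono {n n' : ℕ} {x : ℕ → ℝ} (h : IsSmall n x) (hn : n' ≤ n) : IsSmall n' x := by
  obtain ⟨C, hC⟩ := h
  exact ⟨C, hC.trans (isBigO_pw_pow_eps_pow le_rfl hn)⟩

lemma IsSmall.add {n : ℕ} {x y : ℕ → ℝ} (hx : IsSmall n x) (hy : IsSmall n y) :
    IsSmall n fun k => x k + y k := by
  obtain ⟨C, hC⟩ := hx
  obtain ⟨D, hD⟩ := hy
  exact ⟨max C D, (hC.trans (isBigO_pw_pow_eps_pow (le_max_left _ _) le_rfl)).add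
    (hD.trans (isBigO_pw_pow_eps_pow (le_max_right _ _) le_rfl))⟩

lemma IsSmall.mul {n n' : ℕ} {x y : ℕ → ℝ} (hx : IsSmall n x) (hy : IsSmall n' y) :
    IsSmall (n + n') fun k => x k * y k := by
  obtain ⟨C, hC⟩ := hx
  obtain ⟨D, hD⟩ := hy
  refine ⟨C + D, (hC.mul hD).congr_right fun k => ?_⟩
  ring

lemma isSmall_const (c : ℝ) : IsSmall 0 fun _ => c := by
  refine ⟨0, ?_⟩
  simpa using Asymptotics.isBigO_const_const c (one_ne_zero (α := ℝ)) atTop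

lemma isSmall_zero (n : ℕ) : IsSmall n fun _ => 0 :=
  ⟨0, Asymptotics.isBigO_zero _ _⟩

lemma IsSmall.const_mul {n : ℕ} {x : ℕ → ℝ} (hx : IsSmall n x) (c : ℝ) :
    IsSmall n fun k => c * x k := by
  simpa using (isSmall_const c).mul hx

lemma IsSmall.sub {n : ℕ} {x y : ℕ → ℝ} (hx : IsSmall n x) (hy : IsSmall n y) :
    IsSmall n fun k => x k - y k := by
  simpa [sub_eq_add_neg] using hx.add (hy.const_mul (-1))

lemma IsSmall.sum {ι : Type*} (S : Finset ι) {n : ℕ} {x : ι → ℕ → ℝ}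
    (hx : ∀ i ∈ S, IsSmall n (x i)) : IsSmall n fun k => ∑ i ∈ S, x i k := by
  classical
  induction S using Finset.induction_on with
  | empty => simpa using isSmall_zero n
  | insert i S hi ih =>
    simp only [Finset.sum_insert hi]
    exact (hx i (by simp)).add (ih fun j hj => hx j (by simp [hj]))

lemma isSmall_pw : IsSmall 0 pw :=
  ⟨1, by simpa using Asymptotics.isBigO_refl pw atTop⟩

lemma isSmall_eps : IsSmall 1 eps :=
  ⟨0, by simpa using Asymptotics.isBigO_refl eps atTop⟩

lemma IsSmall.pow {n : ℕ} {x : ℕ → ℝ} (hx : IsSmall n x) (j : ℕ) :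
    IsSmall (n * j) fun k => x k ^ j := by
  induction j with
  | zero => simpa using isSmall_const 1
  | succ j ih => simpa [pow_succ, mul_add] using ih.mul hx

lemma isSmall_of_le_one {x : ℕ → ℝ} (hx : ∀ k, |x k| ≤ 1) : IsSmall 0 x :=
  ⟨0, Asymptotics.IsBigO.of_bound 1 (Eventually.of_forall fun k => by simpa using hx k)⟩

lemma rho_le_one (k : ℕ) : rho k ≤ 1 := by
  refine (rho_antitone (Nat.zero_le k)).trans ?_
  simp [rho, num, den, p, q, s]

lemma isSmall_rho : IsSmall 0 rho :=
  isSmall_of_le_one fun k => by rw [abs_of_pos (rho_pos k)]; exact rho_le_one k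

lemma IsSmall.shift {n : ℕ} {x : ℕ → ℝ} (hx : IsSmall n x) :
    IsSmall (2 * n) fun k => x (k + 1) := by
  obtain ⟨C, hC⟩ := hx
  refine ⟨C, (hC.comp_tendsto (tendsto_add_atTop_nat 1)).trans
    (Asymptotics.IsBigO.of_bound (2 ^ C) (Eventually.of_forall fun k => ?_))⟩
  have h1 := two_le_pw k
  have h2 := eps_pos k
  have h3 := eps_pos (k + 1)
  simp only [Function.comp, pw_succ]
  rw [norm_of_nonneg (by positivity), norm_of_nonneg (by positivity), mul_pow, mul_assoc]
  refine mul_le_mul_of_nonneg_left (mul_le_mul_of_nonneg_left ?_ (by positivity)) (by positivity)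
  rw [pow_mul]
  exact pow_le_pow_left₀ h3.le (eps_succ_le_sq k) n

lemma IsSmall.tendsto_zero {x : ℕ → ℝ} (hx : IsSmall 1 x) : Tendsto x atTop (nhds 0) := by
  obtain ⟨C, hC⟩ := hx
  exact hC.trans_tendsto (by simpa using tendsto_pw_pow_mul_eps C)

lemma isSmall_aeval {ι : Type*} {v : ι → ℕ → ℝ} (hv : ∀ i, IsSmall 0 (v i))
    (F : MvPolynomial ι ℚ) : IsSmall 0 fun k => MvPolynomial.aeval (fun i => v i k) F := by
  induction F using MvPolynomial.induction_on with
  | C c => simpa using isSmall_const (c : ℝ)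
  | add F G hF hG => simpa using hF.add hG
  | mul_X F i hF => simpa using hF.mul (hv i)

lemma abs_rho_sub_le {t : ℝ} (ht : Tendsto rho atTop (nhds t)) (k : ℕ) :
    |rho k - t| ≤ 2 * eps k := by
  have h1 := rho_antitone.le_of_tendsto ht k
  have heps : Tendsto eps atTop (nhds 0) := isSmall_eps.tendsto_zero
  have h2 : rho k - 2 * eps k ≤ t :=
    rho_sub_eps_monotone.ge_of_tendsto (by simpa using ht.sub (heps.const_mul 2)) k
  rw [abs_of_nonneg (by linarith)]
  linarith

lemma isSmall_rho_sub {t : ℝ} (ht : Tendsto rho atTop (nhds t)) :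
    IsSmall 1 fun k => rho k - t :=
  ⟨0, Asymptotics.IsBigO.of_bound 2 (Eventually.of_forall fun k => by
    simpa [abs_of_pos (eps_pos k)] using abs_rho_sub_le ht k)⟩

/-- The sequence `x` agrees with a polynomial in `t`, `eps` and `pw`, divided by a polynomial in
`pw`, up to an error of order `eps ^ n`. -/
def HasExpansion (t : ℝ) (n : ℕ) (x : ℕ → ℝ) : Prop :=
  ∃ P : Polynomial ℚ, P ≠ 0 ∧ ∃ F : MvPolynomial (Fin 3) ℚ,
    IsSmall n fun k => Polynomial.aeval (pw k) P * x k - MvPolynomial.aeval ![t, eps k, pw k] F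

lemma isSmall_aeval_expansion (t : ℝ) (F : MvPolynomial (Fin 3) ℚ) :
    IsSmall 0 fun k => MvPolynomial.aeval ![t, eps k, pw k] F := by
  have h := isSmall_aeval (v := ![fun _ => t, eps, pw]) (fun i => by
    fin_cases i
    exacts [isSmall_const t, isSmall_eps.mono (Nat.zero_le _), isSmall_pw]) F
  convert h using 4 with k
  ext i
  fin_cases i <;> rfl

lemma aeval_X_two (t : ℝ) (k : ℕ) (P : Polynomial ℚ) :
    MvPolynomial.aeval ![t, eps k, pw k]
        (Polynomial.aeval (MvPolynomial.X 2 : MvPolynomial (Fin 3) ℚ) P) =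
      Polynomial.aeval (pw k) P := by
  rw [← Polynomial.aeval_algHom_apply]
  simp

lemma isSmall_aeval_pw (P : Polynomial ℚ) : IsSmall 0 fun k => Polynomial.aeval (pw k) P := by
  simpa only [aeval_X_two] using
    isSmall_aeval_expansion 0 (Polynomial.aeval (MvPolynomial.X 2 : MvPolynomial (Fin 3) ℚ) P)

section HasExpansion

variable {t : ℝ} {n : ℕ} {x y : ℕ → ℝ}

lemma HasExpansion.mono {n' : ℕ} (h : HasExpansion t n x) (hn : n' ≤ n) :
    HasExpansion t n' x := by
  obtain ⟨P, hP, F, hF⟩ := h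
  exact ⟨P, hP, F, hF.mono hn⟩

lemma hasExpansion_aeval (n : ℕ) (F : MvPolynomial (Fin 3) ℚ) :
    HasExpansion t n fun k => MvPolynomial.aeval ![t, eps k, pw k] F :=
  ⟨1, one_ne_zero, F, by simpa using isSmall_zero n⟩

lemma hasExpansion_const (n : ℕ) (c : ℚ) : HasExpansion t n fun _ => (c : ℝ) := by
  simpa using hasExpansion_aeval (t := t) n (MvPolynomial.C c)

lemma hasExpansion_self (n : ℕ) : HasExpansion t n fun _ => t := by
  simpa using hasExpansion_aeval (t := t) n (MvPolynomial.X 0)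

lemma hasExpansion_eps (n : ℕ) : HasExpansion t n eps := by
  simpa using hasExpansion_aeval (t := t) n (MvPolynomial.X 1)

lemma hasExpansion_pw (n : ℕ) : HasExpansion t n pw := by
  simpa using hasExpansion_aeval (t := t) n (MvPolynomial.X 2)

lemma IsSmall.hasExpansion (h : IsSmall n x) : HasExpansion t n x :=
  ⟨1, one_ne_zero, 0, by simpa using h⟩

lemma HasExpansion.add (hx : HasExpansion t n x) (hy : HasExpansion t n y) :
    HasExpansion t n fun k => x k + y k := by
  obtain ⟨P, hP, F, hF⟩ := hx
  obtain ⟨Q, hQ, G, hG⟩ := hy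
  refine ⟨P * Q, mul_ne_zero hP hQ,
    Polynomial.aeval (MvPolynomial.X 2 : MvPolynomial (Fin 3) ℚ) Q * F +
    Polynomial.aeval (MvPolynomial.X 2 : MvPolynomial (Fin 3) ℚ) P * G, ?_⟩
  have h1 := (isSmall_aeval_pw Q).mul hF
  have h2 := (isSmall_aeval_pw P).mul hG
  simp only [zero_add] at h1 h2
  convert h1.add h2 using 2 with k
  simp only [map_add, map_mul, aeval_X_two]
  ring

lemma HasExpansion.mul (hx : HasExpansion t n x) (hy : HasExpansion t n y) :
    HasExpansion t n fun k => x k * y k := by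
  obtain ⟨P, hP, F, hF⟩ := hx
  obtain ⟨Q, hQ, G, hG⟩ := hy
  have hy0 : IsSmall 0 fun k => Polynomial.aeval (pw k) Q * y k := by
    simpa using (hG.mono (Nat.zero_le _)).add (isSmall_aeval_expansion t G)
  refine ⟨P * Q, mul_ne_zero hP hQ, F * G, ?_⟩
  have h1 := hF.mul hy0
  have h2 := (isSmall_aeval_expansion t F).mul hG
  simp only [zero_add, add_zero] at h1 h2
  convert h1.add h2 using 2 with k
  simp only [map_mul]
  ring

lemma HasExpansion.pow (hx : HasExpansion t n x) (j : ℕ) :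
    HasExpansion t n fun k => x k ^ j := by
  induction j with
  | zero => simpa using hasExpansion_const (t := t) n 1
  | succ j ih => simpa [pow_succ] using ih.mul hx

lemma HasExpansion.sum {ι : Type*} (S : Finset ι) {x : ι → ℕ → ℝ}
    (hx : ∀ i ∈ S, HasExpansion t n (x i)) : HasExpansion t n fun k => ∑ i ∈ S, x i k := by
  classical
  induction S using Finset.induction_on with
  | empty => simpa using hasExpansion_const (t := t) n 0
  | insert i S hi ih =>
    simp only [Finset.sum_insert hi]
    exact (hx i (by simp)).add (ih fun j hj => hx j (by simp [hj]))

lemma HasExpansion.const_mul (hx : HasExpansion t n x) (c : ℚ) :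
    HasExpansion t n fun k => c * x k :=
  (hasExpansion_const n c).mul hx

lemma HasExpansion.aeval {ι : Type*} {v : ι → ℕ → ℝ} (hv : ∀ i, HasExpansion t n (v i))
    (F : MvPolynomial ι ℚ) :
    HasExpansion t n fun k => MvPolynomial.aeval (fun i => v i k) F := by
  induction F using MvPolynomial.induction_on with
  | C c => simpa using hasExpansion_const (t := t) n c
  | add F G hF hG => simpa using hF.add hG
  | mul_X F i hF => simpa using hF.mul (hv i)

lemma HasExpansion.of_aeval_mul {P : Polynomial ℚ} (hP : P ≠ 0)
    (hx : HasExpansion t n fun k => Polynomial.aeval (pw k) P * x k) : HasExpansion t n x := by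
  obtain ⟨Q, hQ, F, hF⟩ := hx
  refine ⟨Q * P, mul_ne_zero hQ hP, F, ?_⟩
  simpa [mul_assoc] using hF

lemma HasExpansion.eps_mul (hx : HasExpansion t n x) :
    HasExpansion t (n + 1) fun k => eps k * x k := by
  obtain ⟨P, hP, F, hF⟩ := hx
  refine ⟨P, hP, MvPolynomial.X 1 * F, ?_⟩
  rw [add_comm]
  convert isSmall_eps.mul hF using 2 with k
  simp
  ring

lemma HasExpansion.shift {n' : ℕ} (hx : HasExpansion t n x) (hn : n' ≤ 2 * n)
    (heps : HasExpansion t n' fun k => eps (k + 1)) : HasExpansion t n' fun k => x (k + 1) := by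
  obtain ⟨P, hP, F, hF⟩ := hx
  have hQ : P.comp (Polynomial.C 2 * Polynomial.X) ≠ 0 := fun h => by
    rw [Polynomial.comp_eq_zero_iff] at h
    rcases h with h | h
    · exact hP h
    · have := congrArg (Polynomial.coeff · 1) h.2
      simp [Polynomial.coeff_C] at this
  refine HasExpansion.of_aeval_mul hQ ?_
  have hF' : HasExpansion t n' fun k => MvPolynomial.aeval ![t, eps (k + 1), pw (k + 1)] F := by
    have h2 : HasExpansion t n' fun k => pw (k + 1) := by
      simpa [pw_succ] using (hasExpansion_pw n').const_mul (t := t) 2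
    have h := HasExpansion.aeval (v := ![fun _ => t, fun k => eps (k + 1), fun k => pw (k + 1)])
      (fun i => by
        fin_cases i
        exacts [hasExpansion_self n', heps, h2]) F
    convert h using 4 with k
    ext i
    fin_cases i <;> rfl
  have h := ((hF.shift.mono hn).hasExpansion (t := t)).add hF'
  convert h using 2 with k
  simp [Polynomial.aeval_comp, pw_succ]

/-- An algebraic number `t` satisfies `(X + 2 t) q = P` with `P` a polynomial in `X` alone. -/
lemma exists_norm_linear (hint : IsIntegral ℚ t) :
    ∃ P : Polynomial ℚ, P ≠ 0 ∧ ∃ q : MvPolynomial (Fin 3) ℚ, ∀ k,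
      MvPolynomial.aeval ![t, eps k, pw k] q * (pw k + 2 * t) = Polynomial.aeval (pw k) P := by
  set χ := minpoly ℚ t with hχ
  refine ⟨χ.comp (Polynomial.C (-1 / 2) * Polynomial.X), fun h => ?_, ?_⟩
  · rw [Polynomial.comp_eq_zero_iff] at h
    rcases h with h | h
    · exact minpoly.ne_zero hint h
    · have := congrArg (Polynomial.coeff · 1) h.2
      simp [Polynomial.coeff_C] at this
  · obtain ⟨q, hq⟩ := (χ.map (algebraMap ℚ (MvPolynomial (Fin 3) ℚ))).sub_dvd_eval_sub
      (MvPolynomial.C (-1 / 2) * MvPolynomial.X 2) (MvPolynomial.X 0)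
    refine ⟨MvPolynomial.C (-1 / 2) * q, fun k => ?_⟩
    have h := congrArg (MvPolynomial.aeval ![t, eps k, pw k]) hq
    rw [Polynomial.eval_map_algebraMap, Polynomial.eval_map_algebraMap, map_sub,
      ← Polynomial.aeval_algHom_apply, ← Polynomial.aeval_algHom_apply] at h
    have h0 : Polynomial.aeval t χ = 0 := minpoly.aeval ℚ t
    simp [h0] at h
    simp [Polynomial.aeval_comp, h]
    ring

lemma HasExpansion.inv_pw_add (hint : IsIntegral ℚ t) (ht : Tendsto rho atTop (nhds t))
    (h : HasExpansion t n rho) : HasExpansion t n fun k => (pw k + 2 * rho k)⁻¹ := by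
  obtain ⟨P, hP, q, hq⟩ := exists_norm_linear hint
  set η : ℕ → ℝ := fun k => -(2 * MvPolynomial.aeval ![t, eps k, pw k] q * (rho k - t)) with hη
  have hη1 : HasExpansion t n η := by
    have h1 := (((hasExpansion_aeval (t := t) n q).mul
      (h.add ((hasExpansion_self n).const_mul (-1)))).const_mul (-2))
    convert h1 using 2 with k
    simp [hη]
    ring
  have hη2 : IsSmall 1 η := by
    have h1 := ((isSmall_aeval_expansion t q).mul (isSmall_rho_sub ht)).const_mul (-2)
    rw [zero_add] at h1
    convert h1 using 2 with k
    simp [hη]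
    ring
  refine HasExpansion.of_aeval_mul (P := P ^ n) (pow_ne_zero _ hP) ?_
  have hP' : HasExpansion t n fun k => Polynomial.aeval (pw k) P := by
    simpa only [aeval_X_two] using
      hasExpansion_aeval (t := t) n (Polynomial.aeval (MvPolynomial.X 2 : MvPolynomial (Fin 3) ℚ) P)
  have hS : HasExpansion t n fun k => MvPolynomial.aeval ![t, eps k, pw k] q *
      ∑ i ∈ Finset.range n, Polynomial.aeval (pw k) P ^ i * η k ^ (n - 1 - i) :=
    (hasExpansion_aeval n q).mul (HasExpansion.sum _ fun i _ => (hP'.pow i).mul (hη1.pow _))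
  have hR : IsSmall n fun k => η k ^ n * (pw k + 2 * rho k)⁻¹ := by
    have h1 := hη2.pow n
    rw [one_mul] at h1
    refine h1.mul (isSmall_of_le_one fun k => ?_)
    rw [abs_of_pos (inv_pos.2 (pw_add_pos k))]
    exact inv_le_one_of_one_le₀ (by linarith [two_le_pw k, rho_pos k])
  convert hS.add hR.hasExpansion using 2 with k
  have hk := (pw_add_pos k).ne'
  have hgeom := geom_sum₂_mul (Polynomial.aeval (pw k) P) (η k) n
  have hlin : Polynomial.aeval (pw k) P - η k =
      MvPolynomial.aeval ![t, eps k, pw k] q * (pw k + 2 * rho k) := by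
    rw [← hq k]; simp only [hη]; ring
  rw [hlin] at hgeom
  rw [map_pow]
  field_simp
  linear_combination -hgeom

lemma hasExpansion_rho (hint : IsIntegral ℚ t) (ht : Tendsto rho atTop (nhds t)) (n : ℕ) :
    HasExpansion t (n + 1) rho := by
  induction n with
  | zero => simpa using (isSmall_rho_sub ht).hasExpansion.add (hasExpansion_self (t := t) 1)
  | succ n ih =>
    have heps : HasExpansion t (n + 2) fun k => eps (k + 1) := by
      have h := (ih.inv_pw_add hint ht).eps_mul.eps_mul.mono (Nat.le_succ (n + 2))
      convert h using 2 with k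
      rw [eps_succ]
      ring
    convert (ih.shift (by omega) heps).add heps using 2 with k
    rw [rho_succ]
    ring

end HasExpansion

lemma exists_pow_eq_sum {t : ℝ} (hint : IsIntegral ℚ t) (a : ℕ) :
    ∃ c : Fin (minpoly ℚ t).natDegree → ℚ, t ^ a = ∑ r, (c r : ℝ) * t ^ (r : ℕ) := by
  refine ⟨fun r => (Polynomial.X ^ a %ₘ minpoly ℚ t).coeff r, ?_⟩
  have h := Polynomial.aeval_modByMonic_eq_self_of_root
    (p := Polynomial.X ^ a) (minpoly.aeval ℚ t)
  rw [Polynomial.aeval_eq_sum_range' (Polynomial.natDegree_modByMonic_lt _ (minpoly.monic hint)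
    (minpoly.ne_one ℚ t)), Finset.sum_range] at h
  simpa [Rat.smul_def] using h.symm

/-- Any polynomial in `t`, `eps` and `pw` reduces to one of bounded degree in `t` and `eps`. -/
lemma exists_reduction {t : ℝ} (hint : IsIntegral ℚ t) (n : ℕ) (F : MvPolynomial (Fin 3) ℚ) :
    ∃ f : Fin (minpoly ℚ t).natDegree × Fin n → Polynomial ℚ,
      IsSmall n fun k => MvPolynomial.aeval ![t, eps k, pw k] F -
        ∑ u, Polynomial.aeval (pw k) (f u) * (t ^ (u.1 : ℕ) * eps k ^ (u.2 : ℕ)) := by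
  induction F using MvPolynomial.induction_on' with
  | monomial u a =>
    have hmon : ∀ k, MvPolynomial.aeval ![t, eps k, pw k] (MvPolynomial.monomial u a) =
        a * (t ^ u 0 * eps k ^ u 1 * pw k ^ u 2) := fun k => by
      rw [MvPolynomial.aeval_monomial, Finsupp.prod_fintype _ _ (by simp), Fin.prod_univ_three]
      simp
    by_cases hn : u 1 < n
    · obtain ⟨c, hc⟩ := exists_pow_eq_sum hint (u 0)
      refine ⟨fun v => if v.2 = ⟨u 1, hn⟩ then
        Polynomial.C (a * c v.1) * Polynomial.X ^ u 2 else 0, ?_⟩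
      convert isSmall_zero n using 2 with k
      rw [hmon, hc, Fintype.sum_prod_type, sub_eq_zero]
      simp only [apply_ite (Polynomial.aeval (pw k)), map_zero, ite_mul, zero_mul,
        Finset.sum_ite_eq', Finset.mem_univ, if_true]
      rw [Finset.sum_mul, Finset.sum_mul, Finset.mul_sum]
      refine Finset.sum_congr rfl fun r _ => ?_
      simp
      ring
    · refine ⟨fun _ => 0, ?_⟩
      have h := ((isSmall_eps.pow (u 1)).mul (isSmall_pw.pow (u 2))).const_mul (a * t ^ u 0)
      convert h.mono (show n ≤ _ by omega) using 2 with k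
      rw [hmon]
      simp
      ring
  | add F G hF hG =>
    obtain ⟨f, hf⟩ := hF
    obtain ⟨g, hg⟩ := hG
    refine ⟨f + g, ?_⟩
    convert hf.add hg using 2 with k
    simp only [map_add, Pi.add_apply, add_mul, Finset.sum_add_distrib]
    ring

lemma HasExpansion.exists_reduction {t : ℝ} (hint : IsIntegral ℚ t) {n : ℕ} {x : ℕ → ℝ}
    (hx : HasExpansion t n x) :
    ∃ P : Polynomial ℚ, P ≠ 0 ∧ ∃ f : Fin (minpoly ℚ t).natDegree × Fin n → Polynomial ℚ,
      IsSmall n fun k => Polynomial.aeval (pw k) P * x k -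
        ∑ u, Polynomial.aeval (pw k) (f u) * (t ^ (u.1 : ℕ) * eps k ^ (u.2 : ℕ)) := by
  obtain ⟨P, hP, F, hF⟩ := hx
  obtain ⟨f, hf⟩ := RulerCF.exists_reduction hint n F
  refine ⟨P, hP, f, ?_⟩
  convert hF.add hf using 2 with k
  ring

/-- Siegel-type elimination: enough sequences with expansions satisfy an approximate relation. -/
lemma exists_isSmall_sum {t : ℝ} (hint : IsIntegral ℚ t) {n : ℕ} {ι : Type*} [Fintype ι]
    (hcard : (minpoly ℚ t).natDegree * n < Fintype.card ι) {x : ι → ℕ → ℝ}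
    (hx : ∀ i, HasExpansion t n (x i)) :
    ∃ a : ι → Polynomial ℚ, a ≠ 0 ∧
      IsSmall n fun k => ∑ i, Polynomial.aeval (pw k) (a i) * x i k := by
  choose P hP f hf using fun i => (hx i).exists_reduction hint
  have hdep : ¬ LinearIndependent (Polynomial ℚ) f := fun h => by
    have := h.fintype_card_le_finrank
    simp at this
    omega
  obtain ⟨c, hc, i, hi⟩ := Fintype.not_linearIndependent_iff.1 hdep
  refine ⟨fun i => c i * P i, fun h => ?_, ?_⟩
  · exact mul_ne_zero hi (hP i) (congrFun h i)
  have h := IsSmall.sum Finset.univ fun i (_ : i ∈ Finset.univ) =>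
    (isSmall_aeval_pw (c i)).mul (hf i)
  rw [zero_add] at h
  convert h using 2 with k
  have hz : ∑ i, Polynomial.aeval (pw k) (c i) * ∑ u, Polynomial.aeval (pw k) (f i u) *
      (t ^ (u.1 : ℕ) * eps k ^ (u.2 : ℕ)) = 0 := by
    simp only [Finset.mul_sum]
    rw [Finset.sum_comm]
    refine Finset.sum_eq_zero fun u _ => ?_
    have := congrArg (Polynomial.aeval (pw k)) (congrFun hc u)
    simp only [Finset.sum_apply, Pi.smul_apply, smul_eq_mul, map_sum, map_mul, Pi.zero_apply,
      map_zero] at this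
    simp only [← mul_assoc, ← Finset.sum_mul, this, zero_mul]
  simp only [mul_sub, Finset.sum_sub_distrib, hz, map_mul, sub_zero, mul_assoc]

lemma exists_int_mul_aeval {ι : Type*} (F : MvPolynomial ι ℚ) :
    ∃ N : ℤ, N ≠ 0 ∧ ∀ z : ι → ℤ, ∃ n : ℤ,
      N * MvPolynomial.aeval (fun i => (z i : ℝ)) F = n := by
  induction F using MvPolynomial.induction_on with
  | C c =>
    refine ⟨c.den, by simp, fun z => ⟨c.num, ?_⟩⟩
    have h := Rat.den_mul_eq_num c
    simp only [MvPolynomial.aeval_C, eq_ratCast]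
    exact_mod_cast h
  | add F G hF hG =>
    obtain ⟨N, hN, h⟩ := hF
    obtain ⟨N', hN', h'⟩ := hG
    refine ⟨N * N', mul_ne_zero hN hN', fun z => ?_⟩
    obtain ⟨n, hn⟩ := h z
    obtain ⟨n', hn'⟩ := h' z
    refine ⟨N' * n + N * n', ?_⟩
    push_cast
    rw [map_add, ← hn, ← hn']
    ring
  | mul_X F i hF =>
    obtain ⟨N, hN, h⟩ := hF
    refine ⟨N, hN, fun z => ?_⟩
    obtain ⟨n, hn⟩ := h z
    refine ⟨n * z i, ?_⟩
    push_cast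
    rw [map_mul, MvPolynomial.aeval_X, ← hn]
    ring

lemma IsSmall.num_pow_mul {n m : ℕ} {x : ℕ → ℝ} (hx : IsSmall (n + m) x) :
    IsSmall m fun k => (num k : ℝ) ^ n * x k := by
  obtain ⟨C, hC⟩ := hx
  refine ⟨C, ((Asymptotics.isBigO_refl (fun k => (num k : ℝ) ^ n) atTop).mul hC).congr_right
    fun k => ?_⟩
  have h := (num_pos k).ne'
  rw [eps, one_div, inv_pow, inv_pow, pow_add]
  field_simp

lemma aeval_X_point (v : Fin 3 → ℝ) (P : Polynomial ℚ) :
    MvPolynomial.aeval v (Polynomial.aeval (MvPolynomial.X 2 : MvPolynomial (Fin 3) ℚ) P) =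
      Polynomial.aeval (v 2) P := by
  rw [← Polynomial.aeval_algHom_apply, MvPolynomial.aeval_X]

lemma sum_aeval_X_ne_zero {N : ℕ} {a : Fin N × Fin N → Polynomial ℚ} (ha : a ≠ 0) :
    ∑ u, Polynomial.aeval (MvPolynomial.X 2 : MvPolynomial (Fin 3) ℚ) (a u) *
      (MvPolynomial.X 1 ^ (u.1 : ℕ) * MvPolynomial.X 0 ^ (u.2 : ℕ)) ≠ 0 := by
  intro h
  refine ha (funext fun v => ?_)
  let y : Fin 3 → Polynomial (Polynomial (Polynomial ℚ)) :=
    ![.X, .C .X, .C (.C .X)]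
  let φ := MvPolynomial.aeval (R := ℚ) y
  have hφ : ∀ P : Polynomial ℚ, φ (Polynomial.aeval (MvPolynomial.X 2) P) =
      Polynomial.C (Polynomial.C P) := fun P => by
    induction P using Polynomial.induction_on' with
    | add P Q hP hQ => simp only [map_add, hP, hQ]
    | monomial j b =>
      rw [Polynomial.aeval_monomial, map_mul, map_pow, AlgHom.commutes,
        ← Polynomial.C_mul_X_pow_eq_monomial]
      simp [φ, y, Polynomial.algebraMap_apply]
  have h0 : φ (MvPolynomial.X 0) = Polynomial.X := MvPolynomial.aeval_X _ _
  have h1 : φ (MvPolynomial.X 1) = Polynomial.C Polynomial.X := MvPolynomial.aeval_X _ _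
  have h2 := congrArg (fun Q => (Polynomial.coeff (Polynomial.coeff (φ Q) v.2) v.1)) h
  simp only [map_sum, map_mul, _root_.map_pow φ, hφ, h0, h1, ← Polynomial.C_pow, map_zero,
    Polynomial.coeff_zero, Polynomial.finsetSum_coeff, Polynomial.coeff_C_mul,
    Polynomial.coeff_X_pow, Fin.val_inj, Fintype.sum_prod_type, mul_ite, mul_one, mul_zero,
    apply_ite Polynomial.coeff, ite_apply] at h2
  simpa using h2

/-- If `1 / σ` is algebraic, the points `(rho k, eps k, pw k)` satisfy a polynomial relation. -/
lemma exists_vanishing {t : ℝ} (hint : IsIntegral ℚ t) (ht : Tendsto rho atTop (nhds t)) :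
    ∃ P : MvPolynomial (Fin 3) ℚ, P ≠ 0 ∧
      ∀ᶠ k in atTop, MvPolynomial.aeval ![rho k, eps k, pw k] P = 0 := by
  set d := (minpoly ℚ t).natDegree with hd
  have hexp : ∀ u : Fin (2 * d + 1) × Fin (2 * d + 1), HasExpansion t (4 * d + 1) fun k =>
      eps k ^ (u.1 : ℕ) * rho k ^ (u.2 : ℕ) := fun u =>
    ((hasExpansion_eps _).pow _).mul ((hasExpansion_rho hint ht _).pow _)
  obtain ⟨a, ha, hsmall⟩ := exists_isSmall_sum hint (by
    rw [← hd, Fintype.card_prod, Fintype.card_fin]; nlinarith) hexp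
  refine ⟨_, sum_aeval_X_ne_zero ha, ?_⟩
  obtain ⟨N, hN, hint⟩ := exists_int_mul_aeval
    (∑ u, Polynomial.aeval (MvPolynomial.X 2 : MvPolynomial (Fin 3) ℚ) (a u) *
      (MvPolynomial.X 1 ^ (4 * d - u.1 - u.2 : ℕ) * MvPolynomial.X 0 ^ (u.2 : ℕ)))
  have h1 := (hsmall.num_pow_mul.const_mul N).tendsto_zero
  filter_upwards [h1.eventually (Metric.ball_mem_nhds 0 one_pos)] with k hk
  obtain ⟨n, hn⟩ := hint ![den k, num k, 2 ^ (k + 1)]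
  have hnum := (num_pos k).ne'
  have hpt : MvPolynomial.aeval (fun i => ((![den k, num k, 2 ^ (k + 1)] i : ℤ) : ℝ))
      (∑ u, Polynomial.aeval (MvPolynomial.X 2 : MvPolynomial (Fin 3) ℚ) (a u) *
        (MvPolynomial.X 1 ^ (4 * d - u.1 - u.2 : ℕ) * MvPolynomial.X 0 ^ (u.2 : ℕ))) =
      (num k : ℝ) ^ (4 * d) * ∑ u, Polynomial.aeval (pw k) (a u) *
        (eps k ^ (u.1 : ℕ) * rho k ^ (u.2 : ℕ)) := by
    simp only [map_sum, map_mul, map_pow, aeval_X_point, MvPolynomial.aeval_X, Finset.mul_sum]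
    refine Finset.sum_congr rfl fun u _ => ?_
    have h4 : 4 * d = (4 * d - u.1 - u.2) + u.1 + u.2 := by have := u.1.2; have := u.2.2; omega
    conv_rhs => rw [h4]
    simp [eps, rho, pw, div_pow, pow_add]
    field_simp
  rw [hpt] at hn
  have hn0 : n = 0 := by
    rw [hn, dist_zero_right, norm_eq_abs] at hk
    exact Int.abs_lt_one_iff.1 (by exact_mod_cast hk)
  rw [hn0, Int.cast_zero, mul_eq_zero, mul_eq_zero] at hn
  have hz := (hn.resolve_left (by exact_mod_cast hN)).resolve_left (pow_ne_zero _ hnum)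
  simpa [map_sum, aeval_X_point] using hz

open Polynomial in
/-- An ideal of `R[X]` in which nonzero constants can be cancelled is principal. -/
lemma exists_generator {R : Type*} [CommRing R] [IsDomain R] [UniqueFactorizationMonoid R]
    (I : Ideal R[X]) (hI : ∃ P ∈ I, P ≠ 0) (hC : ∀ r ≠ 0, ∀ P, C r * P ∈ I → P ∈ I) :
    ∃ G ∈ I, G ≠ 0 ∧ ∀ P ∈ I, G ∣ P := by
  classical
  let : NormalizedGCDMonoid R := Nonempty.some inferInstance
  obtain ⟨P₀, ⟨hP₀I, hP₀⟩, hmin⟩ := WellFounded.has_min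
    (measure (natDegree (R := R))).wf {P | P ∈ I ∧ P ≠ 0} hI
  have hG : P₀.primPart ∈ I := hC P₀.content (by rwa [Ne, content_eq_zero_iff]) _ (by
    rwa [← eq_C_content_mul_primPart])
  refine ⟨P₀.primPart, hG, P₀.primPart_ne_zero, fun P hP => ?_⟩
  let K := FractionRing R
  refine P₀.isPrimitive_primPart.dvd_of_fraction_map_dvd_fraction_map (K := K) ?_
  set G := P₀.primPart with hGdef
  have hG0 : G.map (algebraMap R K) ≠ 0 := by
    rw [Ne, Polynomial.map_eq_zero_iff (IsFractionRing.injective R K)]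
    exact P₀.primPart_ne_zero
  set Q := P.map (algebraMap R K) / G.map (algebraMap R K) with hQ
  obtain ⟨b, hb, hbQ⟩ :=
    IsLocalization.integerNormalization_spec (nonZeroDivisors R) Q
  set Q' := IsLocalization.integerNormalization (nonZeroDivisors R) Q
  have hbK : algebraMap R K b ≠ 0 := by
    simpa using nonZeroDivisors.ne_zero hb
  have hmod : (C b * P - G * Q').map (algebraMap R K) =
      C (algebraMap R K b) * (P.map (algebraMap R K) % G.map (algebraMap R K)) := by
    have h1 := EuclideanDomain.div_add_mod (P.map (algebraMap R K)) (G.map (algebraMap R K))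
    rw [← hQ] at h1
    simp only [Polynomial.map_sub, Polynomial.map_mul, map_C, hbQ, Algebra.smul_def]
    rw [Polynomial.algebraMap_apply]
    linear_combination -C (algebraMap R K b) * h1
  rw [← EuclideanDomain.mod_eq_zero]
  by_contra hr
  have hr' : C b * P - G * Q' ≠ 0 := fun h => by
    rw [h, Polynomial.map_zero, eq_comm, mul_eq_zero, C_eq_zero] at hmod
    exact hmod.elim hbK hr
  refine hmin _ ⟨I.sub_mem (I.mul_mem_left _ hP) (I.mul_mem_right _ hG), hr'⟩ ?_
  change natDegree _ < natDegree _
  rw [← P₀.natDegree_primPart, ← natDegree_map_eq_of_injective (IsFractionRing.injective R K), hmod,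
    ← natDegree_map_eq_of_injective (IsFractionRing.injective R K) P₀.primPart,
    natDegree_C_mul hbK]
  exact natDegree_lt_natDegree hr (EuclideanDomain.mod_lt _ hG0)

/-- A nonzero polynomial is bounded away from zero along `pw`. -/
lemma exists_le_abs_aeval_pw {u : Polynomial ℚ} (hu : u ≠ 0) :
    ∃ c : ℝ, 0 < c ∧ ∀ᶠ k in atTop, c ≤ |Polynomial.aeval (pw k) u| := by
  have hpw : Tendsto pw atTop atTop :=
    (tendsto_pow_atTop_atTop_of_one_lt (by norm_num : (1 : ℝ) < 2)).comp (tendsto_add_atTop_nat 1)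
  by_cases hdeg : 0 < u.degree
  · refine ⟨1, one_pos, ?_⟩
    have h := ((u.map (algebraMap ℚ ℝ)).abs_tendsto_atTop (by simpa using hdeg)).comp hpw
    filter_upwards [h.eventually_ge_atTop 1] with k hk
    simpa using hk
  · have h := Polynomial.eq_C_of_degree_le_zero (not_lt.1 hdeg)
    have h0 : u.coeff 0 ≠ 0 := fun h0 => hu (by rw [h, h0, map_zero])
    refine ⟨|(u.coeff 0 : ℝ)|, by simpa using h0, Eventually.of_forall fun k => ?_⟩
    rw [h]
    simp

/-- A polynomial is divisible by `X i` up to its restriction to `X i = 0`. -/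
lemma dvd_sub_of_forall_X {ι : Type*} (d : MvPolynomial ι ℚ)
    (φ : MvPolynomial ι ℚ →ₐ[ℚ] MvPolynomial ι ℚ)
    (hφ : ∀ j, d ∣ MvPolynomial.X j - φ (MvPolynomial.X j)) (P : MvPolynomial ι ℚ) :
    d ∣ P - φ P := by
  induction P using MvPolynomial.induction_on with
  | C c => simp [MvPolynomial.algHom_C]
  | add P Q hP hQ =>
    rw [map_add, add_sub_add_comm]
    exact dvd_add hP hQ
  | mul_X P j hP =>
    obtain ⟨a, ha⟩ := hP
    obtain ⟨b, hb⟩ := hφ j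
    refine ⟨a * MvPolynomial.X j + φ P * b, ?_⟩
    rw [map_mul]
    linear_combination MvPolynomial.X j * ha + φ P * hb

lemma eventually_add_eps_mul_ne_zero {u w : ℕ → ℝ} {c : ℝ} (hc : 0 < c)
    (hu : ∀ᶠ k in atTop, c ≤ |u k|) (hw : IsSmall 0 w) :
    ∀ᶠ k in atTop, u k + eps k * w k ≠ 0 := by
  have h := (isSmall_eps.mul hw).tendsto_zero
  filter_upwards [hu, h.eventually (Metric.ball_mem_nhds 0 hc)] with k hk hk' h0
  rw [dist_zero_right, norm_eq_abs, ← abs_neg, ← eq_neg_of_add_eq_zero_left h0] at hk'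
  linarith

lemma eventually_aeval_eps_pw_ne_zero {r : MvPolynomial (Fin 2) ℚ} (hr : r ≠ 0) :
    ∀ᶠ k in atTop, MvPolynomial.aeval ![eps k, pw k] r ≠ 0 := by
  obtain ⟨a, r', hr', rfl⟩ := WfDvdMonoid.max_power_factor hr
    (MvPolynomial.X_prime (R := ℚ) (i := (0 : Fin 2))).irreducible
  set u : Polynomial ℚ := MvPolynomial.aeval ![0, Polynomial.X] r' with hu
  let φ : MvPolynomial (Fin 2) ℚ →ₐ[ℚ] MvPolynomial (Fin 2) ℚ :=
    MvPolynomial.aeval ![0, MvPolynomial.X 1]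
  obtain ⟨w, hw⟩ := dvd_sub_of_forall_X (MvPolynomial.X 0) φ
    (fun j => by fin_cases j <;> simp [φ]) r'
  have hφ : φ r' = Polynomial.aeval (MvPolynomial.X 1) u := by
    rw [hu, ← AlgHom.comp_apply]
    congr 1
    ext i : 1
    fin_cases i <;> simp [φ]
  have hu0 : u ≠ 0 := fun h => hr' ⟨w, by rw [← hw, hφ, h, map_zero, sub_zero]⟩
  obtain ⟨c, hc, hcu⟩ := exists_le_abs_aeval_pw hu0
  have hws : IsSmall 0 fun k => MvPolynomial.aeval ![eps k, pw k] w := by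
    have h := isSmall_aeval (v := ![eps, pw]) (fun i => by
      fin_cases i
      exacts [isSmall_eps.mono (Nat.zero_le _), isSmall_pw]) w
    convert h using 4 with k
    ext i
    fin_cases i <;> rfl
  filter_upwards [eventually_add_eps_mul_ne_zero hc hcu hws] with k hk
  have h := congrArg (MvPolynomial.aeval ![eps k, pw k]) hw
  rw [map_sub, map_mul, hφ, ← Polynomial.aeval_algHom_apply] at h
  simp only [MvPolynomial.aeval_X] at h
  rw [map_mul, map_pow, MvPolynomial.aeval_X]
  refine mul_ne_zero (pow_ne_zero _ (eps_pos k).ne') ?_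
  rw [sub_eq_iff_eq_add'] at h
  rw [h]
  exact hk

open MvPolynomial

/-- Evaluation at a real point of a rational polynomial in three variables, playing the roles
of `rho`, `eps` and `pw`. -/
noncomputable abbrev ev (a b c : ℝ) : MvPolynomial (Fin 3) ℚ →ₐ[ℚ] ℝ := aeval ![a, b, c]

lemma ev_X_zero (a b c : ℝ) : ev a b c (X 0) = a := aeval_X _ _

lemma ev_X_one (a b c : ℝ) : ev a b c (X 1) = b := aeval_X _ _

lemma ev_X_two (a b c : ℝ) : ev a b c (X 2) = c := aeval_X _ _

lemma ev_aeval (a b c : ℝ) (x y z P : MvPolynomial (Fin 3) ℚ) :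
    ev a b c (aeval ![x, y, z] P) = ev (ev a b c x) (ev a b c y) (ev a b c z) P := by
  rw [← AlgHom.comp_apply]
  congr 1
  ext i : 1
  fin_cases i <;> simp

lemma eq_zero_of_ev {P : MvPolynomial (Fin 3) ℚ} (h : ∀ a b c, ev a b c P = 0) : P = 0 := by
  refine MvPolynomial.funext fun v => ?_
  have h1 := h (v 0) (v 1) (v 2)
  have h2 : ![(v 0 : ℝ), (v 1 : ℝ), (v 2 : ℝ)] = algebraMap ℚ ℝ ∘ v := by
    ext i
    fin_cases i <;> simp
  rw [ev, h2, aeval_algebraMap_apply] at h1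
  simpa [aeval_eq_eval] using h1

/-- Polynomial identities may be checked off the zero locus of a nonzero polynomial. -/
lemma eq_of_ev {H P Q : MvPolynomial (Fin 3) ℚ} (hH : H ≠ 0)
    (h : ∀ a b c, ev a b c H ≠ 0 → ev a b c P = ev a b c Q) : P = Q := by
  have h0 : H * (P - Q) = 0 := eq_zero_of_ev fun a b c => by
    rw [map_mul, map_sub]
    by_cases hz : ev a b c H = 0
    · rw [hz, zero_mul]
    · rw [h a b c hz, sub_self, mul_zero]
  exact sub_eq_zero.1 ((mul_eq_zero.1 h0).resolve_left hH)

lemma isSmall_ev (P : MvPolynomial (Fin 3) ℚ) :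
    IsSmall 0 fun k => ev (rho k) (eps k) (pw k) P := by
  have h := isSmall_aeval (v := ![rho, eps, pw]) (fun i => by
    fin_cases i
    exacts [isSmall_rho, isSmall_eps.mono (Nat.zero_le _), isSmall_pw]) P
  convert h using 4 with k
  ext i
  fin_cases i <;> rfl

/-- The ideal of polynomials vanishing at almost all points `(rho k, eps k, pw k)`. -/
def vanishing : Ideal (MvPolynomial (Fin 3) ℚ) where
  carrier := {P | ∀ᶠ k in atTop, ev (rho k) (eps k) (pw k) P = 0}
  add_mem' := fun {P Q} hP hQ => by
    filter_upwards [hP, hQ] with k h1 h2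
    rw [map_add, h1, h2, add_zero]
  zero_mem' := by simp
  smul_mem' := fun P Q hQ => by
    filter_upwards [hQ] with k h
    rw [smul_eq_mul, map_mul, h, mul_zero]

lemma mem_vanishing {P : MvPolynomial (Fin 3) ℚ} :
    P ∈ vanishing ↔ ∀ᶠ k in atTop, ev (rho k) (eps k) (pw k) P = 0 := Iff.rfl

lemma mem_vanishing_of_succ {P : MvPolynomial (Fin 3) ℚ}
    (h : ∀ᶠ k in atTop, ev (rho (k + 1)) (eps (k + 1)) (pw (k + 1)) P = 0) : P ∈ vanishing := by
  obtain ⟨N, hN⟩ := eventually_atTop.1 h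
  refine eventually_atTop.2 ⟨N + 1, fun k hk => ?_⟩
  obtain ⟨j, rfl⟩ := Nat.exists_eq_add_of_le' hk
  exact hN (j + N) (by omega)

lemma vanishing_generator (h : ∃ P ∈ vanishing, P ≠ 0) :
    ∃ G ∈ vanishing, G ≠ 0 ∧ ∀ P ∈ vanishing, G ∣ P := by
  let E := finSuccEquiv ℚ 2
  have hE : ∀ r, E.symm (Polynomial.C r) = rename Fin.succ r := fun r => by
    rw [AlgEquiv.symm_apply_eq]
    induction r using MvPolynomial.induction_on with
    | C c => simp [E, finSuccEquiv_apply]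
    | add P Q hP hQ => simp only [map_add, hP, hQ]
    | mul_X P i hP => rw [map_mul, map_mul, map_mul, ← hP, rename_X, finSuccEquiv_X_succ]
  obtain ⟨P, hP, hP0⟩ := h
  obtain ⟨G, hG, hG0, hdvd⟩ := exists_generator
    (vanishing.comap (E.symm : Polynomial (MvPolynomial (Fin 2) ℚ) →+* MvPolynomial (Fin 3) ℚ))
    ⟨E P, by simpa using hP, by simpa using hP0⟩ (fun r hr P hP => by
      have hP' : E.symm (Polynomial.C r * P) ∈ vanishing := hP
      change E.symm P ∈ vanishing
      rw [mem_vanishing] at hP' ⊢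
      filter_upwards [hP', eventually_aeval_eps_pw_ne_zero hr] with k h1 h2
      rw [map_mul, hE, map_mul, aeval_rename] at h1
      exact (mul_eq_zero.1 h1).resolve_left h2)
  refine ⟨E.symm G, hG, by simpa using hG0, fun Q hQ => ?_⟩
  have h1 := map_dvd E.symm (hdvd (E Q) (by simpa using hQ))
  simpa using h1

/-- The denominator in the recursions for `eps` and `rho`. -/
noncomputable def kap : MvPolynomial (Fin 3) ℚ := X 2 + C 2 * X 0

lemma ev_kap (a b c : ℝ) : ev a b c kap = c + 2 * a := by
  simp [kap]

lemma prime_kap : Prime kap := by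
  let T : ℚ → MvPolynomial (Fin 3) ℚ →ₐ[ℚ] MvPolynomial (Fin 3) ℚ := fun r =>
    aeval ![X 0, X 1, X 2 + C r * X 0]
  have hT : ∀ r, (T (-r)).comp (T r) = AlgHom.id ℚ _ := fun r => by
    ext i : 1
    fin_cases i <;> simp [T]
  let e := AlgEquiv.ofAlgHom (T (-2)) (T 2) (hT 2) (by simpa using hT (-2))
  rw [← MulEquiv.prime_iff e]
  have h : e kap = X 2 := by simp [e, T, kap]
  rw [h]
  exact X_prime

lemma totalDegree_kap : kap.totalDegree = 1 := by
  refine le_antisymm ?_ (Nat.one_le_iff_ne_zero.2 fun h => ?_)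
  · refine (totalDegree_add _ _).trans (max_le (by simp) ?_)
    exact (totalDegree_mul _ _).trans (by simp)
  · rw [totalDegree_eq_zero_iff_eq_C] at h
    exact prime_kap.not_isUnit (by
      rw [h]
      refine (IsUnit.mk0 _ fun h0 => prime_kap.ne_zero ?_).map C
      rw [h, h0, map_zero])

/-- Clearing denominators in the substitution taking one point of the orbit to the next one. -/
lemma exists_pullback (P : MvPolynomial (Fin 3) ℚ) :
    ∃ S : MvPolynomial (Fin 3) ℚ, S.totalDegree ≤ P.totalDegree + P.totalDegree ∧
      ∀ a b c, c + 2 * a ≠ 0 → ev a b c S = (c + 2 * a) ^ P.totalDegree *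
        ev (a - b ^ 2 / (c + 2 * a)) (b ^ 2 / (c + 2 * a)) (2 * c) P := by
  refine ⟨∑ u ∈ P.support, C (P.coeff u) * ((C 2 * X 2) ^ u 2 *
    kap ^ (P.totalDegree - u 0 - u 1) * (X 1 ^ 2) ^ u 1 * (kap * X 0 - X 1 ^ 2) ^ u 0), ?_, ?_⟩
  · refine (totalDegree_finsetSum _ _).trans (Finset.sup_le fun u hu => ?_)
    have hu' : u 0 + u 1 + u 2 ≤ P.totalDegree := by
      have h := le_totalDegree hu
      rwa [Finsupp.sum_fintype _ _ (by simp), Fin.sum_univ_three] at h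
    have h1 : (C 2 * X 2 : MvPolynomial (Fin 3) ℚ).totalDegree ≤ 1 :=
      (totalDegree_mul _ _).trans (by simp)
    have h2 : (X 1 ^ 2 : MvPolynomial (Fin 3) ℚ).totalDegree ≤ 2 := by simp
    have h3 : (kap * X 0 - X 1 ^ 2 : MvPolynomial (Fin 3) ℚ).totalDegree ≤ 2 := by
      refine (totalDegree_sub _ _).trans (max_le ((totalDegree_mul _ _).trans ?_) h2)
      rw [totalDegree_kap, totalDegree_X]
    have h4 := totalDegree_pow (C 2 * X 2 : MvPolynomial (Fin 3) ℚ) (u 2)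
    have h5 := totalDegree_pow kap (P.totalDegree - u 0 - u 1)
    have h6 := totalDegree_pow (X 1 ^ 2 : MvPolynomial (Fin 3) ℚ) (u 1)
    have h7 := totalDegree_pow (kap * X 0 - X 1 ^ 2 : MvPolynomial (Fin 3) ℚ) (u 0)
    have h8 := Nat.mul_le_mul_left (u 2) h1
    have h9 := Nat.mul_le_mul_left (u 1) h2
    have h10 := Nat.mul_le_mul_left (u 0) h3
    rw [totalDegree_kap] at h5
    refine (totalDegree_mul _ _).trans ?_
    rw [totalDegree_C, zero_add]
    refine (totalDegree_mul _ _).trans ((Nat.add_le_add_right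
      ((totalDegree_mul _ _).trans (Nat.add_le_add_right (totalDegree_mul _ _) _)) _).trans ?_)
    omega
  · intro a b c hc
    generalize hD' : P.totalDegree = D
    conv_rhs => rw [P.as_sum]
    subst hD'
    rw [map_sum, map_sum, Finset.mul_sum]
    refine Finset.sum_congr rfl fun u hu => ?_
    have hu' : u 0 + u 1 + u 2 ≤ P.totalDegree := by
      have h := le_totalDegree hu
      rwa [Finsupp.sum_fintype _ _ (by simp), Fin.sum_univ_three] at h
    have hD : P.totalDegree = (P.totalDegree - u 0 - u 1) + u 0 + u 1 := by omega
    rw [aeval_monomial, Finsupp.prod_fintype _ _ (by simp), Fin.prod_univ_three]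
    have h2 : b ^ 2 = (c + 2 * a) * (b ^ 2 / (c + 2 * a)) := by
      field_simp
    generalize b ^ 2 / (c + 2 * a) = y at h2
    simp only [map_mul, map_pow, map_sub, ev_kap, aeval_C, aeval_X]
    simp only [Matrix.cons_val]
    conv_rhs => rw [hD]
    rw [h2, ← mul_sub]
    simp only [mul_pow, pow_add, map_ofNat]
    ring

lemma eval_aeval (x y z : Polynomial ℝ) (s : ℝ) (P : MvPolynomial (Fin 3) ℚ) :
    (aeval ![x, y, z] P).eval s = ev (x.eval s) (y.eval s) (z.eval s) P := by
  induction P using MvPolynomial.induction_on with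
  | C c => simp [Polynomial.algebraMap_apply]
  | add P Q hP hQ => simp only [map_add, Polynomial.eval_add, hP, hQ]
  | mul_X P i hP =>
    rw [map_mul, map_mul, Polynomial.eval_mul, hP, aeval_X, aeval_X]
    fin_cases i <;> rfl

lemma ev_eq_zero_of_infinite {P : MvPolynomial (Fin 3) ℚ} {x y z : Polynomial ℝ}
    (h : {s : ℝ | ev (x.eval s) (y.eval s) (z.eval s) P = 0}.Infinite) (s : ℝ) :
    ev (x.eval s) (y.eval s) (z.eval s) P = 0 := by
  have h0 : aeval ![x, y, z] P = (0 : Polynomial ℝ) :=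
    Polynomial.eq_zero_of_infinite_isRoot _ (by simpa only [Polynomial.IsRoot, eval_aeval] using h)
  rw [← eval_aeval, h0, Polynomial.eval_zero]

lemma exists_even_odd (P : MvPolynomial (Fin 3) ℚ) :
    ∃ U V : MvPolynomial (Fin 3) ℚ, ∀ a b c,
      ev a b c P = ev a (b ^ 2) c U + b * ev a (b ^ 2) c V := by
  induction P using MvPolynomial.induction_on with
  | C r => exact ⟨C r, 0, fun a b c => by simp⟩
  | add P Q hP hQ =>
    obtain ⟨U, V, h⟩ := hP
    obtain ⟨U', V', h'⟩ := hQ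
    refine ⟨U + U', V + V', fun a b c => ?_⟩
    simp only [map_add, h, h']
    ring
  | mul_X P i hP =>
    obtain ⟨U, V, h⟩ := hP
    fin_cases i
    · refine ⟨U * X 0, V * X 0, fun a b c => ?_⟩
      simp [h]
      ring
    · refine ⟨X 1 * V, U, fun a b c => ?_⟩
      simp [h]
      ring
    · refine ⟨U * X 2, V * X 2, fun a b c => ?_⟩
      simp [h]
      ring

/-- Restriction to the plane `eps = 0`. -/
noncomputable def atZero : MvPolynomial (Fin 3) ℚ →ₐ[ℚ] MvPolynomial (Fin 3) ℚ :=
  aeval ![X 0, 0, X 2]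

lemma ev_atZero (a b c : ℝ) (P : MvPolynomial (Fin 3) ℚ) :
    ev a b c (atZero P) = ev a 0 c P := by
  rw [atZero, ev_aeval, ev_X_zero, ev_X_two, map_zero]

lemma exists_ev_eq_add (P : MvPolynomial (Fin 3) ℚ) :
    ∃ w : MvPolynomial (Fin 3) ℚ, ∀ a b c, ev a b c P = ev a 0 c P + b * ev a b c w := by
  obtain ⟨w, hw⟩ := dvd_sub_of_forall_X (X 1) atZero
    (fun j => by fin_cases j <;> simp [atZero]) P
  refine ⟨w, fun a b c => ?_⟩
  have h := congrArg (ev a b c) hw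
  rw [map_sub, map_mul, ev_atZero, ev_X_one] at h
  linarith

lemma X_one_dvd {P : MvPolynomial (Fin 3) ℚ} (h : atZero P = 0) : X 1 ∣ P := by
  have h' := dvd_sub_of_forall_X (X 1) atZero (fun j => by fin_cases j <;> simp [atZero]) P
  rwa [h, sub_zero] at h'

lemma dvd_of_dvd_prime_pow_mul {R : Type*} [CommRing R] [IsDomain R] {x a b : R} (hx : Prime x)
    (ha : ¬ x ∣ a) {n : ℕ} (h : a ∣ x ^ n * b) : a ∣ b := by
  obtain ⟨y, hy⟩ := h
  obtain ⟨z, rfl⟩ := hx.pow_dvd_of_dvd_mul_left n ha ⟨b, hy.symm⟩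
  refine ⟨z, mul_left_cancel₀ (pow_ne_zero n hx.ne_zero) ?_⟩
  rw [hy]
  ring

lemma totalDegree_kap_pow (i : ℕ) : (kap ^ i).totalDegree = i := by
  induction i with
  | zero => simp
  | succ i ih =>
    rw [pow_succ, totalDegree_mul_of_isDomain (pow_ne_zero _ prime_kap.ne_zero) prime_kap.ne_zero,
      ih, totalDegree_kap]

section Generator

variable {G : MvPolynomial (Fin 3) ℚ}

lemma atZero_generator_ne_zero (hG : G ∈ vanishing) (hG0 : G ≠ 0)
    (hdvd : ∀ P ∈ vanishing, G ∣ P) : atZero G ≠ 0 := by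
  intro h
  obtain ⟨G₁, hG₁⟩ := X_one_dvd h
  have hmem : G₁ ∈ vanishing := by
    rw [mem_vanishing] at hG ⊢
    filter_upwards [hG] with k hk
    rw [hG₁, map_mul, ev_X_one] at hk
    exact (mul_eq_zero.1 hk).resolve_left (eps_pos k).ne'
  obtain ⟨y, hy⟩ := hdvd _ hmem
  have h1 : G₁ * 1 = G₁ * (X 1 * y) := by
    rw [mul_one]
    conv_lhs => rw [hy, hG₁]
    ring
  have h0 : G₁ ≠ 0 := fun h0 => hG0 (by rw [hG₁, h0, mul_zero])
  exact (X_prime (R := ℚ) (i := (1 : Fin 3))).not_isUnit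
    (IsUnit.of_mul_eq_one _ (mul_left_cancel₀ h0 h1).symm)

/-- The norm of the generator, moved one step along the orbit, is again divisible by it. -/
lemma exists_pushforward (hG : G ∈ vanishing) (hdvd : ∀ P ∈ vanishing, G ∣ P) :
    ∃ W : MvPolynomial (Fin 3) ℚ, ∀ a b c d, d ^ 2 = b * (c / 2 + 2 * a + 2 * b) →
      ev a b c G * ev a b c W = ev (a + b) d (c / 2) G * ev (a + b) (-d) (c / 2) G := by
  obtain ⟨U, V, hUV⟩ := exists_even_odd G
  set Q : MvPolynomial (Fin 3) ℚ :=
    aeval ![X 0 + X 1, X 1 * (C (1 / 2) * X 2 + C 2 * X 0 + C 2 * X 1), C (1 / 2) * X 2]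
    (U ^ 2 - X 1 * V ^ 2) with hQ
  have hev : ∀ a b c d, d ^ 2 = b * (c / 2 + 2 * a + 2 * b) →
      ev a b c Q = ev (a + b) d (c / 2) G * ev (a + b) (-d) (c / 2) G := fun a b c d hd => by
    have h1 : ev a b c (C (1 / 2) * X 2) = c / 2 := by simp; ring
    have h2 : ev a b c (X 1 * (C (1 / 2) * X 2 + C 2 * X 0 + C 2 * X 1)) = d ^ 2 := by
      rw [hd, map_mul, ev_X_one]
      congr 1
      simp
      ring
    rw [hQ, ev_aeval, h1, h2, hUV, hUV]
    simp
    ring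
  obtain ⟨W, hW⟩ := hdvd Q (mem_vanishing_of_succ (by
    filter_upwards [hG] with k hk
    have h1 : rho (k + 1) + eps (k + 1) = rho k := by rw [rho_succ]; ring
    have h2 : pw (k + 1) / 2 = pw k := by rw [pw_succ]; ring
    rw [hev _ _ _ (eps k), h1, h2, hk, zero_mul]
    have h3 := (pw_add_pos k).ne'
    rw [h2, add_assoc, ← mul_add, h1, eps_succ]
    field_simp))
  refine ⟨W, fun a b c d hd => ?_⟩
  rw [← map_mul, ← hW, hev a b c d hd]

lemma not_kap_dvd_atZero (hG : G ∈ vanishing) (hG0 : G ≠ 0) (hdvd : ∀ P ∈ vanishing, G ∣ P) :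
    ¬ kap ∣ atZero G := by
  intro h
  obtain ⟨W, hW⟩ := exists_pushforward hG hdvd
  have hhalf : ∀ a c, ev a 0 c G = 0 → ev a 0 (c / 2) G = 0 := fun a c h0 => by
    have h1 := hW a 0 c 0 (by ring)
    simpa [h0] using h1
  have hj : ∀ a (j : ℕ), ev a 0 (-2 * a / 2 ^ j) G = 0 := fun a j => by
    induction j with
    | zero =>
      obtain ⟨y, hy⟩ := h
      have h1 := congrArg (ev a 0 (-2 * a)) hy
      rw [ev_atZero, map_mul, ev_kap] at h1
      simpa using h1
    | succ j ih =>
      rw [pow_succ, ← div_div]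
      exact hhalf _ _ ih
  refine atZero_generator_ne_zero hG hG0 hdvd (eq_of_ev (H := X 0) (X_ne_zero 0) ?_)
  intro a b c ha
  rw [ev_X_zero] at ha
  rw [ev_atZero, map_zero]
  have hinf : {s : ℝ | ev ((Polynomial.C a).eval s) ((0 : Polynomial ℝ).eval s)
      (Polynomial.X.eval s) G = 0}.Infinite := by
    refine Set.infinite_of_injective_forall_mem (f := fun j : ℕ => -2 * a / 2 ^ j) ?_
      fun j => by simpa using hj a j
    intro i j hij
    have h2 : (2 : ℝ) ^ i = 2 ^ j := by
      have h3 : -2 * a ≠ 0 := by simpa using ha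
      have h4 : -2 * a / 2 ^ i = -2 * a / 2 ^ j := hij
      rw [div_eq_div_iff (by positivity) (by positivity)] at h4
      exact (mul_left_cancel₀ h3 h4).symm
    exact pow_right_injective₀ (by norm_num) (by norm_num) h2
  simpa using ev_eq_zero_of_infinite hinf c

/-- The reflection `eps ↦ -eps`. -/
noncomputable def negEps : MvPolynomial (Fin 3) ℚ →ₐ[ℚ] MvPolynomial (Fin 3) ℚ :=
  aeval ![X 0, -X 1, X 2]

lemma ev_negEps (a b c : ℝ) (P : MvPolynomial (Fin 3) ℚ) :
    ev a b c (negEps P) = ev a (-b) c P := by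
  rw [negEps, ev_aeval, map_neg, ev_X_zero, ev_X_one, ev_X_two]

lemma negEps_ne_zero {P : MvPolynomial (Fin 3) ℚ} (hP : P ≠ 0) : negEps P ≠ 0 :=
  fun h => hP (eq_zero_of_ev fun a b c => by
    have h1 := ev_negEps a (-b) c P
    rw [h, map_zero, neg_neg] at h1
    exact h1.symm)

lemma atZero_negEps (P : MvPolynomial (Fin 3) ℚ) : atZero (negEps P) = atZero P :=
  eq_of_ev one_ne_zero fun a b c _ => by rw [ev_atZero, ev_atZero, ev_negEps, neg_zero]

/-- The pullback of the generator along the orbit is a multiple of it, by a cofactor dividing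
the reflected generator up to powers of `kap`. -/
lemma exists_cofactor (hG : G ∈ vanishing) (hG0 : G ≠ 0) (hdvd : ∀ P ∈ vanishing, G ∣ P) :
    ∃ R : MvPolynomial (Fin 3) ℚ, (G * R).totalDegree ≤ G.totalDegree + G.totalDegree ∧
      (∀ a b c, c + 2 * a ≠ 0 → ev a b c (G * R) = (c + 2 * a) ^ G.totalDegree *
        ev (a - b ^ 2 / (c + 2 * a)) (b ^ 2 / (c + 2 * a)) (2 * c) G) ∧
      ∃ n, R ∣ kap ^ n * negEps G := by
  obtain ⟨W, hW⟩ := exists_pushforward hG hdvd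
  obtain ⟨S, hSdeg, hS⟩ := exists_pullback G
  obtain ⟨SW, -, hSW⟩ := exists_pullback W
  obtain ⟨R, rfl⟩ := hdvd S (by
    obtain ⟨N, hN⟩ := eventually_atTop.1 hG
    refine eventually_atTop.2 ⟨N, fun k hk => ?_⟩
    rw [hS _ _ _ (pw_add_pos k).ne', ← eps_succ, ← rho_succ, ← pw_succ, hN _ (by omega), mul_zero])
  refine ⟨R, hSdeg, hS, G.totalDegree + W.totalDegree, SW, ?_⟩
  refine mul_left_cancel₀ hG0 (eq_of_ev prime_kap.ne_zero fun a b c hc => ?_)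
  rw [ev_kap] at hc
  have h1 := hW (a - b ^ 2 / (c + 2 * a)) (b ^ 2 / (c + 2 * a)) (2 * c) b (by field_simp; ring)
  rw [sub_add_cancel, mul_div_cancel_left₀ _ (two_ne_zero' ℝ)] at h1
  rw [← mul_assoc G R, map_mul _ (G * R), hS _ _ _ hc, hSW _ _ _ hc, map_mul, map_mul, map_pow,
    ev_kap, ev_negEps, pow_add]
  linear_combination -(c + 2 * a) ^ G.totalDegree * (c + 2 * a) ^ W.totalDegree * h1

lemma kap_pow_mul_atZero {R : MvPolynomial (Fin 3) ℚ}
    (hS : ∀ a b c, c + 2 * a ≠ 0 → ev a b c (G * R) = (c + 2 * a) ^ G.totalDegree *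
        ev (a - b ^ 2 / (c + 2 * a)) (b ^ 2 / (c + 2 * a)) (2 * c) G) :
    kap ^ G.totalDegree * atZero (aeval ![X 0, X 1, C 2 * X 2] G) = atZero G * atZero R := by
  refine eq_of_ev prime_kap.ne_zero fun a b c hc => ?_
  rw [ev_kap] at hc
  have h1 := hS a 0 c hc
  have h2 : ev a 0 c (C 2 * X 2) = 2 * c := by simp
  rw [zero_pow two_ne_zero, zero_div, sub_zero] at h1
  rw [← map_mul, map_mul (ev a b c), map_pow, ev_atZero, ev_atZero, ev_kap, h1, ev_aeval, h2,
    ev_X_zero, ev_X_one]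

lemma cofactor_eq {R : MvPolynomial (Fin 3) ℚ} {n : ℕ} (hG0 : G ≠ 0)
    (hkap : ¬ kap ∣ atZero G) (hdeg : (G * R).totalDegree ≤ G.totalDegree + G.totalDegree)
    (hzero : kap ^ G.totalDegree ∣ atZero G * atZero R) (hneg : R ∣ kap ^ n * negEps G) :
    ∃ r : ℚ, r ≠ 0 ∧ R = kap ^ G.totalDegree * C r := by
  have hR0 : R ≠ 0 := ne_zero_of_dvd_ne_zero
    (mul_ne_zero (pow_ne_zero _ prime_kap.ne_zero) (negEps_ne_zero hG0)) hneg
  obtain ⟨i, R', hR', rfl⟩ := WfDvdMonoid.max_power_factor hR0 prime_kap.irreducible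
  have hR'0 := right_ne_zero_of_mul hR0
  have hatkap : atZero kap = kap := eq_of_ev one_ne_zero fun a b c _ => by
    rw [ev_atZero, ev_kap, ev_kap]
  have hdvdneg : R' ∣ negEps G := dvd_of_dvd_prime_pow_mul prime_kap hR'
    ((dvd_mul_left _ _).trans hneg)
  have hi : G.totalDegree ≤ i := by
    by_contra! hlt
    have h1 := (pow_dvd_pow kap (Nat.succ_le_of_lt hlt)).trans hzero
    rw [map_mul, map_pow, hatkap, mul_left_comm, pow_succ] at h1
    have h2 := (mul_dvd_mul_iff_left (pow_ne_zero i prime_kap.ne_zero)).1 h1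
    have h3 := (prime_kap.dvd_or_dvd h2).resolve_left hkap
    have h4 := h3.trans (map_dvd atZero hdvdneg)
    rw [atZero_negEps] at h4
    exact hkap h4
  rw [totalDegree_mul_of_isDomain hG0 hR0,
    totalDegree_mul_of_isDomain (pow_ne_zero _ prime_kap.ne_zero) hR'0,
    totalDegree_kap_pow] at hdeg
  obtain rfl : i = G.totalDegree := by omega
  have hC := totalDegree_eq_zero_iff_eq_C.1 (show R'.totalDegree = 0 by omega)
  refine ⟨R'.coeff 0, fun h => hR'0 (by rw [hC, h, map_zero]), ?_⟩
  rw [← hC]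

/-- The generator is an eigenvector of the substitution moving along the orbit. -/
lemma exists_functional_equation (hG : G ∈ vanishing) (hG0 : G ≠ 0)
    (hdvd : ∀ P ∈ vanishing, G ∣ P) :
    ∃ r : ℚ, r ≠ 0 ∧ ∀ a b c, c + 2 * a ≠ 0 →
      ev (a - b ^ 2 / (c + 2 * a)) (b ^ 2 / (c + 2 * a)) (2 * c) G = r * ev a b c G := by
  obtain ⟨R, hdeg, hS, n, hneg⟩ := exists_cofactor hG hG0 hdvd
  obtain ⟨r, hr, rfl⟩ := cofactor_eq hG0 (not_kap_dvd_atZero hG hG0 hdvd) hdeg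
    ⟨_, (kap_pow_mul_atZero hS).symm⟩ hneg
  refine ⟨r, hr, fun a b c hc => ?_⟩
  have h1 := hS a b c hc
  rw [map_mul, map_mul, map_pow, ev_kap, aeval_C, eq_ratCast] at h1
  refine mul_left_cancel₀ (pow_ne_zero G.totalDegree hc) ?_
  linear_combination -h1

end Generator

section FunctionalEquation

variable {G : MvPolynomial (Fin 3) ℚ} {r : ℚ}

/-- A solution of the functional equation is even in `eps`, and the equation becomes polynomial
in terms of `eps ^ 2`. -/
lemma exists_even_of_functional_equation (hr : r ≠ 0) (hG : ∀ a b c, c + 2 * a ≠ 0 →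
      ev (a - b ^ 2 / (c + 2 * a)) (b ^ 2 / (c + 2 * a)) (2 * c) G = r * ev a b c G) :
    ∃ U : MvPolynomial (Fin 3) ℚ, (∀ a b c, ev a b c G = ev a (b ^ 2) c U) ∧
      ∀ a h c, ev (a - h) (h ^ 2) (2 * c) U = r * ev a ((c + 2 * a) * h) c U := by
  obtain ⟨U, V, hUV⟩ := exists_even_odd G
  have hr' : (r : ℝ) ≠ 0 := by exact_mod_cast hr
  have hGU : G = aeval ![X 0, X 1 ^ 2, X 2] U := by
    refine eq_of_ev prime_kap.ne_zero fun a b c hc => ?_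
    rw [ev_kap] at hc
    have h1 := hG a (-b) c hc
    rw [neg_sq, hG a b c hc] at h1
    have h2 := mul_left_cancel₀ hr' h1
    rw [ev_aeval, map_pow, ev_X_zero, ev_X_one, ev_X_two]
    have h3 := hUV a b c
    have h4 := hUV a (-b) c
    rw [neg_sq] at h4
    linarith
  have hev : ∀ a b c, ev a b c G = ev a (b ^ 2) c U := fun a b c => by
    rw [hGU, ev_aeval, map_pow, ev_X_zero, ev_X_one, ev_X_two]
  refine ⟨U, hev, fun a h c => ?_⟩
  set L : MvPolynomial (Fin 3) ℚ := aeval ![X 0 - X 1, X 1 ^ 2, C 2 * X 2] U with hL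
  set S : MvPolynomial (Fin 3) ℚ := C r * aeval ![X 0, kap * X 1, X 2] U with hS
  have hevL : ∀ a h c, ev a h c L = ev (a - h) (h ^ 2) (2 * c) U := fun a h c => by
    rw [hL, ev_aeval]
    simp
  have hevS : ∀ a h c, ev a h c S = r * ev a ((c + 2 * a) * h) c U := fun a h c => by
    rw [hS, map_mul, ev_aeval, map_mul, ev_kap, ev_X_zero, ev_X_one, ev_X_two, aeval_C,
      eq_ratCast]
  rw [← hevL, ← hevS]
  congr 1
  refine eq_of_ev prime_kap.ne_zero fun a h c hc => ?_
  rw [ev_kap] at hc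
  rw [← sub_eq_zero, ← map_sub]
  have hinf : {s : ℝ | ev ((Polynomial.C a).eval s) (Polynomial.X.eval s)
      ((Polynomial.C c).eval s) (L - S) = 0}.Infinite := by
    refine Set.infinite_of_injective_forall_mem (f := fun n : ℕ => (n : ℝ) ^ 2 / (c + 2 * a)) ?_
      fun n => ?_
    · intro i j hij
      have h2 := (div_left_inj' hc).1 hij
      rw [pow_left_inj₀ (by positivity) (by positivity) two_ne_zero] at h2
      exact_mod_cast h2
    · have h1 := hG a n c hc
      rw [hev, hev] at h1
      simp only [Set.mem_ofPred_eq, Polynomial.eval_C, Polynomial.eval_X, map_sub, hevL, hevS]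
      rw [h1, mul_div_cancel₀ _ hc, sub_self]
  simpa using ev_eq_zero_of_infinite hinf h

/-- A solution of the functional equation does not depend on `rho` on the plane `eps = 0`. -/
lemma ev_eq_of_functional_equation (hr : r ≠ 0) (hG : ∀ a b c, c + 2 * a ≠ 0 →
      ev (a - b ^ 2 / (c + 2 * a)) (b ^ 2 / (c + 2 * a)) (2 * c) G = r * ev a b c G)
    (a : ℝ) {c : ℝ} (hc : c ≠ 0) : ev a 0 c G = ev 0 0 c G := by
  obtain ⟨U, hGU, hU⟩ := exists_even_of_functional_equation hr hG
  have hr' : (r : ℝ) ≠ 0 := by exact_mod_cast hr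
  have hdouble : ∀ a c, ev a 0 (2 * c) U = r * ev a 0 c U := fun a c => by
    simpa using hU a 0 c
  obtain ⟨w, hw⟩ := exists_ev_eq_add U
  let f : ℝ → Polynomial ℝ := fun m => aeval ![Polynomial.X, 0, Polynomial.C m] U
  have hf : ∀ m s, (f m).eval s = ev s 0 m U := fun m s => by
    rw [eval_aeval, Polynomial.eval_X, Polynomial.eval_zero, Polynomial.eval_C]
  have hcrit : ∀ s, (f (-4 * s)).derivative.eval s = 0 := fun s => by
    obtain ⟨y, hy⟩ : ∃ y, ev s 0 (-4 * s) U = y := ⟨_, rfl⟩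
    have h1 : (f (-4 * s)).comp (Polynomial.C s - Polynomial.X) +
        Polynomial.X ^ 2 * aeval ![Polynomial.C s - Polynomial.X, Polynomial.X ^ 2,
          Polynomial.C (-4 * s)] w = Polynomial.C y := by
      refine Polynomial.funext fun h => ?_
      have h2 := hU s h (-2 * s)
      have h3 : 2 * (-2 * s) = -4 * s := by ring
      rw [show (-2 * s + 2 * s) * h = 0 by ring, ← hdouble, h3, hw, hy] at h2
      simpa [eval_aeval, hf] using h2
    have h4 := congrArg (fun P => (Polynomial.derivative P).eval 0) h1
    simpa [Polynomial.derivative_comp] using h4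
  have hscale : ∀ j : ℕ, f (2 ^ j * c) = Polynomial.C ((r : ℝ) ^ j) * f c := fun j => by
    refine Polynomial.funext fun s => ?_
    rw [Polynomial.eval_mul, Polynomial.eval_C, hf, hf]
    induction j with
    | zero => simp
    | succ j ih => rw [pow_succ', mul_assoc, hdouble, ih, pow_succ', mul_assoc]
  have hder : (f c).derivative = 0 := by
    refine Polynomial.eq_zero_of_infinite_isRoot _ (Set.infinite_of_injective_forall_mem
      (f := fun j : ℕ => 2 ^ j * c / (-4)) (fun i j hij => ?_) fun j => ?_)
    · have h1 := mul_right_cancel₀ hc ((div_left_inj' (by norm_num)).1 hij)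
      exact pow_right_injective₀ (by norm_num : (0 : ℝ) < 2) (by norm_num) h1
    · have h1 := hcrit (2 ^ j * c / (-4))
      rw [mul_div_cancel₀ _ (by norm_num), hscale, Polynomial.derivative_C_mul,
        Polynomial.eval_mul, Polynomial.eval_C] at h1
      exact (mul_eq_zero.1 h1).resolve_left (pow_ne_zero _ hr')
  have hconst := Polynomial.eq_C_of_natDegree_eq_zero
    (Polynomial.derivative_eq_zero.1 hder)
  rw [hGU, hGU, zero_pow two_ne_zero, ← hf, ← hf, hconst, Polynomial.eval_C, Polynomial.eval_C]

end FunctionalEquation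

/-- The quantities `rho k`, `eps k` and `pw k` satisfy no algebraic relation for all large `k`. -/
lemma eq_zero_of_mem_vanishing {P : MvPolynomial (Fin 3) ℚ} (hP : P ∈ vanishing) : P = 0 := by
  by_contra hP0
  obtain ⟨G, hG, hG0, hdvd⟩ := vanishing_generator ⟨P, hP, hP0⟩
  obtain ⟨r, hr, hFE⟩ := exists_functional_equation hG hG0 hdvd
  have hconst := fun a {c} => ev_eq_of_functional_equation hr hFE a (c := c)
  set u : Polynomial ℚ := aeval ![0, 0, Polynomial.X] G with hu
  have hevu : ∀ c : ℝ, Polynomial.aeval c u = ev 0 0 c G := fun c => by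
    rw [hu, ← AlgHom.comp_apply]
    congr 1
    ext i : 1
    fin_cases i <;> simp
  have hu0 : u ≠ 0 := fun h => by
    refine atZero_generator_ne_zero hG hG0 hdvd (eq_of_ev (H := X 2) (X_ne_zero 2) ?_)
    intro a b c hc
    rw [ev_X_two] at hc
    rw [ev_atZero, map_zero, hconst a hc, ← hevu, h, map_zero]
  obtain ⟨w, hw⟩ := exists_ev_eq_add G
  obtain ⟨δ, hδ, hδu⟩ := exists_le_abs_aeval_pw hu0
  have hne := eventually_add_eps_mul_ne_zero hδ hδu (isSmall_ev w)
  obtain ⟨k, hk, hk'⟩ := (hne.and hG).exists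
  refine hk ?_
  rw [hevu, ← hconst (rho k) (by linarith [two_le_pw k]), ← hw, hk']

lemma tendsto_rho_inv {t : ℝ}
    (ht : Tendsto (fun n : ℕ => (p (n + 2) : ℝ) / (q (n + 2) : ℝ)) atTop (nhds t)) :
    Tendsto rho atTop (nhds t⁻¹) := by
  have hsub : Tendsto (fun k : ℕ => 2 ^ (k + 1) - 2) atTop atTop :=
    tendsto_atTop_mono (fun k => by
      have := Nat.lt_two_pow_self (n := k)
      simp only [id]
      rw [pow_succ]
      omega)
      tendsto_id
  have h : Tendsto (fun k => (rho k)⁻¹) atTop (nhds t) := by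
    refine (ht.comp hsub).congr fun k => ?_
    have h2 : 2 ^ (k + 1) - 2 + 2 = 2 ^ (k + 1) :=
      Nat.sub_add_cancel (by have := Nat.one_le_two_pow (n := k); rw [pow_succ]; omega)
    rw [rho, inv_div, Function.comp_apply, h2]
    rfl
  have ht1 : 1 ≤ t := ge_of_tendsto' h fun k => (one_le_inv₀ (rho_pos k)).2 (rho_le_one k)
  simpa using h.inv₀ (by linarith)

end RulerCF

/-- σ² is transcendental over ℚ. -/
theorem sigma_sq_transcendental (σ : ℝ)
    (hσ : Tendsto (fun n : ℕ => (p (n + 2) : ℝ) / (q (n + 2) : ℝ)) atTop (nhds σ)) :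
    Transcendental ℚ (σ ^ 2) := by
  intro halg
  have hint : IsIntegral ℚ σ⁻¹ := (halg.of_pow two_pos).inv.isIntegral
  obtain ⟨P, hP0, hP⟩ := RulerCF.exists_vanishing hint (RulerCF.tendsto_rho_inv hσ)
  exact hP0 (RulerCF.eq_zero_of_mem_vanishing (RulerCF.mem_vanishing.2 hP))
end

section
/- The real number σ is transcendental over ℚ. -/
namespace RulerFraction

open Filter Asymptotics Polynomial Topology

/-- The orbit of `(4, 2)` under `(a, b) ↦ (a ^ 2 + a * b - 2, 2 * a * b)`. -/
def orbit : ℕ → ℤ × ℤ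
  | 0 => (4, 2)
  | n + 1 => ((orbit n).1 ^ 2 + (orbit n).1 * (orbit n).2 - 2, 2 * (orbit n).1 * (orbit n).2)

/-- First coordinate of `orbit`. -/
noncomputable def U (n : ℕ) : ℝ := (orbit n).1

/-- Second coordinate of `orbit`. -/
noncomputable def V (n : ℕ) : ℝ := (orbit n).2

theorem U_zero : U 0 = 4 := by simp [U, orbit]

theorem V_zero : V 0 = 2 := by simp [V, orbit]

theorem U_succ (n : ℕ) : U (n + 1) = U n ^ 2 + U n * V n - 2 := by simp [U, V, orbit]

theorem V_succ (n : ℕ) : V (n + 1) = 2 * U n * V n := by simp [U, V, orbit]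

theorem two_le_V_and_V_lt_U (n : ℕ) : 2 ≤ V n ∧ V n + 1 ≤ U n := by
  induction n with
  | zero => rw [U_zero, V_zero]; norm_num
  | succ n ih =>
    obtain ⟨h1, h2⟩ := ih
    rw [U_succ, V_succ]
    constructor <;> nlinarith

theorem two_le_V (n : ℕ) : 2 ≤ V n := (two_le_V_and_V_lt_U n).1

theorem V_lt_U (n : ℕ) : V n < U n := by linarith [(two_le_V_and_V_lt_U n).2]

theorem V_pos (n : ℕ) : 0 < V n := by linarith [two_le_V n]

theorem U_pos (n : ℕ) : 0 < U n := by linarith [V_pos n, V_lt_U n]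

theorem U_le (n : ℕ) : U n ≤ 2 * V n := by
  induction n with
  | zero => rw [U_zero, V_zero]; norm_num
  | succ n ih =>
    rw [U_succ, V_succ]
    nlinarith [U_pos n, V_lt_U n]

theorem two_pow_two_pow_le_V (n : ℕ) : (2 : ℝ) ^ 2 ^ n ≤ V n := by
  induction n with
  | zero => rw [V_zero]; norm_num
  | succ n ih =>
    have h : (0 : ℝ) < 2 ^ 2 ^ n := by positivity
    rw [V_succ, pow_succ, pow_mul]
    nlinarith [V_lt_U n]

/-- The local coordinate `1 / V` at infinity. -/
noncomputable def t (n : ℕ) : ℝ := (V n)⁻¹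

/-- The ratio `U / V`. -/
noncomputable def ρ (n : ℕ) : ℝ := U n / V n

theorem t_pos (n : ℕ) : 0 < t n := inv_pos.2 (V_pos n)

theorem t_le (n : ℕ) : t n ≤ 1 / 2 := by
  rw [t, inv_le_comm₀ (V_pos n) (by norm_num)]
  linarith [two_le_V n]

theorem V_eq (n : ℕ) : V n = (t n)⁻¹ := by simp [t]

theorem U_eq (n : ℕ) : U n = ρ n * (t n)⁻¹ := by
  rw [← V_eq, ρ, div_mul_cancel₀ _ (V_pos n).ne']

theorem one_lt_ρ (n : ℕ) : 1 < ρ n := by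
  rw [ρ, one_lt_div (V_pos n)]
  exact V_lt_U n

theorem ρ_pos (n : ℕ) : 0 < ρ n := by linarith [one_lt_ρ n]

theorem t_succ (n : ℕ) : t (n + 1) = t n ^ 2 * (2 * ρ n)⁻¹ := by
  have := (V_pos n).ne'
  have := (U_pos n).ne'
  rw [t, V_succ, t, ρ]
  field_simp

theorem ρ_succ (n : ℕ) : ρ (n + 1) = (ρ n + 1) / 2 - 2 * t (n + 1) := by
  have := (V_pos n).ne'
  have := (U_pos n).ne'
  rw [t, ρ, U_succ, V_succ, ρ]
  field_simp

theorem t_succ_le (n : ℕ) : t (n + 1) ≤ t n ^ 2 / 2 := by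
  have h := ρ_pos n
  have h1 := one_lt_ρ n
  rw [t_succ, div_eq_mul_inv]
  gcongr
  linarith

theorem exists_limit : ∃ φ : ℝ, 0 < φ ∧ Tendsto (fun n ↦ 2 ^ n * (ρ n - 1)) atTop (𝓝 φ) ∧
    ∀ n, φ / 2 ^ n ≤ ρ n - 1 ∧ ρ n - 1 ≤ φ / 2 ^ n + 4 * t n ^ 2 := by
  have hanti : Antitone fun n ↦ 2 ^ n * (ρ n - 1) := by
    refine antitone_nat_of_succ_le fun n ↦ ?_
    have h := t_pos (n + 1)
    have h2 : (0 : ℝ) < 2 ^ n := by positivity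
    rw [ρ_succ, pow_succ]
    nlinarith [mul_pos h h2]
  have hmono : Monotone fun n ↦ 2 ^ n * (ρ n - 1) - 2 ^ n * (4 * t n ^ 2) := by
    refine monotone_nat_of_le_succ fun n ↦ ?_
    have h := t_pos n
    have h1 := t_succ_le n
    have h3 := t_le n
    have h4 := t_pos (n + 1)
    have h2 : (0 : ℝ) < 2 ^ n := by positivity
    have h5 : t (n + 1) ≤ t n ^ 2 / 2 := h1
    have h6 : t n ^ 2 ≤ 1 / 4 := by nlinarith
    have h7 : t (n + 1) ^ 2 ≤ t n ^ 2 / 16 := by nlinarith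
    have h8 : 2 ^ n * (4 * t (n + 1) + 8 * t (n + 1) ^ 2) ≤ 2 ^ n * (4 * t n ^ 2) := by
      gcongr
      linarith
    rw [ρ_succ, pow_succ (2 : ℝ) n]
    linarith
  have hbdd : BddBelow (Set.range fun n ↦ 2 ^ n * (ρ n - 1)) := by
    refine ⟨0, ?_⟩
    rintro _ ⟨n, rfl⟩
    exact mul_nonneg (by positivity) (by linarith [one_lt_ρ n])
  have hlim := tendsto_atTop_ciInf hanti hbdd
  set φ := ⨅ n, 2 ^ n * (ρ n - 1) with hφ
  have hupper : ∀ n, φ ≤ 2 ^ n * (ρ n - 1) := fun n ↦ hanti.le_of_tendsto hlim n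
  have hlower : ∀ n, 2 ^ n * (ρ n - 1) - 2 ^ n * (4 * t n ^ 2) ≤ φ := by
    intro n
    refine ge_of_tendsto hlim (eventually_atTop.2 ⟨n, fun m hm ↦ (hmono hm).trans ?_⟩)
    have : (0 : ℝ) ≤ 2 ^ m * (4 * t m ^ 2) := by positivity
    linarith
  refine ⟨φ, ?_, hlim, fun n ↦ ⟨?_, ?_⟩⟩
  · have h := hlower 1
    rw [ρ, t, U_succ 0, V_succ 0, U_zero, V_zero] at h
    norm_num at h
    linarith
  · rw [div_le_iff₀ (by positivity)]
    linarith [hupper n]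
  · have h := hlower n
    have h2 : (0 : ℝ) < 2 ^ n := by positivity
    have h3 : ρ n - 1 - 4 * t n ^ 2 ≤ φ / 2 ^ n := by
      rw [le_div_iff₀ h2]
      linarith
    linarith

theorem tendsto_two_pow_mul_t (L : ℕ) : Tendsto (fun n ↦ (2 ^ n) ^ L * t n) atTop (𝓝 0) := by
  have h := (tendsto_pow_const_div_const_pow_of_one_lt L (r := (2 : ℝ)) (by norm_num)).comp
    (tendsto_pow_atTop_atTop_of_one_lt (r := 2) (by norm_num))
  refine squeeze_zero (fun n ↦ mul_nonneg (by positivity) (t_pos n).le) (fun n ↦ ?_) h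
  simp only [Function.comp_apply, Nat.cast_pow, Nat.cast_ofNat, div_eq_mul_inv]
  gcongr
  rw [t]
  gcongr
  exact two_pow_two_pow_le_V n

theorem tendsto_t : Tendsto t atTop (𝓝 0) := by
  simpa using tendsto_two_pow_mul_t 0

theorem div_two_pow_succ (φ : ℝ) (n : ℕ) : φ / 2 ^ (n + 1) = 2⁻¹ * (φ / 2 ^ n) := by
  rw [pow_succ]
  field_simp

theorem tendsto_div_two_pow (φ : ℝ) : Tendsto (fun n : ℕ ↦ φ / 2 ^ n) atTop (𝓝 0) :=
  tendsto_const_nhds.div_atTop (tendsto_pow_atTop_atTop_of_one_lt (by norm_num))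

theorem tendsto_aeval (φ : ℝ) (D : ℚ[X]) :
    Tendsto (fun n : ℕ ↦ aeval (φ / 2 ^ n) D) atTop (𝓝 (D.eval 0 : ℚ)) := by
  have h : aeval (0 : ℝ) D = (D.eval 0 : ℚ) := by
    rw [← coeff_zero_eq_aeval_zero', coeff_zero_eq_eval_zero]; rfl
  rw [← h]
  exact (D.continuous_aeval.tendsto 0).comp (tendsto_div_two_pow φ)

theorem tendsto_aevalAeval (φ : ℝ) (G : ℚ[X][X]) :
    Tendsto (fun n : ℕ ↦ aevalAeval (φ / 2 ^ n) (t n) G) atTop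
      (𝓝 (((G.coeff 0).eval 0 : ℚ) : ℝ)) := by
  induction G using Polynomial.induction_on' with
  | add P Q hP hQ =>
    simp only [map_add, coeff_add, eval_add, Rat.cast_add]
    exact hP.add hQ
  | monomial k c =>
    simp only [← C_mul_X_pow_eq_monomial, map_mul, map_pow, aevalAeval_C, aevalAeval_Y]
    have h := (tendsto_aeval φ c).mul (tendsto_t.pow k)
    rcases Nat.eq_zero_or_pos k with rfl | hk
    · simpa using h
    · simpa [hk.ne', hk.ne] using h

theorem aeval_isBigO_one (φ : ℝ) (D : ℚ[X]) :
    (fun n : ℕ ↦ aeval (φ / 2 ^ n) D) =O[atTop] fun _ ↦ (1 : ℝ) :=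
  (tendsto_aeval φ D).isBigO_one ℝ

theorem aevalAeval_isBigO_one (φ : ℝ) (G : ℚ[X][X]) :
    (fun n : ℕ ↦ aevalAeval (φ / 2 ^ n) (t n) G) =O[atTop] fun _ ↦ (1 : ℝ) :=
  (tendsto_aevalAeval φ G).isBigO_one ℝ

theorem t_pow_isBigO {j k : ℕ} (h : j ≤ k) :
    (fun n ↦ t n ^ k) =O[atTop] fun n ↦ t n ^ j := by
  refine .of_norm_le fun n ↦ ?_
  have := t_pos n
  rw [Real.norm_of_nonneg (by positivity)]
  exact pow_le_pow_of_le_one this.le (by linarith [t_le n]) h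

/-- The sequence `h` agrees up to `O(t ^ K)` with a polynomial in `t` whose coefficients are
rational functions of `φ / 2 ^ n` with a common denominator not vanishing at `0`. -/
def HasExpansion (φ : ℝ) (K : ℕ) (h : ℕ → ℝ) : Prop :=
  ∃ D : ℚ[X], D.eval 0 ≠ 0 ∧ ∃ G : ℚ[X][X],
    (fun n ↦ aeval (φ / 2 ^ n) D * h n - aevalAeval (φ / 2 ^ n) (t n) G)
      =O[atTop] fun n ↦ t n ^ K

namespace HasExpansion

variable {φ : ℝ} {K : ℕ} {h h₁ h₂ : ℕ → ℝ}

theorem mono {J : ℕ} (hh : HasExpansion φ K h) (hJ : J ≤ K) : HasExpansion φ J h := by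
  obtain ⟨D, hD, G, hG⟩ := hh
  exact ⟨D, hD, G, hG.trans (t_pow_isBigO hJ)⟩

theorem of_aevalAeval (G : ℚ[X][X]) :
    HasExpansion φ K fun n ↦ aevalAeval (φ / 2 ^ n) (t n) G :=
  ⟨1, by simp, G, by simpa using isBigO_zero _ _⟩

theorem of_aeval (c : ℚ[X]) : HasExpansion φ K fun n ↦ aeval (φ / 2 ^ n) c := by
  simpa only [aevalAeval_C] using of_aevalAeval (φ := φ) (K := K) (C c)

theorem const (c : ℚ) : HasExpansion φ K fun _ ↦ (c : ℝ) := by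
  simpa using of_aeval (φ := φ) (K := K) (C c)

theorem t_pow (k : ℕ) : HasExpansion φ K fun n ↦ t n ^ k := by
  simpa only [map_pow, aevalAeval_Y] using of_aevalAeval (φ := φ) (K := K) (X ^ k)

theorem congr_isBigO (hh : HasExpansion φ K h₁)
    (h12 : (fun n ↦ h₂ n - h₁ n) =O[atTop] fun n ↦ t n ^ K) : HasExpansion φ K h₂ := by
  obtain ⟨D, hD, G, hG⟩ := hh
  refine ⟨D, hD, G, ?_⟩
  have h1 := (aeval_isBigO_one φ D).mul h12
  simp only [one_mul] at h1
  have := h1.add hG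
  refine this.congr_left fun n ↦ ?_
  ring

theorem isBigO_one (hh : HasExpansion φ K h) : h =O[atTop] fun _ ↦ (1 : ℝ) := by
  obtain ⟨D, hD, G, hG⟩ := hh
  have hG' := hG.trans (t_pow_isBigO (Nat.zero_le K))
  simp only [pow_zero] at hG'
  have hDh := hG'.add (aevalAeval_isBigO_one φ G)
  have hlim := tendsto_aeval φ D
  have hD' : ((D.eval 0 : ℚ) : ℝ) ≠ 0 := by exact_mod_cast hD
  have hinv := (hlim.inv₀ hD').isBigO_one ℝ
  have := hinv.mul hDh
  simp only [one_mul] at this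
  refine this.congr' ?_ EventuallyEq.rfl
  filter_upwards [hlim.eventually_ne hD'] with n hn
  field_simp
  ring

theorem add (hh₁ : HasExpansion φ K h₁) (hh₂ : HasExpansion φ K h₂) :
    HasExpansion φ K fun n ↦ h₁ n + h₂ n := by
  obtain ⟨D₁, hD₁, G₁, hG₁⟩ := hh₁
  obtain ⟨D₂, hD₂, G₂, hG₂⟩ := hh₂
  refine ⟨D₁ * D₂, by simp [hD₁, hD₂], C D₂ * G₁ + C D₁ * G₂, ?_⟩
  have h1 := (aeval_isBigO_one φ D₂).mul hG₁
  have h2 := (aeval_isBigO_one φ D₁).mul hG₂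
  simp only [one_mul] at h1 h2
  refine (h1.add h2).congr_left fun n ↦ ?_
  simp only [map_mul, map_add, aevalAeval_C]
  ring

theorem mul (hh₁ : HasExpansion φ K h₁) (hh₂ : HasExpansion φ K h₂) :
    HasExpansion φ K fun n ↦ h₁ n * h₂ n := by
  have hb := hh₁.isBigO_one
  obtain ⟨D₁, hD₁, G₁, hG₁⟩ := hh₁
  obtain ⟨D₂, hD₂, G₂, hG₂⟩ := hh₂
  refine ⟨D₁ * D₂, by simp [hD₁, hD₂], G₁ * G₂, ?_⟩
  have h1 := ((aeval_isBigO_one φ D₁).mul hb).mul hG₂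
  have h2 := (aevalAeval_isBigO_one φ G₂).mul hG₁
  simp only [one_mul] at h1 h2
  refine (h1.add h2).congr_left fun n ↦ ?_
  simp only [map_mul]
  ring

theorem pow (hh : HasExpansion φ K h) (k : ℕ) : HasExpansion φ K fun n ↦ h n ^ k := by
  induction k with
  | zero => simpa using const (φ := φ) (K := K) 1
  | succ k ih => simpa only [pow_succ] using ih.mul hh

theorem t_pow_mul (hh : HasExpansion φ K h) (k : ℕ) :
    HasExpansion φ (K + k) fun n ↦ t n ^ k * h n := by
  obtain ⟨D, hD, G, hG⟩ := hh
  refine ⟨D, hD, X ^ k * G, ?_⟩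
  refine (((isBigO_refl (fun n ↦ t n ^ k) atTop).mul hG).congr_left fun n ↦ ?_).trans
    (.of_norm_le fun n ↦ ?_)
  · simp only [map_mul, map_pow, aevalAeval_Y]
    ring
  · have := t_pos n
    rw [← pow_add, add_comm, Real.norm_of_nonneg (by positivity)]

theorem of_aeval_mul {D : ℚ[X]} (hD : D.eval 0 ≠ 0)
    (hh : HasExpansion φ K fun n ↦ aeval (φ / 2 ^ n) D * h n) : HasExpansion φ K h := by
  obtain ⟨D', hD', G, hG⟩ := hh
  refine ⟨D' * D, by simp [hD, hD'], G, hG.congr_left fun n ↦ ?_⟩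
  simp only [map_mul]
  ring

theorem inv (hh : HasExpansion φ K h) {l : ℝ} (hl : l ≠ 0) (hlim : Tendsto h atTop (𝓝 l)) :
    HasExpansion φ K fun n ↦ (h n)⁻¹ := by
  rcases Nat.eq_zero_or_pos K with rfl | hK
  · refine congr_isBigO (const 0) ?_
    simpa using (hlim.inv₀ hl).isBigO_one ℝ
  have hinv : (fun n ↦ (h n)⁻¹) =O[atTop] fun _ ↦ (1 : ℝ) := (hlim.inv₀ hl).isBigO_one ℝ
  obtain ⟨D, hD, G, hG⟩ := hh
  have hc : (G.coeff 0).eval 0 ≠ 0 := by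
    have h1 : Tendsto (fun n ↦ aeval (φ / 2 ^ n) D * h n - aevalAeval (φ / 2 ^ n) (t n) G)
        atTop (𝓝 (((D.eval 0 : ℚ) : ℝ) * l - ((G.coeff 0).eval 0 : ℚ))) :=
      ((tendsto_aeval φ D).mul hlim).sub (tendsto_aevalAeval φ G)
    have h2 : Tendsto (fun n ↦ aeval (φ / 2 ^ n) D * h n - aevalAeval (φ / 2 ^ n) (t n) G)
        atTop (𝓝 0) := by
      refine hG.trans_tendsto ?_
      simpa [hK.ne'] using tendsto_t.pow K
    have h3 := tendsto_nhds_unique h1 h2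
    intro h0
    rw [h0, Rat.cast_zero, sub_zero] at h3
    exact mul_ne_zero (by exact_mod_cast hD) hl h3
  have key : ∀ k ≤ K, HasExpansion φ k fun n ↦ (h n)⁻¹ := by
    intro k
    induction k with
    | zero => exact fun _ ↦ congr_isBigO (const 0) (by simpa using hinv)
    | succ k ih =>
      intro hk
      have hGinv : HasExpansion φ (k + 1) fun n ↦
          t n ^ 1 * (aevalAeval (φ / 2 ^ n) (t n) (divX G) * (h n)⁻¹) :=
        ((of_aevalAeval (divX G)).mul (ih (by omega))).t_pow_mul 1
      refine of_aeval_mul hc (congr_isBigO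
        ((of_aeval (φ := φ) D).add ((const (-1)).mul hGinv)) ?_)
      have h5 := ((hG.trans (t_pow_isBigO hk)).mul hinv).neg_left
      simp only [mul_one] at h5
      refine h5.congr' ?_ EventuallyEq.rfl
      filter_upwards [hlim.eventually_ne hl] with n hn
      have h6 : aevalAeval (φ / 2 ^ n) (t n) G =
          aevalAeval (φ / 2 ^ n) (t n) (divX G) * t n + aeval (φ / 2 ^ n) (G.coeff 0) := by
        conv_lhs => rw [← divX_mul_X_add G]
        simp only [map_add, map_mul, aevalAeval_C, aevalAeval_Y]
      rw [h6]
      field_simp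
      push_cast
      ring
  exact key K le_rfl

theorem aevalAeval_shift (ht : HasExpansion φ K fun n ↦ t (n + 1)) (G : ℚ[X][X]) :
    HasExpansion φ K fun n ↦ aevalAeval (φ / 2 ^ (n + 1)) (t (n + 1)) G := by
  induction G using Polynomial.induction_on' with
  | add P Q hP hQ => simpa only [map_add] using hP.add hQ
  | monomial n c =>
    simp only [← C_mul_X_pow_eq_monomial, map_mul, map_pow, aevalAeval_C, aevalAeval_Y]
    refine mul ?_ (ht.pow n)
    have : (fun n : ℕ ↦ aeval (φ / 2 ^ (n + 1)) c) =
        fun n ↦ aeval (φ / 2 ^ n) (c.comp (C 2⁻¹ * X)) := by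
      funext n
      rw [aeval_comp, div_two_pow_succ]
      simp
    rw [this]
    exact of_aeval _

theorem shift {J : ℕ} (hh : HasExpansion φ J h) (ht : HasExpansion φ K fun n ↦ t (n + 1))
    (hK : K ≤ 2 * J) : HasExpansion φ K fun n ↦ h (n + 1) := by
  obtain ⟨D, hD, G, hG⟩ := hh
  refine of_aeval_mul (D := D.comp (C 2⁻¹ * X)) (by simpa using hD)
    (congr_isBigO (ht.aevalAeval_shift G) ?_)
  have h1 : (fun n ↦ t (n + 1)) =O[atTop] fun n ↦ t n ^ 2 := by
    refine .of_norm_le fun n ↦ ?_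
    rw [Real.norm_of_nonneg (t_pos _).le]
    linarith [t_succ_le n, sq_nonneg (t n)]
  have h2 := (hG.comp_tendsto (tendsto_add_atTop_nat 1)).trans (h1.pow J)
  simp only [← pow_mul] at h2
  refine (h2.trans (t_pow_isBigO hK)).congr_left fun n ↦ ?_
  simp [aeval_comp, div_two_pow_succ]

end HasExpansion

theorem tendsto_ρ : Tendsto ρ atTop (𝓝 1) := by
  obtain ⟨φ, -, -, hφ⟩ := exists_limit
  have h1 : Tendsto (fun n : ℕ ↦ 1 + (φ / 2 ^ n + 4 * t n ^ 2)) atTop (𝓝 1) := by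
    simpa using ((tendsto_div_two_pow φ).add ((tendsto_t.pow 2).const_mul 4)).const_add 1
  exact tendsto_of_tendsto_of_tendsto_of_le_of_le tendsto_const_nhds h1
    (fun n ↦ (one_lt_ρ n).le) fun n ↦ by linarith [hφ n]

theorem hasExpansion_ρ {φ : ℝ}
    (hφ : ∀ n, φ / 2 ^ n ≤ ρ n - 1 ∧ ρ n - 1 ≤ φ / 2 ^ n + 4 * t n ^ 2) (K : ℕ) :
    HasExpansion φ K ρ := by
  have hO : (fun n ↦ ρ n - (1 + φ / 2 ^ n)) =O[atTop] fun n ↦ t n ^ 2 := by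
    refine .of_bound 4 (Eventually.of_forall fun n ↦ ?_)
    rw [Real.norm_of_nonneg (by linarith [hφ n]), Real.norm_of_nonneg (by positivity)]
    linarith [hφ n]
  have key : ∀ k, HasExpansion φ (2 * k + 2) ρ := by
    intro k
    induction k with
    | zero =>
      refine HasExpansion.congr_isBigO (h₁ := fun n ↦ 1 + φ / 2 ^ n) ?_ hO
      have h : HasExpansion φ 2 fun n ↦ aeval (φ / 2 ^ n) (1 + X : ℚ[X]) := .of_aeval _
      simpa only [map_add, map_one, aeval_X] using h
    | succ k ih =>
      have h1 : HasExpansion φ (2 * k + 2) fun n ↦ (2 * ρ n)⁻¹ := by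
        refine HasExpansion.inv (l := 2 * 1) ?_ (by norm_num) (tendsto_ρ.const_mul 2)
        simpa using (HasExpansion.const 2).mul ih
      have ht : HasExpansion φ (2 * (k + 1) + 2) fun n ↦ t (n + 1) := by
        simp only [t_succ]
        exact h1.t_pow_mul 2
      have h2 := ih.shift ht (by omega)
      have h3 := (((HasExpansion.const 2).mul h2).add (HasExpansion.const (-1))).add
        ((HasExpansion.const 4).mul ht)
      refine h3.congr_isBigO ?_
      refine (isBigO_zero _ _).congr_left fun n ↦ ?_
      rw [ρ_succ]
      push_cast
      ring
  exact (key K).mono (by omega)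

theorem aevalAeval_isBigO_t_pow (φ : ℝ) {K : ℕ} {G : ℚ[X][X]} (hG : ∀ k < K, G.coeff k = 0) :
    (fun n : ℕ ↦ aevalAeval (φ / 2 ^ n) (t n) G) =O[atTop] fun n ↦ t n ^ K := by
  obtain ⟨H, rfl⟩ := X_pow_dvd_iff.2 hG
  simpa using (isBigO_refl (fun n ↦ t n ^ K) atTop).mul (aevalAeval_isBigO_one φ H)

theorem exists_sum_isBigO {ι : Type*} [Fintype ι] {φ : ℝ} {K : ℕ} (h : ι → ℕ → ℝ)
    (hh : ∀ i, HasExpansion φ K (h i)) (hK : K < Fintype.card ι) :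
    ∃ p : ι → ℚ[X], p ≠ 0 ∧
      (fun n ↦ ∑ i, aeval (φ / 2 ^ n) (p i) * h i n) =O[atTop] fun n ↦ t n ^ K := by
  choose D hD G hG using hh
  have hdep : ¬ LinearIndependent ℚ[X] fun i ↦ fun k : Fin K ↦ (G i).coeff k := by
    intro hind
    have := hind.fintype_card_le_finrank
    simp only [Module.finrank_fintype_fun_eq_card, Fintype.card_fin] at this
    omega
  obtain ⟨c, hc, i, hi⟩ := Fintype.not_linearIndependent_iff.1 hdep
  have hDi : D i ≠ 0 := fun h0 ↦ hD i (by simp [h0])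
  refine ⟨fun i ↦ c i * D i, fun h0 ↦ mul_ne_zero hi hDi (congrFun h0 i), ?_⟩
  have h1 : (fun n : ℕ ↦ aevalAeval (φ / 2 ^ n) (t n) (∑ i, C (c i) * G i))
      =O[atTop] fun n ↦ t n ^ K := by
    refine aevalAeval_isBigO_t_pow φ fun k hk ↦ ?_
    simpa [finsetSum_coeff] using congrFun hc ⟨k, hk⟩
  have h2 : (fun n : ℕ ↦ ∑ i, aeval (φ / 2 ^ n) (c i) *
      (aeval (φ / 2 ^ n) (D i) * h i n - aevalAeval (φ / 2 ^ n) (t n) (G i)))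
      =O[atTop] fun n ↦ t n ^ K :=
    .fun_sum fun i _ ↦ by simpa only [one_mul] using (aeval_isBigO_one φ (c i)).mul (hG i)
  refine (h1.add h2).congr_left fun n ↦ ?_
  rw [map_sum, ← Finset.sum_add_distrib]
  refine Finset.sum_congr rfl fun i _ ↦ ?_
  simp only [map_mul, aevalAeval_C]
  ring

theorem exists_auxiliary {φ : ℝ}
    (hφ : ∀ n, φ / 2 ^ n ≤ ρ n - 1 ∧ ρ n - 1 ≤ φ / 2 ^ n + 4 * t n ^ 2) {N K : ℕ}
    (hK : K < (N + 1) ^ 2) :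
    ∃ p : Fin (N + 1) × Fin (N + 1) → ℚ[X], p ≠ 0 ∧
      (fun n ↦ t n ^ (2 * N) *
        ∑ i, aeval (φ / 2 ^ n) (p i) * (U n ^ (i.1 : ℕ) * V n ^ (i.2 : ℕ)))
        =O[atTop] fun n ↦ t n ^ K := by
  have hexp (i : Fin (N + 1) × Fin (N + 1)) : HasExpansion φ K fun n ↦
      ρ n ^ (i.1 : ℕ) * t n ^ (2 * N - i.1 - i.2) :=
    ((hasExpansion_ρ hφ K).pow _).mul (.t_pow _)
  obtain ⟨p, hp, h⟩ := exists_sum_isBigO _ hexp (by simpa [← sq] using hK)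
  refine ⟨p, hp, h.congr_left fun n ↦ ?_⟩
  rw [Finset.mul_sum]
  refine Finset.sum_congr rfl fun i _ ↦ ?_
  have hN : 2 * N = (2 * N - i.1 - i.2) + i.1 + i.2 := by omega
  have ht := (t_pos n).ne'
  conv_rhs => rw [hN, pow_add, pow_add, U_eq, V_eq, mul_pow, inv_pow, inv_pow]
  field_simp

theorem t_isLittleO_aeval_ρ {g : ℚ[X]} (hg : g ≠ 0) :
    t =o[atTop] fun n ↦ aeval (ρ n) g := by
  obtain ⟨φ, hφ0, -, hφ⟩ := exists_limit
  obtain ⟨g', hg', hdvd⟩ := exists_eq_pow_rootMultiplicity_mul_and_not_dvd g hg 1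
  set j := g.rootMultiplicity 1
  have hg'1 : g'.eval 1 ≠ 0 := by rwa [Ne, ← IsRoot, ← dvd_iff_isRoot]
  have h1 : t =o[atTop] fun n ↦ (ρ n - 1) ^ j := by
    refine .trans_isBigO (g := fun n : ℕ ↦ (φ / 2 ^ n) ^ j) ?_ (.of_norm_le fun n ↦ ?_)
    · rw [isLittleO_iff_tendsto fun n h ↦ absurd h (by positivity)]
      have := (tendsto_two_pow_mul_t j).mul_const (φ ^ j)⁻¹
      rw [zero_mul] at this
      refine this.congr fun n ↦ ?_
      rw [div_pow]
      field_simp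
    · rw [Real.norm_of_nonneg (by positivity)]
      exact pow_le_pow_left₀ (by positivity) (hφ n).1 j
  have h2 : Tendsto (fun n ↦ aeval (ρ n) g') atTop (𝓝 (g'.eval 1 : ℚ)) := by
    have h := (g'.continuous_aeval (A := ℝ)).tendsto 1 |>.comp tendsto_ρ
    have h3 : aeval (1 : ℝ) g' = (g'.eval 1 : ℚ) := by
      simpa using aeval_algebraMap_apply ℝ (1 : ℚ) g'
    rwa [h3] at h
  have h3 : (fun _ : ℕ ↦ (1 : ℝ)) =O[atTop] fun n ↦ aeval (ρ n) g' := by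
    have hne : ((g'.eval 1 : ℚ) : ℝ) ≠ 0 := by exact_mod_cast hg'1
    exact (isBigO_const_left_iff_pos_le_norm one_ne_zero).2
      ⟨‖((g'.eval 1 : ℚ) : ℝ)‖ / 2, by positivity,
        (h2.norm.eventually_const_le (half_lt_self (norm_pos_iff.2 hne)))⟩
  refine (h1.mul_isBigO h3).congr (fun n ↦ mul_one _) fun n ↦ ?_
  rw [hg']
  simp

theorem eventually_aevalAeval_ρ_V_ne_zero {B : ℚ[X][X]} (hB : B ≠ 0) :
    ∀ᶠ n in atTop, aevalAeval (ρ n) (V n) B ≠ 0 := by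
  have hO (b : ℚ[X]) : (fun n ↦ aeval (ρ n) b) =O[atTop] fun _ ↦ (1 : ℝ) :=
    (((b.continuous_aeval (A := ℝ)).tendsto 1).comp tendsto_ρ).isBigO_one ℝ
  set m := B.natDegree
  have h1 : (fun n ↦ ∑ k ∈ Finset.range m, t n ^ (m - k) * aeval (ρ n) (B.coeff k))
      =O[atTop] t := by
    refine .fun_sum fun k hk ↦ ?_
    have hk := Finset.mem_range.1 hk
    have := (t_pow_isBigO (show 1 ≤ m - k by omega)).mul (hO (B.coeff k))
    simpa only [pow_one, mul_one] using this
  have hlead := t_isLittleO_aeval_ρ (leadingCoeff_ne_zero.2 hB)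
  have h2 := (h1.trans_isLittleO hlead).bound (show (0 : ℝ) < 1 / 2 by norm_num)
  have h3 := hlead.bound one_pos
  filter_upwards [h2, h3] with n h2 h3 h0
  have hexp : t n ^ m * aevalAeval (ρ n) (V n) B =
      ∑ k ∈ Finset.range m, t n ^ (m - k) * aeval (ρ n) (B.coeff k) +
        aeval (ρ n) B.leadingCoeff := by
    have ht := (t_pos n).ne'
    conv_lhs => rw [B.as_sum_range_C_mul_X_pow, map_sum, Finset.mul_sum, Finset.sum_range_succ]
    simp only [map_mul, map_pow, aevalAeval_C, aevalAeval_Y]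
    congr 1
    · refine Finset.sum_congr rfl fun k hk ↦ ?_
      have hk := Finset.mem_range.1 hk
      rw [V_eq, inv_pow, pow_sub₀ _ ht hk.le]
      ring
    · rw [V_eq, inv_pow]
      change t n ^ m * (aeval (ρ n) B.leadingCoeff * (t n ^ m)⁻¹) = _
      field_simp
  rw [h0, mul_zero] at hexp
  rw [eq_neg_of_add_eq_zero_left hexp.symm, norm_neg] at h2
  have h4 := norm_pos_iff.2 (t_pos n).ne'
  linarith

/-- The substitution `u = y z`, `v = z`. -/
noncomputable def blowUp : ℚ[X][X] →+* ℚ[X][X] :=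
  eval₂RingHom (eval₂RingHom (C.comp C) (C X * X)) X

theorem aevalAeval_blowUp (a b : ℝ) (A : ℚ[X][X]) :
    aevalAeval a b (blowUp A) = aevalAeval (a * b) b A := by
  induction A using Polynomial.induction_on' with
  | add P Q hP hQ => simp only [map_add, hP, hQ]
  | monomial j c =>
    induction c using Polynomial.induction_on' with
    | add P Q hP hQ => simp only [map_add, hP, hQ]
    | monomial i c =>
      simp only [← C_mul_X_pow_eq_monomial, map_mul, map_pow, aevalAeval_C, aevalAeval_Y,
        blowUp, coe_eval₂RingHom, eval₂_C, eval₂_X, aeval_C, aeval_X,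
        RingHom.comp_apply]

theorem coeff_blowUp (A : ℚ[X][X]) (i j : ℕ) :
    ((blowUp A).coeff (i + j)).coeff i = (A.coeff j).coeff i := by
  induction A using Polynomial.induction_on' with
  | add P Q hP hQ => simp only [map_add, coeff_add, hP, hQ]
  | monomial j' c =>
    induction c using Polynomial.induction_on' with
    | add P Q hP hQ => simp only [map_add, coeff_add, hP, hQ]
    | monomial i' c =>
      have : blowUp (monomial j' (monomial i' c)) = monomial (i' + j') (monomial i' c) := by
        simp only [← C_mul_X_pow_eq_monomial, map_mul, map_pow,
          blowUp, coe_eval₂RingHom, eval₂_C, eval₂_X, RingHom.comp_apply]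
        ring
      rw [this]
      simp only [coeff_monomial]
      split_ifs <;> simp_all [coeff_monomial]
      omega

theorem blowUp_ne_zero {A : ℚ[X][X]} (hA : A ≠ 0) : blowUp A ≠ 0 := by
  refine fun h ↦ hA (ext fun j ↦ ext fun i ↦ ?_)
  simp [← coeff_blowUp, h]

theorem eventually_aevalAeval_ne_zero {A : ℚ[X][X]} (hA : A ≠ 0) :
    ∀ᶠ n in atTop, aevalAeval (U n) (V n) A ≠ 0 := by
  filter_upwards [eventually_aevalAeval_ρ_V_ne_zero (blowUp_ne_zero hA)] with n hn
  rwa [aevalAeval_blowUp, ρ, div_mul_cancel₀ _ (V_pos n).ne'] at hn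

end RulerFraction

namespace RulerFraction

open Polynomial

/-- The ring endomorphism `u ↦ u² + u v - 2`, `v ↦ 2 u v` of `ℚ[u][v]`. -/
noncomputable def step : ℚ[X][X] →+* ℚ[X][X] :=
  eval₂RingHom (eval₂RingHom (C.comp C) (C (X ^ 2 - C 2) + C X * X)) (C (C 2 * X) * X)

theorem step_C (a : ℚ[X]) :
    step (C a) = eval₂RingHom (C.comp C) (C (X ^ 2 - C 2) + C X * X) a := by
  rw [step, coe_eval₂RingHom, eval₂_C]

theorem step_X : step X = C (C 2 * X) * X := by
  rw [step, coe_eval₂RingHom, eval₂_X]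

theorem step_C_C (a : ℚ) : step (C (C a)) = C (C a) := by
  rw [step_C, coe_eval₂RingHom, eval₂_C, RingHom.comp_apply]

theorem step_C_X : step (C X) = C (X ^ 2 - C 2) + C X * X := by
  rw [step_C, coe_eval₂RingHom, eval₂_X]

theorem coeff_step_C (a : ℚ[X]) : (step (C a)).coeff 0 = a.comp (X ^ 2 - C 2) ∧
    (step (C a)).coeff 1 = X * (derivative a).comp (X ^ 2 - C 2) := by
  induction a using Polynomial.induction_on with
  | C a => simp [step_C_C, coeff_C]
  | add P Q hP hQ => simp [hP, hQ, mul_add]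
  | monomial n a ih =>
    have h0 : (step (C X)).coeff 0 = X ^ 2 - C 2 := by
      rw [step_C_X, coeff_add, coeff_C_zero, coeff_C_mul, coeff_X_zero, mul_zero, add_zero]
    have h1 : (step (C X)).coeff 1 = X := by
      rw [step_C_X, coeff_add, coeff_C_succ, coeff_C_mul, coeff_X_one, mul_one, zero_add]
    rw [pow_succ, ← mul_assoc, C_mul, map_mul, mul_coeff_zero, mul_coeff_one, ih.1, ih.2, h0, h1]
    constructor
    · simp
    · rw [derivative_mul (f := C a * X ^ n)]
      simp
      ring

theorem step_eq (A : ℚ[X][X]) :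
    step A = step (C (A.coeff 0)) + step (divX A) * (C (C 2 * X) * X) := by
  conv_lhs => rw [← divX_mul_X_add A, map_add, map_mul, step_X]
  ring

theorem coeff_zero_step (A : ℚ[X][X]) :
    (step A).coeff 0 = (A.coeff 0).comp (X ^ 2 - C 2) := by
  rw [step_eq, coeff_add, (coeff_step_C _).1]
  simp

theorem coeff_one_step (A : ℚ[X][X]) :
    (step A).coeff 1 = X * (derivative (A.coeff 0)).comp (X ^ 2 - C 2) +
      C 2 * X * (A.coeff 1).comp (X ^ 2 - C 2) := by
  rw [step_eq, coeff_add, (coeff_step_C _).2, ← mul_assoc, coeff_mul_X, mul_coeff_zero,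
    coeff_zero_step]
  simp
  ring

theorem X_sub_two_comp : (X - C 2 : ℚ[X]).comp (X ^ 2 - C 2) = (X - C 2) * (X + C 2) := by
  simp only [sub_comp, X_comp, C_comp]
  have : (C 2 : ℚ[X]) * C 2 = C 2 + C 2 := by rw [← C_mul, ← C_add]; norm_num
  linear_combination this

theorem X_sub_two_pow_mul_comp (i : ℕ) (a : ℚ[X]) :
    ((X - C 2) ^ i * a).comp (X ^ 2 - C 2) =
      (X - C 2) ^ i * (X + C 2) ^ i * a.comp (X ^ 2 - C 2) := by
  rw [mul_comp, pow_comp, X_sub_two_comp, mul_pow]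

theorem eval_two_comp (a : ℚ[X]) : (a.comp (X ^ 2 - C 2)).eval 2 = a.eval 2 := by
  rw [eval_comp]
  norm_num

theorem exists_eq_X_sub_two_pow_mul {a : ℚ[X]} (ha : a ≠ 0) :
    ∃ (i : ℕ) (b : ℚ[X]), a = (X - C 2) ^ i * b ∧ b.eval 2 ≠ 0 := by
  obtain ⟨b, hb, hdvd⟩ := exists_eq_pow_rootMultiplicity_mul_and_not_dvd a ha 2
  exact ⟨_, b, hb, by rwa [Ne, ← IsRoot, ← dvd_iff_isRoot]⟩

theorem X_sub_two_ne_zero : (X - C 2 : ℚ[X]) ≠ 0 := X_sub_C_ne_zero 2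

theorem eval_two_eq_zero {i j : ℕ} {a b : ℚ[X]} (h : (X - C 2) ^ i * a = (X - C 2) ^ j * b)
    (hij : i < j) : a.eval 2 = 0 := by
  obtain ⟨k, rfl⟩ := Nat.exists_eq_add_of_lt hij
  have : a = (X - C 2) ^ (k + 1) * b :=
    mul_left_cancel₀ (pow_ne_zero i X_sub_two_ne_zero) (by rw [h]; ring)
  simp [this]

theorem X_sub_two_mul_derivative (i : ℕ) (a : ℚ[X]) :
    (X - C 2) * derivative ((X - C 2) ^ i * a) =
      (X - C 2) ^ i * (C (i : ℚ) * a + (X - C 2) * derivative a) := by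
  rw [derivative_mul, derivative_X_sub_C_pow]
  rcases i with - | i
  · simp
  · simp
    ring

/-- The order at `2` of the leading coefficients in a functional equation. -/
theorem order_relation {m a b i j : ℕ} {α β : ℚ[X]} (hα : α.eval 2 ≠ 0) (hβ : β.eval 2 ≠ 0)
    (h : C (2 ^ m) * (C 2 * X) ^ a * ((X - C 2) ^ j * β) * ((X - C 2) ^ i * α).comp (X ^ 2 - C 2) =
      (C 2 * X) ^ b * ((X - C 2) ^ j * β).comp (X ^ 2 - C 2) * ((X - C 2) ^ i * α)) :
    2 * i = m + 2 * j := by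
  have hα0 : (X - C 2) ^ i * α ≠ 0 :=
    mul_ne_zero (pow_ne_zero _ X_sub_two_ne_zero) (by rintro rfl; simp at hα)
  have hβ0 : (X - C 2) ^ j * β ≠ 0 :=
    mul_ne_zero (pow_ne_zero _ X_sub_two_ne_zero) (by rintro rfl; simp at hβ)
  have hlc (c : ℚ[X]) : (c.comp (X ^ 2 - C 2)).leadingCoeff = c.leadingCoeff := by
    rw [leadingCoeff_comp (by rw [natDegree_X_pow_sub_C]; norm_num),
      leadingCoeff_X_pow_sub_C (by norm_num), one_pow, mul_one]
  have h1 := congrArg leadingCoeff h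
  have h2 : (2 : ℚ) ^ (m + a) = 2 ^ b := by
    refine mul_right_cancel₀ (mul_ne_zero (leadingCoeff_ne_zero.2 hβ0)
      (leadingCoeff_ne_zero.2 hα0)) ?_
    simp only [leadingCoeff_mul, hlc, leadingCoeff_pow, leadingCoeff_C, leadingCoeff_X] at h1 ⊢
    rw [pow_add]
    linear_combination h1
  have h3 : m + a = b := Nat.pow_right_injective le_rfl (by exact_mod_cast h2)
  have h4 : C (2 ^ m) * (C 2 * X) ^ a * β * ((X + C 2) ^ i * α.comp (X ^ 2 - C 2)) =
      (C 2 * X) ^ b * ((X + C 2) ^ j * β.comp (X ^ 2 - C 2)) * α := by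
    refine mul_left_cancel₀ (pow_ne_zero (i + j) X_sub_two_ne_zero) ?_
    rw [X_sub_two_pow_mul_comp, X_sub_two_pow_mul_comp] at h
    rw [pow_add]
    linear_combination h
  have h5 := congrArg (eval 2) h4
  simp only [eval_mul, eval_pow, eval_add, eval_X, eval_C, eval_two_comp] at h5
  have h6 : (2 : ℚ) ^ (m + 2 * a + 2 * i) = 2 ^ (2 * b + 2 * j) := by
    refine mul_right_cancel₀ (mul_ne_zero hα hβ) ?_
    rw [pow_add, pow_add, pow_add, pow_mul, pow_mul, pow_mul, pow_mul]
    simp only [show (2 : ℚ) * 2 = 4 by norm_num, show (2 : ℚ) + 2 = 4 by norm_num,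
      show (2 : ℚ) ^ 2 = 4 by norm_num] at h5 ⊢
    linear_combination h5
  have h7 : m + 2 * a + 2 * i = 2 * b + 2 * j :=
    Nat.pow_right_injective le_rfl (by exact_mod_cast h6)
  omega

theorem no_first_order_solution {i j : ℕ} {α β N : ℚ[X]} (hα : α.eval 2 ≠ 0) (hβ : β.eval 2 ≠ 0)
    (hij : i ≠ j) {A B : ℚ[X]} (hA : A = (X - C 2) ^ i * α) (hB : B = (X - C 2) ^ j * β)
    (h : N * (A * B).comp (X ^ 2 - C 2) = A * B * (C 2 * X * N.comp (X ^ 2 - C 2) +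
      X * (derivative A * B - A * derivative B).comp (X ^ 2 - C 2))) : False := by
  set D := α * β with hD
  set M := (C (i : ℚ) * α + (X - C 2) * derivative α) * β -
    α * (C (j : ℚ) * β + (X - C 2) * derivative β) with hM
  have hD2 : D.eval 2 ≠ 0 := by rw [hD, eval_mul]; exact mul_ne_zero hα hβ
  have hD0 : D ≠ 0 := by rintro h0; simp [h0] at hD2
  have hM2 : M.eval 2 ≠ 0 := by
    have : M.eval 2 = (i - j) * (α.eval 2 * β.eval 2) := by
      simp [hM]
      ring
    rw [this]
    exact mul_ne_zero (sub_ne_zero.2 (by exact_mod_cast hij)) (mul_ne_zero hα hβ)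
  have hAB : A * B = (X - C 2) ^ (i + j) * D := by rw [hA, hB, pow_add]; ring
  have hder : (X - C 2) * (derivative A * B - A * derivative B) = (X - C 2) ^ (i + j) * M := by
    have h1 := X_sub_two_mul_derivative i α
    have h2 := X_sub_two_mul_derivative j β
    rw [← hA] at h1
    rw [← hB] at h2
    rw [hM, pow_add]
    linear_combination B * h1 - A * h2 + (X - C 2) ^ i *
      (C (i : ℚ) * α + (X - C 2) * derivative α) * hB - (X - C 2) ^ j *
      (C (j : ℚ) * β + (X - C 2) * derivative β) * hA
  have hder' := congrArg (fun P ↦ P.comp (X ^ 2 - C 2)) hder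
  simp only [X_sub_two_pow_mul_comp] at hder'
  rw [mul_comp, X_sub_two_comp] at hder'
  rw [hAB, X_sub_two_pow_mul_comp] at h
  generalize (derivative A * B - A * derivative B).comp (X ^ 2 - C 2) = W at h hder'
  set d := i + j
  have key : N * (X - C 2) * (X + C 2) ^ (d + 1) * D.comp (X ^ 2 - C 2) =
      D * (C 2 * X * ((X - C 2) * (X + C 2)) * N.comp (X ^ 2 - C 2) +
        X * ((X - C 2) ^ d * (X + C 2) ^ d * M.comp (X ^ 2 - C 2))) := by
    refine mul_left_cancel₀ (pow_ne_zero d X_sub_two_ne_zero) ?_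
    linear_combination (X - C 2) * (X + C 2) * h + (X - C 2) ^ d * D * X * hder'
  have hDM : (D * X * (X + C 2) ^ d * M.comp (X ^ 2 - C 2)).eval 2 ≠ 0 := by
    simp only [eval_mul, eval_two_comp, eval_X, eval_pow, eval_add, eval_C]
    positivity
  rcases eq_or_ne N 0 with rfl | hN
  · have : (X - C 2) ^ d * (D * X * (X + C 2) ^ d * M.comp (X ^ 2 - C 2)) = 0 := by
      simp only [zero_comp, zero_mul, mul_zero, zero_add] at key
      linear_combination -key
    rcases mul_eq_zero.1 this with h0 | h0
    · exact pow_ne_zero _ X_sub_two_ne_zero h0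
    · simp [h0] at hDM
  obtain ⟨n, N', rfl, hN'⟩ := exists_eq_X_sub_two_pow_mul hN
  have key2 : (X - C 2) ^ (n + 1) * ((X + C 2) ^ (d + 1) * N' * D.comp (X ^ 2 - C 2) -
      C 2 * X * D * (X + C 2) ^ (n + 1) * N'.comp (X ^ 2 - C 2)) =
      (X - C 2) ^ d * (D * X * (X + C 2) ^ d * M.comp (X ^ 2 - C 2)) := by
    rw [X_sub_two_pow_mul_comp] at key
    linear_combination key
  have hbr : ((X + C 2) ^ (d + 1) * N' * D.comp (X ^ 2 - C 2) -
      C 2 * X * D * (X + C 2) ^ (n + 1) * N'.comp (X ^ 2 - C 2)).eval 2 =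
      (4 ^ (d + 1) - 4 ^ (n + 2)) * (N'.eval 2 * D.eval 2) := by
    simp only [eval_sub, eval_mul, eval_two_comp, eval_X, eval_pow, eval_add, eval_C]
    norm_num
    ring
  rcases lt_trichotomy (n + 1) d with hlt | heq | hgt
  · have h0 := eval_two_eq_zero key2 hlt
    rw [hbr] at h0
    have h1 : (4 : ℚ) ^ (d + 1) = 4 ^ (n + 2) := by
      rcases mul_eq_zero.1 h0 with h0 | h0
      · linarith
      · exact absurd h0 (mul_ne_zero hN' hD2)
    have : d + 1 = n + 2 := Nat.pow_right_injective (show 2 ≤ 4 by norm_num) (by exact_mod_cast h1)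
    omega
  · have h0 := mul_left_cancel₀ (pow_ne_zero (n + 1) X_sub_two_ne_zero)
      (key2.trans (by rw [heq]))
    rw [← h0, hbr, ← heq] at hDM
    simp at hDM
  · exact hDM (eval_two_eq_zero key2.symm hgt)

theorem no_functional_equation {A B : ℚ[X][X]} (hA : A ≠ 0) (hB : B ≠ 0) {m : ℕ} (hm : 1 ≤ m)
    (h : C (C (2 ^ m)) * B * step A = step B * A) : False := by
  obtain ⟨A', hA', hdA⟩ := exists_eq_pow_rootMultiplicity_mul_and_not_dvd A hA 0
  obtain ⟨B', hB', hdB⟩ := exists_eq_pow_rootMultiplicity_mul_and_not_dvd B hB 0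
  generalize rootMultiplicity 0 A = a at hA'
  generalize rootMultiplicity 0 B = b at hB'
  rw [C_0, sub_zero] at hA' hB' hdA hdB
  rw [X_dvd_iff] at hdA hdB
  subst hA' hB'
  have h1 : C (C (2 ^ m) * (C 2 * X) ^ a) * (B' * step A') =
      C ((C 2 * X) ^ b) * (step B' * A') := by
    refine mul_left_cancel₀ (pow_ne_zero (a + b) (X_ne_zero (R := ℚ[X]))) ?_
    rw [map_mul, map_mul, map_pow step, map_pow step, step_X, mul_pow, mul_pow] at h
    rw [C_mul, C_pow (n := a), C_pow (n := b), pow_add]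
    linear_combination h
  have c0 := congrArg (fun P ↦ P.coeff 0) h1
  have c1 := congrArg (fun P ↦ P.coeff 1) h1
  simp only [coeff_C_mul] at c0 c1
  simp only [mul_coeff_zero, mul_coeff_one, coeff_zero_step, coeff_one_step] at c0 c1
  generalize A'.coeff 0 = α at *
  generalize B'.coeff 0 = β at *
  generalize A'.coeff 1 = α₁ at *
  generalize B'.coeff 1 = β₁ at *
  obtain ⟨i, α', hα, hα'⟩ := exists_eq_X_sub_two_pow_mul hdA
  obtain ⟨j, β', hβ, hβ'⟩ := exists_eq_X_sub_two_pow_mul hdB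
  have hij : i ≠ j := by
    have := order_relation (m := m) (a := a) (b := b) hα' hβ' (by
      rw [← hα, ← hβ]
      linear_combination c0)
    omega
  refine no_first_order_solution (N := α₁ * β - α * β₁) hα' hβ' hij hα hβ ?_
  have hl : C (2 ^ m) * (C 2 * X) ^ a ≠ (0 : ℚ[X]) := by
    refine mul_ne_zero (C_ne_zero.2 (by positivity)) (pow_ne_zero _ (mul_ne_zero ?_ X_ne_zero))
    exact C_ne_zero.2 two_ne_zero
  refine mul_left_cancel₀ hl ?_
  simp only [mul_comp, sub_comp]
  generalize C (2 ^ m) * (C 2 * X) ^ a = l at *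
  generalize (C 2 * X : ℚ[X]) ^ b = r at *
  linear_combination (β.comp (X ^ 2 - C 2) * α₁ +
    α * (X * (derivative β).comp (X ^ 2 - C 2) + C 2 * X * β₁.comp (X ^ 2 - C 2))) * c0 -
    α * β.comp (X ^ 2 - C 2) * c1

end RulerFraction

namespace RulerFraction

open Filter Polynomial

theorem aevalAeval_step (n : ℕ) (A : ℚ[X][X]) :
    aevalAeval (U n) (V n) (step A) = aevalAeval (U (n + 1)) (V (n + 1)) A := by
  induction A using Polynomial.induction_on' with
  | add P Q hP hQ => simp only [map_add, hP, hQ]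
  | monomial j c =>
    induction c using Polynomial.induction_on' with
    | add P Q hP hQ => simp only [map_add, hP, hQ]
    | monomial i c =>
      simp only [← C_mul_X_pow_eq_monomial, map_mul, map_pow, map_add, map_sub,
        step_C_C, step_C_X, step_X, aevalAeval_C, aevalAeval_Y, aeval_C, aeval_X, U_succ, V_succ]
      simp only [map_ofNat]
      ring

/-- Evaluation of a polynomial in `u`, `v` and a third variable at `U n`, `V n`, `φ / 2 ^ n`. -/
noncomputable def evalAt (φ : ℝ) (n : ℕ) : ℚ[X][X][X] →+* ℝ :=
  eval₂RingHom (aevalAeval (U n) (V n) : ℚ[X][X] →ₐ[ℚ] ℝ).toRingHom (φ / 2 ^ n)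

theorem evalAt_C (φ : ℝ) (n : ℕ) (A : ℚ[X][X]) :
    evalAt φ n (C A) = aevalAeval (U n) (V n) A := by
  rw [evalAt, coe_eval₂RingHom, eval₂_C]
  rfl

theorem evalAt_X (φ : ℝ) (n : ℕ) : evalAt φ n X = φ / 2 ^ n := by
  rw [evalAt, coe_eval₂RingHom, eval₂_X]

/-- The extension of `step` which halves the third variable. -/
noncomputable def stepX (P : ℚ[X][X][X]) : ℚ[X][X][X] :=
  (P.map step).comp (C (C (C 2⁻¹)) * X)

theorem evalAt_stepX (φ : ℝ) (n : ℕ) (P : ℚ[X][X][X]) :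
    evalAt φ n (stepX P) = evalAt φ (n + 1) P := by
  induction P using Polynomial.induction_on' with
  | add P Q hP hQ =>
    simpa only [stepX, Polynomial.map_add, add_comp, map_add] using congrArg₂ _ hP hQ
  | monomial j c =>
    rw [stepX, map_monomial, monomial_comp, ← C_mul_X_pow_eq_monomial]
    simp only [map_mul, map_pow, evalAt_C, evalAt_X, aevalAeval_step, aevalAeval_C, aeval_C,
      div_two_pow_succ]
    simp

theorem coeff_stepX (P : ℚ[X][X][X]) (i : ℕ) :
    (stepX P).coeff i = step (P.coeff i) * C (C (2⁻¹ ^ i)) := by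
  rw [stepX, comp_C_mul_X_coeff, coeff_map, C_pow, C_pow]

theorem frequently_evalAt_ne_zero {φ : ℝ} (hφ : φ ≠ 0) {P : ℚ[X][X][X]} (hP : P ≠ 0) :
    ∃ᶠ n in atTop, evalAt φ n P ≠ 0 := by
  intro h
  simp only [not_not] at h
  induction hL : P.natDegree using Nat.strong_induction_on generalizing P with
  | _ L ih =>
    have hlc : P.coeff L ≠ 0 := by rw [← hL]; exact leadingCoeff_ne_zero.2 hP
    have hlarge (i : ℕ) (hi : L < i) : P.coeff i = 0 := coeff_eq_zero_of_natDegree_lt (by omega)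
    set R := C (C (C (2 ^ L)) * P.coeff L) * stepX P - C (step (P.coeff L)) * P with hR
    have hcoeff (i : ℕ) : R.coeff i = C (C (2 ^ L * 2⁻¹ ^ i)) * P.coeff L * step (P.coeff i) -
        step (P.coeff L) * P.coeff i := by
      rw [hR, coeff_sub, coeff_C_mul, coeff_C_mul, coeff_stepX]
      simp only [C_mul]
      ring
    have hR0 : R = 0 := by
      by_contra hR0
      refine ih R.natDegree ?_ hR0 ?_ rfl
      · rw [natDegree_lt_iff_degree_lt hR0, degree_lt_iff_coeff_zero]
        intro i hi
        rw [hcoeff]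
        rcases hi.eq_or_lt with rfl | hi
        · rw [← mul_pow]
          norm_num
          ring
        · rw [hlarge i hi]
          simp
      · filter_upwards [h, (tendsto_add_atTop_nat 1).eventually h] with n h1 h2
        refine (map_sub (evalAt φ n) _ _).trans ?_
        rw [map_mul (evalAt φ n) _ (stepX P), map_mul (evalAt φ n) _ P, evalAt_stepX, h1, h2,
          mul_zero, mul_zero, sub_zero]
    have hsmall (i : ℕ) (hi : i < L) : P.coeff i = 0 := by
      by_contra hi0
      refine no_functional_equation hi0 hlc (m := L - i) (by omega) ?_
      have h1 := hcoeff i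
      rw [hR0, coeff_zero, inv_pow, ← pow_sub₀ _ two_ne_zero hi.le] at h1
      exact (sub_eq_zero.1 h1.symm)
    have hPX : P = C (P.coeff L) * X ^ L := by
      ext1 i
      rw [coeff_C_mul_X_pow]
      split_ifs with hi
      · rw [hi]
      · rcases Nat.lt_or_gt_of_ne hi with hi | hi
        exacts [hsmall i hi, hlarge i hi]
    obtain ⟨n, h1, h2⟩ := (h.and (eventually_aevalAeval_ne_zero hlc)).exists
    rw [hPX, map_mul, map_pow, evalAt_C, evalAt_X] at h1
    exact mul_ne_zero h2 (pow_ne_zero _ (by positivity)) h1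

end RulerFraction

namespace RulerFraction

open Polynomial

theorem norm_aeval_le {R : ℤ[X]} {L : ℕ} (hL : R.natDegree ≤ L) {H : ℝ}
    (hH : ∀ i, |(R.coeff i : ℝ)| ≤ H) (z : ℂ) :
    ‖aeval z R‖ ≤ (∑ i ∈ Finset.range (L + 1), ‖z‖ ^ i) * H := by
  rw [aeval_eq_sum_range' (Nat.lt_succ_of_le hL), Finset.sum_mul]
  refine (norm_sum_le _ _).trans (Finset.sum_le_sum fun i _ ↦ ?_)
  rw [zsmul_eq_mul, norm_mul, norm_pow, Complex.norm_intCast, mul_comm]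
  gcongr
  exact hH i

theorem isIntegral_pow_mul_aeval {K : Type*} [Field K] {θ : K} {b : ℤ}
    (hb : IsIntegral ℤ (b * θ)) {R : ℤ[X]} {L : ℕ} (hL : R.natDegree ≤ L) :
    IsIntegral ℤ ((b : K) ^ L * aeval θ R) := by
  rw [aeval_eq_sum_range' (Nat.lt_succ_of_le hL), Finset.mul_sum]
  refine IsIntegral.sum _ fun i hi ↦ ?_
  have hi := Nat.le_of_lt_succ (Finset.mem_range.1 hi)
  have h : (b : K) ^ L * R.coeff i • θ ^ i =
      algebraMap ℤ K (b ^ (L - i) * R.coeff i) * (b * θ) ^ i := by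
    obtain ⟨k, rfl⟩ := Nat.exists_eq_add_of_le hi
    rw [Nat.add_sub_cancel_left, zsmul_eq_mul, mul_pow, pow_add, algebraMap_int_eq, eq_intCast]
    push_cast
    ring
  rw [h]
  exact isIntegral_algebraMap.mul (hb.pow i)

/-- Liouville's inequality for integer polynomials of bounded degree at an algebraic number. -/
theorem exists_liouville {φ : ℝ} (hφ : IsAlgebraic ℚ φ) :
    ∃ d : ℕ, ∀ L : ℕ, ∃ c : ℝ, 0 < c ∧ ∀ (R : ℤ[X]) (H : ℝ), R.natDegree ≤ L →
      (∀ i, |(R.coeff i : ℝ)| ≤ H) → aeval φ R ≠ 0 → c ≤ |aeval φ R| * H ^ d := by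
  let K := IntermediateField.adjoin ℚ {φ}
  have : FiniteDimensional ℚ K := IntermediateField.adjoin.finiteDimensional hφ.isIntegral
  let θ : K := IntermediateField.AdjoinSimple.gen ℚ φ
  let σ₀ : K →ₐ[ℚ] ℂ := (Algebra.ofId ℝ ℂ).restrictScalars ℚ |>.comp K.val
  have hσ₀ (R : ℤ[X]) : σ₀ (aeval θ R) = ((aeval φ R : ℝ) : ℂ) := by
    have h : K.val (aeval θ R) = aeval φ R :=
      (aeval_algHom_apply (K.val.restrictScalars ℤ) θ R).symm
    change algebraMap ℝ ℂ (K.val (aeval θ R)) = _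
    rw [h]
    rfl
  have hθ : IsAlgebraic ℤ θ :=
    (IsFractionRing.isAlgebraic_iff ℤ ℚ K).2 (Algebra.IsAlgebraic.isAlgebraic θ)
  obtain ⟨b, hb0, hb⟩ := hθ.exists_integral_multiple
  rw [zsmul_eq_mul] at hb
  classical
  refine ⟨(Finset.univ.erase σ₀).card, fun L ↦ ?_⟩
  set B : ℝ := |(b : ℝ)| ^ L with hB
  have hBpos : 0 < B := by positivity
  set c : ℝ := B * ∏ σ ∈ Finset.univ.erase σ₀,
    (B * ∑ i ∈ Finset.range (L + 1), ‖σ θ‖ ^ i) with hc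
  have hcpos : 0 < c := by
    refine mul_pos hBpos (Finset.prod_pos fun σ _ ↦ mul_pos hBpos ?_)
    exact Finset.sum_pos' (fun i _ ↦ by positivity) ⟨0, by simp⟩
  refine ⟨c⁻¹, inv_pos.2 hcpos, fun R H hL hH hR ↦ ?_⟩
  have hnorm (σ : K →ₐ[ℚ] ℂ) :
      ‖σ ((b : K) ^ L * aeval θ R)‖ = B * ‖σ (aeval θ R)‖ := by
    rw [map_mul, map_pow, map_intCast, norm_mul, norm_pow, Complex.norm_intCast]
  have hint := Algebra.isIntegral_norm ℚ (isIntegral_pow_mul_aeval hb hL)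
  obtain ⟨k, hk⟩ := IsIntegrallyClosed.isIntegral_iff.1 hint
  have hne : (b : K) ^ L * aeval θ R ≠ 0 := by
    refine mul_ne_zero (pow_ne_zero _ (by exact_mod_cast hb0)) fun h0 ↦ hR ?_
    have := hσ₀ R
    rw [h0, map_zero] at this
    exact_mod_cast this.symm
  have hk0 : k ≠ 0 := by
    rintro rfl
    rw [map_zero] at hk
    exact hne (Algebra.norm_eq_zero_iff.1 hk.symm)
  have hprod := Algebra.norm_eq_prod_embeddings ℚ ℂ ((b : K) ^ L * aeval θ R)
  rw [← hk] at hprod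
  have h1 : (1 : ℝ) ≤ ‖∏ σ : K →ₐ[ℚ] ℂ, σ ((b : K) ^ L * aeval θ R)‖ := by
    rw [← hprod]
    have : (1 : ℝ) ≤ |(k : ℝ)| := by exact_mod_cast Int.one_le_abs hk0
    simpa using this
  have h2 : ‖∏ σ : K →ₐ[ℚ] ℂ, σ ((b : K) ^ L * aeval θ R)‖ ≤
      B * |aeval φ R| * ∏ σ ∈ Finset.univ.erase σ₀,
        (B * (∑ i ∈ Finset.range (L + 1), ‖σ θ‖ ^ i) * H) := by
    rw [← Finset.mul_prod_erase _ _ (Finset.mem_univ σ₀), norm_mul, hnorm, hσ₀, Complex.norm_real,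
      Real.norm_eq_abs, norm_prod]
    gcongr with σ _
    rw [hnorm, mul_assoc]
    gcongr
    have : σ (aeval θ R) = aeval (σ θ) R := (aeval_algHom_apply (σ.restrictScalars ℤ) θ R).symm
    rw [this]
    exact norm_aeval_le hL hH _
  rw [Finset.prod_mul_distrib, Finset.prod_const] at h2
  rw [inv_le_iff_one_le_mul₀ hcpos]
  calc (1 : ℝ) ≤ _ := h1.trans h2
    _ = _ := by rw [hc]; ring

end RulerFraction

namespace RulerFraction

open Filter Asymptotics Polynomial Topology

theorem frequently_sum_ne_zero {φ : ℝ} (hφ : φ ≠ 0) {N : ℕ}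
    {p : Fin N × Fin N → ℚ[X]} (hp : p ≠ 0) :
    ∃ᶠ n in atTop,
      ∑ i, aeval (φ / 2 ^ n) (p i) * (U n ^ (i.1 : ℕ) * V n ^ (i.2 : ℕ)) ≠ 0 := by
  set P : ℚ[X][X][X] := ∑ i, (p i).map (C.comp C) *
    C (monomial (i.2 : ℕ) (monomial (i.1 : ℕ) 1)) with hP
  have hcoeff (i : Fin N × Fin N) (k : ℕ) :
      ((P.coeff k).coeff i.2).coeff i.1 = (p i).coeff k := by
    simp only [hP, finsetSum_coeff, coeff_mul_C, coeff_map, RingHom.comp_apply, C_mul_monomial,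
      coeff_monomial]
    rw [Finset.sum_eq_single i]
    · simp
    · intro j _ hj
      split_ifs with h2
      · rw [coeff_monomial, if_neg]
        exact fun h1 ↦ hj (Prod.ext (Fin.ext h1) (Fin.ext h2))
      · simp
    · simp
  have hP0 : P ≠ 0 := by
    intro h0
    refine hp (funext fun i ↦ ext fun k ↦ ?_)
    rw [← hcoeff, h0]
    simp
  refine (frequently_evalAt_ne_zero hφ hP0).mono fun n hn ↦ ?_
  convert hn using 1
  rw [hP, map_sum]
  refine Finset.sum_congr rfl fun i _ ↦ ?_
  rw [map_mul, evalAt_C, ← C_mul_X_pow_eq_monomial, ← C_mul_X_pow_eq_monomial]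
  simp only [map_mul, map_pow, aevalAeval_C, aevalAeval_Y, aeval_X, map_one, one_mul]
  congr 1
  rw [evalAt, coe_eval₂RingHom, eval₂_map, aeval_def]
  congr 1
  exact Subsingleton.elim _ _

theorem exists_common_denominator {ι : Type*} [Fintype ι] (p : ι → ℚ[X]) :
    ∃ b : ℤ, b ≠ 0 ∧ ∃ P : ι → ℤ[X], ∀ i,
      (P i).map (Int.castRingHom ℚ) = C (b : ℚ) * p i := by
  classical
  have h (i : ι) : ∃ b : ℤ, b ≠ 0 ∧ ∃ P : ℤ[X], P.map (Int.castRingHom ℚ) = C (b : ℚ) * p i := by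
    obtain ⟨b, hb0, hb⟩ := IsLocalization.integerNormalization_spec (nonZeroDivisors ℤ) (p i)
    refine ⟨b, nonZeroDivisors.ne_zero hb0, _, hb.trans ?_⟩
    rw [← Int.cast_smul_eq_zsmul ℚ, smul_eq_C_mul]
  choose b hb P hP using h
  refine ⟨∏ i, b i, Finset.prod_ne_zero_iff.2 fun i _ ↦ hb i,
    fun i ↦ C (∏ j ∈ Finset.univ.erase i, b j) * P i, fun i ↦ ?_⟩
  rw [Polynomial.map_mul, hP, map_C, ← mul_assoc, ← C_mul,
    ← Finset.prod_erase_mul _ _ (Finset.mem_univ i)]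
  simp

theorem exists_auxiliary_int {φ : ℝ}
    (hφ : ∀ n, φ / 2 ^ n ≤ ρ n - 1 ∧ ρ n - 1 ≤ φ / 2 ^ n + 4 * t n ^ 2) (hφ0 : φ ≠ 0) {N K : ℕ}
    (hK : K < (N + 1) ^ 2) :
    ∃ p : Fin (N + 1) × Fin (N + 1) → ℤ[X],
      (fun n ↦ t n ^ (2 * N) *
        ∑ i, aeval (φ / 2 ^ n) (p i) * (U n ^ (i.1 : ℕ) * V n ^ (i.2 : ℕ)))
        =O[atTop] (fun n ↦ t n ^ K) ∧
      ∃ᶠ n in atTop,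
        ∑ i, aeval (φ / 2 ^ n) (p i) * (U n ^ (i.1 : ℕ) * V n ^ (i.2 : ℕ)) ≠ 0 := by
  obtain ⟨p, hp, hO⟩ := exists_auxiliary hφ hK
  obtain ⟨b, hb, P, hP⟩ := exists_common_denominator p
  have hev (n : ℕ) : ∑ i, aeval (φ / 2 ^ n) (P i) * (U n ^ (i.1 : ℕ) * V n ^ (i.2 : ℕ)) =
      b * ∑ i, aeval (φ / 2 ^ n) (p i) * (U n ^ (i.1 : ℕ) * V n ^ (i.2 : ℕ)) := by
    rw [Finset.mul_sum]
    refine Finset.sum_congr rfl fun i _ ↦ ?_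
    have h := congrArg (aeval (φ / 2 ^ n)) (hP i)
    rw [map_mul, aeval_C, ← algebraMap_int_eq, aeval_map_algebraMap] at h
    rw [h]
    simp
    ring
  refine ⟨P, ?_, (frequently_sum_ne_zero hφ0 hp).mono fun n hn ↦ ?_⟩
  · simp only [hev]
    refine (hO.const_mul_left b).congr_left fun n ↦ ?_
    ring
  · rw [hev]
    exact mul_ne_zero (by exact_mod_cast hb) hn

/-- The polynomial obtained from `∑ i, w i * P i` by clearing denominators after the substitution
of `X / m` for `X`. -/
noncomputable def clear {ι : Type*} [Fintype ι] (L : ℕ) (P : ι → ℤ[X]) (m : ℤ) (w : ι → ℤ) :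
    ℤ[X] :=
  ∑ k ∈ Finset.range (L + 1), C (m ^ (L - k) * ∑ i, (P i).coeff k * w i) * X ^ k

theorem natDegree_clear_le {ι : Type*} [Fintype ι] (L : ℕ) (P : ι → ℤ[X]) (m : ℤ) (w : ι → ℤ) :
    (clear L P m w).natDegree ≤ L :=
  natDegree_sum_le_of_forall_le _ _ fun _ hk ↦
    (natDegree_C_mul_X_pow_le _ _).trans (Nat.le_of_lt_succ (Finset.mem_range.1 hk))

theorem aeval_clear {ι : Type*} [Fintype ι] {L : ℕ} {P : ι → ℤ[X]}
    (hL : ∀ i, (P i).natDegree ≤ L) {m : ℤ} (hm : m ≠ 0) (w : ι → ℤ) (x : ℝ) :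
    aeval x (clear L P m w) = (m : ℝ) ^ L * ∑ i, aeval (x / m) (P i) * w i := by
  have hm' : (m : ℝ) ≠ 0 := by exact_mod_cast hm
  have h (i : ι) : aeval (x / m) (P i) =
      ∑ k ∈ Finset.range (L + 1), (P i).coeff k * (x / m) ^ k := by
    rw [aeval_eq_sum_range' (Nat.lt_succ_of_le (hL i))]
    simp
  simp only [h, Finset.sum_mul]
  rw [Finset.sum_comm, clear, map_sum, Finset.mul_sum]
  refine Finset.sum_congr rfl fun k hk ↦ ?_
  have hk := Nat.le_of_lt_succ (Finset.mem_range.1 hk)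
  rw [map_mul, map_pow, aeval_X, aeval_C, algebraMap_int_eq, eq_intCast]
  push_cast
  rw [pow_sub₀ _ hm' hk, Finset.mul_sum, Finset.mul_sum, Finset.sum_mul]
  refine Finset.sum_congr rfl fun i _ ↦ ?_
  rw [div_pow]
  field_simp

theorem abs_coeff_clear_le {ι : Type*} [Fintype ι] (L : ℕ) (P : ι → ℤ[X]) {m : ℤ} (hm : 1 ≤ m)
    {w : ι → ℤ} {W : ℝ} (hw : ∀ i, |(w i : ℝ)| ≤ W) (k : ℕ) :
    |((clear L P m w).coeff k : ℝ)| ≤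
      (m : ℝ) ^ L * ((∑ k ∈ Finset.range (L + 1), ∑ i, |((P i).coeff k : ℝ)|) * W) := by
  have hm' : (1 : ℝ) ≤ m := by exact_mod_cast hm
  have hW (i : ι) : 0 ≤ W := (abs_nonneg _).trans (hw i)
  have hcoeff : (clear L P m w).coeff k =
      if k ∈ Finset.range (L + 1) then m ^ (L - k) * ∑ i, (P i).coeff k * w i else 0 := by
    simp only [clear, finsetSum_coeff, coeff_C_mul_X_pow, Finset.sum_ite_eq]
  rw [hcoeff]
  rcases isEmpty_or_nonempty ι with hι | ⟨⟨i₀⟩⟩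
  · simp
  split_ifs with hk
  · push_cast
    rw [abs_mul, abs_pow, abs_of_nonneg (by linarith : (0 : ℝ) ≤ m)]
    gcongr
    · exact Nat.sub_le L k
    refine (Finset.abs_sum_le_sum_abs _ _).trans ?_
    have h1 := Finset.single_le_sum (f := fun k ↦ ∑ i, |((P i).coeff k : ℝ)|)
      (fun _ _ ↦ Finset.sum_nonneg fun _ _ ↦ abs_nonneg _) hk
    refine le_trans ?_ (mul_le_mul_of_nonneg_right h1 (hW i₀))
    rw [Finset.sum_mul]
    refine Finset.sum_le_sum fun i _ ↦ ?_
    rw [abs_mul]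
    gcongr
    exact hw i
  · have := hW i₀
    simp only [Int.cast_zero, abs_zero]
    positivity

theorem transcendental_of_bounds {φ : ℝ} (hφ0 : 0 < φ)
    (hφ : ∀ n, φ / 2 ^ n ≤ ρ n - 1 ∧ ρ n - 1 ≤ φ / 2 ^ n + 4 * t n ^ 2) :
    Transcendental ℚ φ := by
  intro halg
  obtain ⟨d, hd⟩ := exists_liouville halg
  set N := 2 * (d + 1) with hN
  obtain ⟨p, hO, hfreq⟩ := exists_auxiliary_int hφ hφ0.ne' (N := N) (K := 2 * N * (d + 1) + 1)
    (by rw [hN]; ring_nf; omega)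
  set L := Finset.univ.sup fun i ↦ (p i).natDegree with hL
  have hLi (i) : (p i).natDegree ≤ L :=
    Finset.le_sup (f := fun i ↦ (p i).natDegree) (Finset.mem_univ i)
  obtain ⟨c, hc, hliou⟩ := hd L
  obtain ⟨C₁, hC₁⟩ := hO.bound
  set C₂ := ∑ k ∈ Finset.range (L + 1), ∑ i, |((p i).coeff k : ℝ)| with hC₂
  set w : ℕ → Fin (N + 1) × Fin (N + 1) → ℤ :=
    fun n i ↦ (orbit n).1 ^ (i.1 : ℕ) * (orbit n).2 ^ (i.2 : ℕ) with hw
  have hwcast (n) (i) : (w n i : ℝ) = U n ^ (i.1 : ℕ) * V n ^ (i.2 : ℕ) := by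
    simp [hw, U, V]
  have hwle (n) (i) : |(w n i : ℝ)| ≤ 2 ^ N * V n ^ (2 * N) := by
    have h1 := two_le_V n
    have h2 := U_le n
    have h3 := U_pos n
    rw [hwcast, abs_of_nonneg (by positivity)]
    have h4 : U n ^ (i.1 : ℕ) ≤ (2 * V n) ^ N := calc
      _ ≤ (2 * V n) ^ (i.1 : ℕ) := by gcongr
      _ ≤ _ := pow_le_pow_right₀ (by linarith) (Nat.le_of_lt_succ i.1.2)
    have h5 : V n ^ (i.2 : ℕ) ≤ V n ^ N :=
      pow_le_pow_right₀ (by linarith) (Nat.le_of_lt_succ i.2.2)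
    calc _ ≤ (2 * V n) ^ N * V n ^ N := by gcongr
      _ = _ := by rw [mul_pow, two_mul N, pow_add]; ring
  have hlim : Tendsto (fun n ↦ C₁ * (C₂ * 2 ^ N) ^ d * ((2 ^ n) ^ (L * (d + 1)) * t n)) atTop
      (𝓝 0) := by
    simpa using (tendsto_two_pow_mul_t (L * (d + 1))).const_mul (C₁ * (C₂ * 2 ^ N) ^ d)
  obtain ⟨n, ⟨hn, hn1⟩, hn2⟩ :=
    ((hfreq.and_eventually hC₁).and_eventually (hlim.eventually_lt_const hc)).exists
  refine hn2.not_ge ?_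
  have hev := aeval_clear hLi (m := 2 ^ n) (by positivity) (w n) φ
  have hle := hliou (clear L p (2 ^ n) (w n)) _ (natDegree_clear_le _ _ _ _)
    (abs_coeff_clear_le L p (one_le_pow₀ one_le_two) (hwle n)) (by
      rw [hev]
      simp only [hwcast]
      push_cast
      positivity)
  refine hle.trans ?_
  rw [hev]
  simp only [hwcast]
  push_cast
  have ht := t_pos n
  rw [norm_mul, Real.norm_of_nonneg (pow_nonneg ht.le _), Real.norm_of_nonneg (pow_nonneg ht.le _),
    Real.norm_eq_abs] at hn1
  rw [abs_mul, abs_of_nonneg (by positivity), ← hC₂]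
  generalize |∑ i, aeval (φ / 2 ^ n) (p i) * (U n ^ (i.1 : ℕ) * V n ^ (i.2 : ℕ))| = S at hn1 ⊢
  have hS : S ≤ C₁ * V n ^ (2 * N) * t n ^ (2 * N * (d + 1) + 1) := by
    refine le_of_mul_le_mul_left (hn1.trans_eq ?_) (pow_pos ht (2 * N))
    rw [V_eq, inv_pow]
    field_simp
  have hC₂0 : 0 ≤ C₂ := Finset.sum_nonneg fun _ _ ↦ Finset.sum_nonneg fun _ _ ↦ abs_nonneg _
  have hV := V_pos n
  calc _ ≤ (2 ^ n) ^ L * (C₁ * V n ^ (2 * N) * t n ^ (2 * N * (d + 1) + 1)) *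
        ((2 ^ n) ^ L * (C₂ * (2 ^ N * V n ^ (2 * N)))) ^ d := by gcongr
    _ = C₁ * (C₂ * 2 ^ N) ^ d * ((2 ^ n) ^ (L * (d + 1)) * t n) *
        ((V n ^ (2 * N)) ^ (d + 1) * (t n ^ (2 * N)) ^ (d + 1)) := by
      rw [pow_succ _ (2 * N * (d + 1)), pow_mul _ (2 * N), pow_mul _ L]
      simp only [mul_pow]
      ring
    _ = _ := by
      rw [← mul_pow, ← mul_pow, V_eq, inv_mul_cancel₀ ht.ne', one_pow, one_pow, mul_one]

end RulerFraction

namespace RulerFraction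

open Filter Topology
open Paper (p q s)

theorem padicValNat_two_pow_mul {v m : ℕ} (hm : ¬ 2 ∣ m) : padicValNat 2 (2 ^ v * m) = v := by
  have hm0 : m ≠ 0 := by rintro rfl; simp at hm
  rw [padicValNat.mul (by positivity) hm0, padicValNat.prime_pow,
    padicValNat.eq_zero_of_not_dvd hm, add_zero]

theorem s_two_pow_add {k i : ℕ} (h : i + 1 < 2 ^ k) : s (2 ^ k + i) = s i := by
  obtain ⟨v, m, hm, hi⟩ := Nat.exists_eq_pow_mul_and_not_dvd (n := i + 1) (by omega) 2 (by norm_num)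
  have hv : v < k := by
    have hm0 : 0 < m := Nat.pos_of_ne_zero (by rintro rfl; simp at hm)
    refine (Nat.pow_lt_pow_iff_right (a := 2) (by norm_num)).1 (lt_of_le_of_lt ?_ h)
    rw [hi]
    exact Nat.le_mul_of_pos_right _ hm0
  obtain ⟨j, rfl⟩ := Nat.exists_eq_add_of_lt hv
  rw [s, s, add_assoc, hi, show 2 ^ (v + j + 1) + 2 ^ v * m = 2 ^ v * (2 * 2 ^ j + m) by ring,
    padicValNat_two_pow_mul hm, padicValNat_two_pow_mul]
  rwa [Nat.dvd_add_right (Nat.dvd_mul_right 2 _)]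

theorem s_two_pow_sub_one (k : ℕ) : s (2 ^ k - 1) = 2 ^ k := by
  rw [s, Nat.sub_add_cancel Nat.one_le_two_pow, padicValNat.prime_pow]

theorem p_add_two (n : ℕ) : p (n + 2) = s n * p (n + 1) + p n := rfl

theorem q_add_two (n : ℕ) : q (n + 2) = s n * q (n + 1) + q n := rfl

theorem det_p_q (n : ℕ) : p (n + 1) * q n - p n * q (n + 1) = (-1) ^ n := by
  induction n with
  | zero => rfl
  | succ n ih =>
    rw [p_add_two, q_add_two, pow_succ, ← ih]
    ring

theorem p_q_two_pow_add (k : ℕ) : ∀ i ≤ 2 ^ k,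
    p (2 ^ k + i) = p (2 ^ k + 1) * p i + p (2 ^ k) * q i ∧
      q (2 ^ k + i) = q (2 ^ k + 1) * p i + q (2 ^ k) * q i
  | 0, _ => by simp [p, q]
  | 1, _ => by simp [p, q]
  | i + 2, hi => by
    have h1 := p_q_two_pow_add k i (by omega)
    have h2 := p_q_two_pow_add k (i + 1) (by omega)
    rw [← add_assoc] at h2
    rw [← add_assoc, p_add_two (2 ^ k + i), q_add_two (2 ^ k + i), p_add_two i, q_add_two i,
      s_two_pow_add (by omega), h1.1, h1.2, h2.1, h2.2]
    constructor <;> ring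

theorem p_q_eq_orbit (n : ℕ) : p (2 ^ (n + 1) - 1) = q (2 ^ (n + 1)) ∧
    (orbit n).2 = 2 ^ (n + 1) * p (2 ^ (n + 1)) ∧
    (orbit n).1 = (orbit n).2 + 2 * q (2 ^ (n + 1)) := by
  induction n with
  | zero => simp [orbit, p, q, s]
  | succ n ih =>
    obtain ⟨hsymm, hV, hU⟩ := ih
    have hpow : 2 ^ (n + 1 + 1) = 2 ^ (n + 1) + 2 ^ (n + 1) := by ring
    have hdet := det_p_q (2 ^ (n + 1) - 1)
    have hlast := p_q_two_pow_add (n + 1) (2 ^ (n + 1)) le_rfl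
    have hprev := (p_q_two_pow_add (n + 1) (2 ^ (n + 1) - 1) (Nat.sub_le _ _)).1
    have hp := p_add_two (2 ^ (n + 1) - 1)
    have hq := q_add_two (2 ^ (n + 1) - 1)
    have hone : 1 ≤ 2 ^ (n + 1) := Nat.one_le_two_pow
    have hodd : Odd (2 ^ (n + 1) - 1) := Nat.Even.sub_odd hone (by simp [Nat.even_pow]) odd_one
    rw [show 2 ^ (n + 1) - 1 + 2 = 2 ^ (n + 1) + 1 by omega, s_two_pow_sub_one,
      Nat.sub_add_cancel hone, hsymm] at hp
    rw [show 2 ^ (n + 1) - 1 + 2 = 2 ^ (n + 1) + 1 by omega, s_two_pow_sub_one,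
      Nat.sub_add_cancel hone] at hq
    rw [Nat.sub_add_cancel hone, hodd.neg_one_pow, hsymm] at hdet
    rw [← Nat.add_sub_assoc hone, hsymm] at hprev
    push_cast at hp hq
    simp only [orbit]
    rw [hpow, hlast.1, hlast.2, hprev, hU, hV, hp, hq]
    set a := p (2 ^ (n + 1))
    set b := q (2 ^ (n + 1))
    set c := q (2 ^ (n + 1) - 1)
    refine ⟨?_, ?_, ?_⟩
    · ring
    · ring
    · linear_combination -2 * hdet

theorem tendsto_p_div_q {φ : ℝ} (hφ : φ ≠ 0)
    (h : Tendsto (fun n ↦ 2 ^ n * (ρ n - 1)) atTop (𝓝 φ)) :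
    Tendsto (fun n : ℕ ↦ (p (2 ^ (n + 1)) : ℝ) / q (2 ^ (n + 1))) atTop (𝓝 φ⁻¹) := by
  refine (h.inv₀ hφ).congr fun n ↦ ?_
  obtain ⟨-, hV, hU⟩ := p_q_eq_orbit n
  have hV' : V n = 2 ^ (n + 1) * p (2 ^ (n + 1)) := by rw [V, hV]; push_cast; ring
  have hU' : U n = V n + 2 * q (2 ^ (n + 1)) := by rw [U, V, hU]; push_cast; ring
  have hV0 := V_pos n
  have h1 : ρ n - 1 = 2 * q (2 ^ (n + 1)) / V n := by
    rw [ρ, hU']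
    field_simp
    ring
  rw [h1, hV']
  generalize p (2 ^ (n + 1)) = a
  generalize q (2 ^ (n + 1)) = b
  rw [pow_succ, mul_div_assoc', inv_div]
  field_simp

theorem exists_transcendental_tendsto : ∃ φ : ℝ, Transcendental ℚ φ ∧
    Tendsto (fun n : ℕ ↦ (p (2 ^ (n + 1)) : ℝ) / q (2 ^ (n + 1))) atTop (𝓝 φ⁻¹) := by
  obtain ⟨φ, hφ0, hlim, hφ⟩ := exists_limit
  exact ⟨φ, transcendental_of_bounds hφ0 hφ, tendsto_p_div_q hφ0.ne' hlim⟩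

end RulerFraction

open Paper Filter Real

/-- σ is transcendental over ℚ. -/
theorem sigma_transcendental (σ : ℝ)
    (hσ : Tendsto (fun n : ℕ => (p (n + 2) : ℝ) / (q (n + 2) : ℝ)) atTop (nhds σ)) :
    Transcendental ℚ σ := by
  obtain ⟨φ, hφ, hlim⟩ := RulerFraction.exists_transcendental_tendsto
  have hsub : Tendsto (fun n : ℕ ↦ 2 ^ (n + 1) - 2) atTop atTop :=
    (tendsto_sub_atTop_nat 2).comp
      ((tendsto_pow_atTop_atTop_of_one_lt one_lt_two).comp (tendsto_add_atTop_nat 1))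
  have hσφ : σ = φ⁻¹ := by
    refine tendsto_nhds_unique (hσ.comp hsub) (hlim.congr fun n ↦ ?_)
    have : 2 ≤ 2 ^ (n + 1) := Nat.le_self_pow n.succ_ne_zero 2
    rw [Function.comp_apply, Nat.sub_add_cancel this]
  rw [hσφ]
  exact fun h ↦ hφ (by simpa using h.inv)
end

section
/- There exist infinitely many pairs of positive integers (P, Q) such that |σ² − P/Q| < Q^{−8/3}. (Consequently the irrationality measure of σ² is at least 8/3.) -/
namespace Paper

open Filter

lemma s_two_pow_sub_one (n : ℕ) : s (2 ^ n - 1) = 2 ^ n := by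
  have h : 2 ^ n - 1 + 1 = 2 ^ n := Nat.sub_add_cancel Nat.one_le_two_pow
  rw [s, h, padicValNat.prime_pow]

lemma s_two_pow_add {n j : ℕ} (hj : j + 1 < 2 ^ n) : s (2 ^ n + j) = s j := by
  have hdvd {i : ℕ} (hi : i ≤ n) : 2 ^ i ∣ j + 1 + 2 ^ n ↔ 2 ^ i ∣ j + 1 :=
    (Nat.dvd_add_iff_left (pow_dvd_pow 2 hi)).symm
  have hn : ¬ 2 ^ n ∣ j + 1 := fun h => absurd (Nat.le_of_dvd j.succ_pos h) (by omega)
  have h₁ : padicValNat 2 (j + 1) ≤ n := by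
    by_contra! h
    exact hn ((pow_dvd_pow 2 h.le).trans pow_padicValNat_dvd)
  have h₂ : padicValNat 2 (j + 1 + 2 ^ n) ≤ n := by
    by_contra! h
    exact hn ((hdvd le_rfl).1 ((pow_dvd_pow 2 h.le).trans pow_padicValNat_dvd))
  rw [s, s, show 2 ^ n + j + 1 = j + 1 + 2 ^ n by ring]
  congr 1
  apply le_antisymm
  · exact (padicValNat_dvd_iff_le (by omega)).1 ((hdvd h₂).1 pow_padicValNat_dvd)
  · exact (padicValNat_dvd_iff_le (by omega)).1 ((hdvd h₁).2 pow_padicValNat_dvd)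

/-- Solutions of the recurrence defining `p` and `q` are determined by two initial values. -/
lemma shifted_eq (X : ℕ → ℤ) (hX : ∀ k, X (k + 2) = s k * X (k + 1) + X k) (n : ℕ) :
    ∀ j ≤ 2 ^ n, X (2 ^ n + j) = X (2 ^ n + 1) * p j + X (2 ^ n) * q j
  | 0, _ => by simp [p, q]
  | 1, _ => by simp [p, q]
  | j + 2, hj => by
    have h₀ := shifted_eq X hX n j (by omega)
    have h₁ := shifted_eq X hX n (j + 1) (by omega)
    rw [← add_assoc, hX, s_two_pow_add (by omega), p, q, add_assoc, h₀, h₁]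
    ring

lemma two_pow_succ_eq (X : ℕ → ℤ) (hX : ∀ k, X (k + 2) = s k * X (k + 1) + X k) (n : ℕ) :
    X (2 ^ n + 1) = 2 ^ n * X (2 ^ n) + X (2 ^ n - 1) := by
  have h := hX (2 ^ n - 1)
  have h1 : 1 ≤ 2 ^ n := Nat.one_le_two_pow
  rw [s_two_pow_sub_one, show 2 ^ n - 1 + 2 = 2 ^ n + 1 by omega,
    show 2 ^ n - 1 + 1 = 2 ^ n by omega] at h
  exact_mod_cast h

lemma two_pow_double_eq (X : ℕ → ℤ) (hX : ∀ k, X (k + 2) = s k * X (k + 1) + X k) (n : ℕ) :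
    X (2 ^ (n + 1)) =
      (2 ^ n * X (2 ^ n) + X (2 ^ n - 1)) * p (2 ^ n) + X (2 ^ n) * q (2 ^ n) := by
  rw [← two_pow_succ_eq X hX, ← shifted_eq X hX n _ le_rfl, pow_succ, mul_two]

lemma two_pow_double_sub_one_eq (X : ℕ → ℤ) (hX : ∀ k, X (k + 2) = s k * X (k + 1) + X k)
    (n : ℕ) : X (2 ^ (n + 1) - 1) =
      (2 ^ n * X (2 ^ n) + X (2 ^ n - 1)) * p (2 ^ n - 1) + X (2 ^ n) * q (2 ^ n - 1) := by
  rw [← two_pow_succ_eq X hX, ← shifted_eq X hX n _ (Nat.sub_le _ _), pow_succ, mul_two,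
    Nat.add_sub_assoc Nat.one_le_two_pow]

lemma p_rec (k : ℕ) : p (k + 2) = s k * p (k + 1) + p k := by rw [p]

lemma q_rec (k : ℕ) : q (k + 2) = s k * q (k + 1) + q k := by rw [q]

/-- The matrix of the palindrome `s_0, ..., s_{2^n - 2}` is symmetric. -/
lemma p_two_pow_sub_one (n : ℕ) : p (2 ^ n - 1) = q (2 ^ n) := by
  induction n with
  | zero => simp [p, q]
  | succ n ih =>
    rw [two_pow_double_sub_one_eq p p_rec, two_pow_double_eq q q_rec, ih]
    ring

lemma p_two_pow_succ (n : ℕ) :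
    p (2 ^ (n + 1)) = p (2 ^ n) * (2 ^ n * p (2 ^ n) + 2 * q (2 ^ n)) := by
  rw [two_pow_double_eq p p_rec, p_two_pow_sub_one]
  ring

lemma q_two_pow_succ (n : ℕ) : q (2 ^ (n + 1)) =
    2 ^ n * p (2 ^ n) * q (2 ^ n) + q (2 ^ n) ^ 2 + p (2 ^ n) * q (2 ^ n - 1) := by
  rw [two_pow_double_eq q q_rec]
  ring

lemma q_two_pow_succ_sub_one (n : ℕ) : q (2 ^ (n + 1) - 1) =
    q (2 ^ n) * (2 ^ n * q (2 ^ n) + 2 * q (2 ^ n - 1)) := by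
  rw [two_pow_double_sub_one_eq q q_rec, p_two_pow_sub_one]
  ring

lemma q_two_pow_sq {n : ℕ} (hn : 1 ≤ n) :
    q (2 ^ n) ^ 2 = p (2 ^ n) * q (2 ^ n - 1) + 1 := by
  induction n, hn using Nat.le_induction with
  | base => simp [p, q, s]
  | succ n hn ih =>
    rw [p_two_pow_succ, q_two_pow_succ, q_two_pow_succ_sub_one]
    linear_combination (q (2 ^ n) ^ 2 - p (2 ^ n) * q (2 ^ n - 1) + 1) * ih

lemma two_pow_order {n : ℕ} (hn : 1 ≤ n) :
    0 ≤ q (2 ^ n - 1) ∧ q (2 ^ n - 1) ≤ q (2 ^ n) ∧ q (2 ^ n) ≤ p (2 ^ n) ∧ 1 ≤ q (2 ^ n) := by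
  induction n, hn using Nat.le_induction with
  | base => simp [p, q, s]
  | succ n hn ih =>
    rw [p_two_pow_succ, q_two_pow_succ, q_two_pow_succ_sub_one]
    obtain ⟨hc, hcb, hba, hb⟩ := ih
    generalize p (2 ^ n) = a at *
    generalize q (2 ^ n) = b at *
    generalize q (2 ^ n - 1) = c at *
    have ht : (0 : ℤ) < 2 ^ n := by positivity
    generalize (2 : ℤ) ^ n = t at *
    have hab : b * b ≤ a * b := by gcongr
    have haa : a * b ≤ a * a := by gcongr; omega
    have hac : b * c ≤ a * c := by gcongr
    have hbc : b * c ≤ b * b := by gcongr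
    have hac' : a * c ≤ a * b := by gcongr; omega
    have h1 : 1 ≤ b * b := by nlinarith
    have h2 := mul_le_mul_of_nonneg_left hab ht.le
    have h3 := mul_le_mul_of_nonneg_left haa ht.le
    have h4 : 0 ≤ b * c := by positivity
    have h5 : 0 ≤ t * (b * b) := by positivity
    refine ⟨?_, ?_, ?_, ?_⟩ <;> linarith

lemma q_pos {k : ℕ} (hk : 2 ≤ k) : 0 < q k := by
  have hs (i : ℕ) : (0 : ℤ) < s i := by simp [s]
  have h (k : ℕ) : 0 < q (k + 2) ∧ 0 ≤ q (k + 1) := by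
    induction k with
    | zero => simp [q]
    | succ k ih =>
      refine ⟨?_, ih.1.le⟩
      rw [q_rec]
      have := mul_pos (hs (k + 1)) ih.1
      linarith [ih.2]
  obtain ⟨j, rfl⟩ := Nat.exists_eq_add_of_le' hk
  exact (h j).1

lemma two_pow_dvd_p {n : ℕ} (hn : 2 ≤ n) : (2 : ℤ) ^ n ∣ p (2 ^ n) := by
  induction n, hn using Nat.le_induction with
  | base =>
    rw [p_two_pow_succ]
    simp [p, q, s]
  | succ n hn ih =>
    rw [p_two_pow_succ, pow_succ]
    exact mul_dvd_mul ih (dvd_add ((dvd_pow_self 2 (by omega)).mul_right _) (dvd_mul_right _ _))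

lemma two_pow_dvd_q (n : ℕ) : (2 : ℤ) ^ n ∣ q (2 ^ (n + 1) - 1) := by
  induction n with
  | zero => simp
  | succ n ih =>
    rw [q_two_pow_succ_sub_one]
    refine (dvd_add (dvd_mul_right _ _) ?_).mul_left _
    rw [pow_succ']
    exact mul_dvd_mul_left 2 ih

/-- A solution of the recurrence stays nonnegative once two consecutive terms are. -/
lemma nonneg_of_rec (X : ℕ → ℤ) (hX : ∀ k, X (k + 2) = s k * X (k + 1) + X k) {m : ℕ}
    (h₀ : 0 ≤ X m) (h₁ : 0 ≤ X (m + 1)) {k : ℕ} (hk : m ≤ k) : 0 ≤ X k := by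
  suffices 0 ≤ X k ∧ 0 ≤ X (k + 1) from this.1
  induction k, hk using Nat.le_induction with
  | base => exact ⟨h₀, h₁⟩
  | succ k _ ih =>
    refine ⟨ih.2, ?_⟩
    rw [hX]
    exact add_nonneg (mul_nonneg (Nat.cast_nonneg _) ih.2) ih.1

lemma p_two_pow_mul_q_le {n k : ℕ} (hn : 1 ≤ n) (hk : 2 ^ n ≤ k) :
    p (2 ^ n) * q k ≤ p k * q (2 ^ n) := by
  have h := nonneg_of_rec (fun k => p k * q (2 ^ n) - p (2 ^ n) * q k)
    (fun k => by simp only [p_rec, q_rec]; ring) (m := 2 ^ n) (by simp) ?_ hk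
  · exact sub_nonneg.1 h
  · have h := q_two_pow_sq hn
    simp only [two_pow_succ_eq p p_rec, two_pow_succ_eq q q_rec, p_two_pow_sub_one]
    nlinarith

lemma p_mul_q_two_pow_sub_one_le {n k : ℕ} (hn : 1 ≤ n) (hk : 2 ^ n ≤ k) :
    p k * q (2 ^ n - 1) ≤ q (2 ^ n) * q k := by
  have h := nonneg_of_rec (fun k => q (2 ^ n) * q k - p k * q (2 ^ n - 1))
    (fun k => by simp only [p_rec, q_rec]; ring) (m := 2 ^ n) ?_ ?_ hk
  · exact sub_nonneg.1 h
  · have h := q_two_pow_sq hn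
    nlinarith
  · have h := q_two_pow_sq hn
    simp only [two_pow_succ_eq p p_rec, two_pow_succ_eq q q_rec, p_two_pow_sub_one]
    have ht : (0 : ℤ) < 2 ^ n := by positivity
    nlinarith

lemma q_two_pow_sub_one_pos {n : ℕ} (hn : 2 ≤ n) : 0 < q (2 ^ n - 1) :=
  q_pos (by have := Nat.pow_le_pow_right (n := 2) (by norm_num) hn; omega)

/-- The fraction `g n / c n` approximates `σ ^ 2` with error at most `(c n)⁻²`, where
`g n = p (2 ^ n)` and `c n = q (2 ^ n - 1)`. -/
lemma abs_sq_sub_le {σ : ℝ}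
    (hσ : Tendsto (fun n : ℕ => (p (n + 2) : ℝ) / (q (n + 2) : ℝ)) atTop (nhds σ))
    {n : ℕ} (hn : 2 ≤ n) :
    |σ ^ 2 - (p (2 ^ n) : ℝ) / q (2 ^ n - 1)| ≤ ((q (2 ^ n - 1) : ℝ) ^ 2)⁻¹ := by
  have hn1 : 1 ≤ n := by omega
  obtain ⟨-, -, hba, hb⟩ := two_pow_order hn1
  have hc : (0 : ℝ) < q (2 ^ n - 1) := mod_cast q_two_pow_sub_one_pos hn
  have hb' : (0 : ℝ) < q (2 ^ n) := mod_cast hb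
  have ha : (0 : ℝ) < p (2 ^ n) := mod_cast (by omega : 0 < p (2 ^ n))
  have hq (k : ℕ) : (0 : ℝ) < q (k + 2) := mod_cast q_pos (by omega)
  have hlow : (p (2 ^ n) : ℝ) / q (2 ^ n) ≤ σ := by
    refine ge_of_tendsto hσ (eventually_atTop.2 ⟨2 ^ n, fun k hk => ?_⟩)
    rw [div_le_div_iff₀ hb' (hq k)]
    exact_mod_cast p_two_pow_mul_q_le hn1 (by omega : 2 ^ n ≤ k + 2)
  have hupp : σ ≤ (q (2 ^ n) : ℝ) / q (2 ^ n - 1) := by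
    refine le_of_tendsto hσ (eventually_atTop.2 ⟨2 ^ n, fun k hk => ?_⟩)
    rw [div_le_div_iff₀ (hq k) hc]
    exact_mod_cast p_mul_q_two_pow_sub_one_le hn1 (by omega : 2 ^ n ≤ k + 2)
  have hdet : (q (2 ^ n) : ℝ) ^ 2 = p (2 ^ n) * q (2 ^ n - 1) + 1 := mod_cast q_two_pow_sq hn1
  generalize (p (2 ^ n) : ℝ) = a at *
  generalize (q (2 ^ n) : ℝ) = b at *
  generalize (q (2 ^ n - 1) : ℝ) = c at *
  have hσ0 : 0 ≤ σ := le_trans (by positivity) hlow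
  have h1 : (a / b) ^ 2 ≤ σ ^ 2 := by gcongr
  have h2 : σ ^ 2 ≤ (b / c) ^ 2 := by gcongr
  have h3 : (b / c) ^ 2 - a / c = (c ^ 2)⁻¹ := by
    field_simp
    linarith
  have h4 : a / c - (a / b) ^ 2 ≤ (c ^ 2)⁻¹ := by
    have : a / c - (a / b) ^ 2 = a * c / b ^ 2 * (c ^ 2)⁻¹ := by
      field_simp
      linear_combination hdet
    rw [this]
    refine mul_le_of_le_one_left (by positivity) ?_
    rw [div_le_one (by positivity)]
    linarith
  rw [abs_le]
  constructor <;> linarith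

/-- For `h = 2 ^ n * r n`, where `r n = 2 ^ n * p (2 ^ n) + 2 * q (2 ^ n)`, both `p (2 ^ (n + 2))`
and `q (2 ^ (n + 2) - 1)` are divisible by `h`, and the second quotient is smaller than `h ^ 3`. -/
lemma exists_common_factor {n : ℕ} (hn : 2 ≤ n) : ∃ P Q h : ℤ, 0 < P ∧ 2 ^ n < Q ∧ 0 < h ∧
    p (2 ^ (n + 2)) = h * P ∧ q (2 ^ (n + 2) - 1) = h * Q ∧ Q < h ^ 3 := by
  obtain ⟨hc, hcb, hba, hb⟩ := two_pow_order (show 1 ≤ n by omega)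
  have hdet := q_two_pow_sq (show 1 ≤ n by omega)
  obtain ⟨a', ha'⟩ := two_pow_dvd_p hn
  obtain ⟨k, rfl⟩ : ∃ k, n = k + 1 := ⟨n - 1, by omega⟩
  obtain ⟨m, hm⟩ := two_pow_dvd_q k
  have hb1 := q_two_pow_succ (k + 1)
  have ha2 := p_two_pow_succ (k + 2)
  have ha1 := p_two_pow_succ (k + 1)
  have hc2 := q_two_pow_succ_sub_one (k + 2)
  have hc1 := q_two_pow_succ_sub_one (k + 1)
  have ht : (2 : ℤ) ≤ 2 ^ k := le_self_pow₀ (by norm_num) (by omega)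
  simp only [show k + 1 + 1 = k + 2 by ring, show k + 2 + 1 = k + 1 + 2 by ring] at *
  simp only [pow_add (2 : ℤ)] at *
  generalize p (2 ^ (k + 1)) = a at *
  generalize q (2 ^ (k + 1)) = b at *
  generalize q (2 ^ (k + 1) - 1) = c at *
  generalize (2 : ℤ) ^ k = t at *
  generalize p (2 ^ (k + 2)) = a₁ at *
  generalize q (2 ^ (k + 2)) = b₁ at *
  generalize q (2 ^ (k + 2) - 1) = c₁ at *
  have hm0 : 0 ≤ m := by nlinarith
  have hmc : m ≤ c := by nlinarith
  have hb1' : b₁ = b * (2 * t * a + 2 * b) - 1 := by linear_combination hb1 - hdet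
  have hb1t : 2 * t < b₁ := by nlinarith [mul_le_mul hba hb (by norm_num) (by omega)]
  have hr0 : 0 < 2 * t * a + 2 * b := by nlinarith
  have hbr : b ≤ 2 * t * a + 2 * b := by nlinarith
  have hmr : 2 * b + m ≤ 2 * t * a + 2 * b := by nlinarith
  refine ⟨2 * a' * (2 * t * a * (2 * t * a + 2 * b) + b₁), b₁ * (2 * b + m),
    2 * t * (2 * t * a + 2 * b), ?_, ?_, by positivity, ?_, ?_, ?_⟩
  · have : 0 < a' := by
      by_contra! h
      nlinarith
    have : 0 < a := by omega
    have : 0 < b₁ := by omega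
    positivity
  · nlinarith
  · rw [ha2, ha1]
    linear_combination 2 * (2 * t * a + 2 * b) * (2 * t * a * (2 * t * a + 2 * b) + b₁) * ha'
  · rw [hc2, hc1]
    linear_combination b₁ * (4 * t * hb1' + 4 * t * hdet + 2 * (2 * t * a + 2 * b) * hm)
  · generalize 2 * t * a + 2 * b = r at *
    have h1 : b₁ ≤ r * r := by nlinarith
    calc b₁ * (2 * b + m) ≤ (r * r) * r := by gcongr
      _ = 1 * r ^ 3 := by ring
      _ < (2 * t) ^ 3 * r ^ 3 := by
        gcongr
        exact one_lt_pow₀ (by omega) (by norm_num)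
      _ = (2 * t * r) ^ 3 := by ring

lemma inv_sq_mul_lt_rpow {Q h : ℝ} (hQ : 0 < Q) (hh : 0 < h) (hlt : Q < h ^ 3) :
    ((h * Q) ^ 2)⁻¹ < Q ^ (-(8 / 3 : ℝ)) := by
  rw [Real.rpow_neg hQ.le]
  refine inv_strictAnti₀ (by positivity) ?_
  have h1 : Q ^ (2 / 3 : ℝ) < h ^ 2 := by
    calc Q ^ (2 / 3 : ℝ) < (h ^ 3) ^ (2 / 3 : ℝ) := by gcongr
      _ = h ^ 2 := by
        rw [← Real.rpow_natCast, ← Real.rpow_natCast, ← Real.rpow_mul hh.le]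
        norm_num
  calc Q ^ (8 / 3 : ℝ) = Q ^ (2 / 3 : ℝ) * Q ^ 2 := by
        rw [← Real.rpow_natCast Q, ← Real.rpow_add hQ]
        norm_num
    _ < h ^ 2 * Q ^ 2 := by gcongr
    _ = (h * Q) ^ 2 := by ring

end Paper

open Paper Filter Real

/-- There are infinitely many pairs of positive integers (P, Q) with
|σ² − P/Q| < Q^{−8/3}. -/
theorem sigma_sq_irrationality_measure (σ : ℝ)
    (hσ : Tendsto (fun n : ℕ => (p (n + 2) : ℝ) / (q (n + 2) : ℝ)) atTop (nhds σ)) :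
    {PQ : ℕ × ℕ | 0 < PQ.1 ∧ 0 < PQ.2 ∧
      |σ ^ 2 - (PQ.1 : ℝ) / (PQ.2 : ℝ)| < (PQ.2 : ℝ) ^ (-(8 / 3 : ℝ))}.Infinite := by
  refine Set.Infinite.of_image Prod.snd (Set.infinite_of_forall_exists_gt fun N => ?_)
  obtain ⟨P, Q, h, hP, hQ, hh, hPeq, hQeq, hlt⟩ :=
    exists_common_factor (n := N + 2) (by omega)
  have hQ0 : 0 < Q := lt_trans (by positivity) hQ
  have hN : N < 2 ^ (N + 2) :=
    Nat.lt_two_pow_self.trans (Nat.pow_lt_pow_right (by norm_num) (by omega))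
  lift P to ℕ using hP.le
  lift Q to ℕ using hQ0.le
  refine ⟨Q, ⟨(P, Q), ⟨by exact_mod_cast hP, by exact_mod_cast hQ0, ?_⟩, rfl⟩, ?_⟩
  · have hQr : (0 : ℝ) < Q := mod_cast hQ0
    have hhr : (0 : ℝ) < h := mod_cast hh
    have key := abs_sq_sub_le hσ (n := N + 2 + 2) (by omega)
    rw [hPeq, hQeq] at key
    push_cast at key
    rw [mul_div_mul_left _ _ hhr.ne'] at key
    exact key.trans_lt (inv_sq_mul_lt_rpow hQr hhr (by exact_mod_cast hlt))
  · exact hN.trans (by exact_mod_cast hQ)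
end

section
/- Let a_0 be a positive integer and let w be a finite palindrome of positive integers with M(w) = [[α, β],[γ, δ]] (so β = γ). If y is a positive real number satisfying y·(α(a_0 + y) + β) = (a_0 α + β)(a_0 + y) + a_0 β + δ (i.e., y = [a_0; w, a_0 + y]), then y² = (a_0² α + 2 a_0 β + δ)/α; in particular y = √(p/q) with p = a_0² α + 2 a_0 β + δ and q = α positive integers. -/
open Paper Filter Real

theorem Paper.M_cons (a : ℤ) (l : List ℤ) : M (a :: l) = !![a, 1; 1, 0] * M l := by
  simp [M]

theorem Paper.M_pos_of_pos (l : List ℤ) (hpos : ∀ a ∈ l, 0 < a) :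
    0 < M l 0 0 ∧ 0 ≤ M l 0 1 ∧ 0 ≤ M l 1 0 ∧ 0 ≤ M l 1 1 := by
  induction l with
  | nil => simp [M]
  | cons a l ih =>
    obtain ⟨h₀₀, h₀₁, h₁₀, h₁₁⟩ := ih fun b hb => hpos b (List.mem_cons_of_mem a hb)
    have ha : 0 < a := hpos a List.mem_cons_self
    simp only [M_cons, Matrix.mul_apply, Fin.sum_univ_two, Matrix.of_apply, Matrix.cons_val',
      Matrix.cons_val_zero, Matrix.cons_val_one, Matrix.cons_val_fin_one]
    refine ⟨?_, ?_, ?_, ?_⟩ <;> positivity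

/-- If `y = [a₀; w, a₀ + y]` with `w` a palindrome of positive integers and
`M(w) = [[α, β],[γ, δ]]`, then `y² = (a₀²α + 2a₀β + δ)/α`, i.e.
`y = √(p/q)` with `p = a₀²α + 2a₀β + δ` and `q = α` positive integers. -/
theorem sqrt_of_palindromic_cf (a₀ : ℤ) (ha₀ : 0 < a₀)
    (l : List ℤ) (hpos : ∀ a ∈ l, 0 < a) (hpal : l.reverse = l)
    (Y : ℝ) (hY : 0 < Y)
    (heq : Y * ((M l 0 0 : ℝ) * ((a₀ : ℝ) + Y) + (M l 0 1 : ℝ)) =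
      ((a₀ : ℝ) * (M l 0 0 : ℝ) + (M l 0 1 : ℝ)) * ((a₀ : ℝ) + Y)
        + (a₀ : ℝ) * (M l 0 1 : ℝ) + (M l 1 1 : ℝ)) :
    Y ^ 2 = ((a₀ ^ 2 * M l 0 0 + 2 * a₀ * M l 0 1 + M l 1 1 : ℤ) : ℝ) / ((M l 0 0 : ℤ) : ℝ) ∧
    Y = Real.sqrt (((a₀ ^ 2 * M l 0 0 + 2 * a₀ * M l 0 1 + M l 1 1 : ℤ) : ℝ) /
      ((M l 0 0 : ℤ) : ℝ)) ∧
    0 < a₀ ^ 2 * M l 0 0 + 2 * a₀ * M l 0 1 + M l 1 1 ∧ 0 < M l 0 0 := by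
  obtain ⟨hα, hβ, -, hδ⟩ := M_pos_of_pos l hpos
  have hsq : Y ^ 2 = ((a₀ ^ 2 * M l 0 0 + 2 * a₀ * M l 0 1 + M l 1 1 : ℤ) : ℝ) /
      ((M l 0 0 : ℤ) : ℝ) := by
    have hα' : ((M l 0 0 : ℤ) : ℝ) ≠ 0 := by exact_mod_cast hα.ne'
    rw [eq_div_iff hα']
    push_cast
    linear_combination heq
  exact ⟨hsq, by rw [← hsq, Real.sqrt_sq hY.le], by positivity, hα⟩
end

section
/- For every n ≥ 2, u(n+1) is the concatenation of v(n), the single term 2^n, and the reversal of v(n); that is, u(n+1) = (v(n), 2^n, v(n)^R). -/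
open Paper Filter Real

theorem padicValNat_le_of_add_eq_prime_pow {p a b m : ℕ} [Fact p.Prime] (ha : 0 < a) (hb : 0 < b)
    (h : a + b = p ^ m) : padicValNat p a ≤ padicValNat p b := by
  have hle : padicValNat p a ≤ m := by
    refine (Nat.pow_le_pow_iff_right (Fact.out : p.Prime).one_lt).1 ?_
    have := Nat.le_of_dvd ha (pow_padicValNat_dvd (p := p) (n := a))
    omega
  rw [← padicValNat_dvd_iff_le hb.ne',
    ← Nat.dvd_add_right (pow_padicValNat_dvd (p := p) (n := a)), h]
  exact pow_dvd_pow p hle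

theorem padicValNat_eq_of_add_eq_prime_pow {p a b m : ℕ} [Fact p.Prime] (ha : 0 < a) (hb : 0 < b)
    (h : a + b = p ^ m) : padicValNat p a = padicValNat p b :=
  le_antisymm (padicValNat_le_of_add_eq_prime_pow ha hb h)
    (padicValNat_le_of_add_eq_prime_pow hb ha (by rwa [add_comm]))

/-- For n ≥ 2, `u(n+1) = (v(n), 2^n, v(n)^R)`. -/
theorem u_succ_eq (n : ℕ) (hn : 2 ≤ n) :
    u (n + 1) = v n ++ [(2 ^ n : ℤ)] ++ (v n).reverse := by
  have h4 : 4 ≤ 2 ^ n := by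
    simpa using Nat.pow_le_pow_right (n := 2) two_pos hn
  have hpow : 2 ^ (n + 1) = 2 * 2 ^ n := pow_succ' 2 n
  refine List.ext_getElem (by simp [u, v]; omega) fun k hk _ => ?_
  simp only [u, List.length_map, List.length_range] at hk
  rcases lt_trichotomy k (2 ^ n - 2) with h | h | h
  · simp [u, v, h]
  · have hs : 2 ^ n - 2 + 1 + 1 = 2 ^ n := by omega
    simp [u, v, s, hs, h]
  · have h2 : ¬ k < 2 ^ n - 2 + 1 := by omega
    simp only [u, v, s, List.getElem_append, List.length_append, List.length_map,
      List.length_range, List.length_singleton, h2, dite_false, List.getElem_map,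
      List.getElem_range, List.getElem_reverse]
    have hval : padicValNat 2 (k + 1 + 1) =
        padicValNat 2 (2 ^ n - 2 - 1 - (k - (2 ^ n - 2 + 1)) + 1 + 1) :=
      padicValNat_eq_of_add_eq_prime_pow (m := n + 1) (by omega) (by omega) (by omega)
    rw [hval]
end
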